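/- (Segre's deformation classification of real Schläfli sixes) Consider the equivalence relation on real Schläfli sixes in which two Schläfli sixes are equivalent if and only if they are connected by a continuous family of real Schläfli sixes (a deformation through configurations of six pairwise skew lines all of which are contained in some nonsingular cubic surface at every moment). This relation has exactly 7 equivalence classes. -/

import Mathlib

open Submodule

abbrev V4 : Type := Fin 4 → ℝ

abbrev PLine : Type := Submodule ℝ V4

def IsLine (P : PLine) : Prop := Module.finrank ℝ P = 2

def Skew (P Q : PLine) : Prop := IsLine P ∧ IsLine Q ∧ P ⊓ Q = ⊥

def PairwiseSkew {n : ℕ} (L : Fin n → PLine) : Prop :=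
  ∀ i j : Fin n, i ≠ j → Skew (L i) (L j)

noncomputable def det2 (a b c d : V4) : ℝ := Matrix.det (Matrix.of ![a, b, c, d])

open Classical in
noncomputable def lk (P Q R : PLine) : ℝ :=
  if h : ∃ v : Fin 6 → V4,
      P = span ℝ {v 0, v 1} ∧ Q = span ℝ {v 2, v 3} ∧ R = span ℝ {v 4, v 5} then
    Real.sign (det2 (h.choose 0) (h.choose 1) (h.choose 2) (h.choose 3) *
      det2 (h.choose 0) (h.choose 1) (h.choose 4) (h.choose 5) *
      det2 (h.choose 2) (h.choose 3) (h.choose 4) (h.choose 5))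
  else 0

noncomputable def sgnOf {n : ℕ} (L : Fin n → PLine) : ℝ :=
  ∑ i : Fin n, ∑ j : Fin n, ∑ k : Fin n,
    if i < j ∧ j < k then lk (L i) (L j) (L k) else 0

def ContinuousLineFamily (L : ℝ → PLine) : Prop :=
  ∃ v w : ℝ → V4, ContinuousOn v (Set.Icc 0 1) ∧ ContinuousOn w (Set.Icc 0 1) ∧
    ∀ t ∈ Set.Icc (0:ℝ) 1, L t = span ℝ {v t, w t}

def Deformation {n : ℕ} (L L' : Fin n → PLine) : Prop :=
  ∃ F : ℝ → Fin n → PLine,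
    (∀ i, ContinuousLineFamily (fun t => F t i)) ∧
    (∀ t ∈ Set.Icc (0:ℝ) 1, PairwiseSkew (F t)) ∧
    F 0 = L ∧ F 1 = L'

def DeformEquiv {n : ℕ} (L L' : Fin n → PLine) : Prop :=
  ∃ π π' : Equiv.Perm (Fin n), Deformation (L ∘ π) (L' ∘ π')

def IsMirror {n : ℕ} (L L' : Fin n → PLine) : Prop :=
  ∃ A : V4 →ₗ[ℝ] V4, LinearMap.det A < 0 ∧ ∀ i, L' i = (L i).map A

def CoarseDeformEquiv {n : ℕ} (L L' : Fin n → PLine) : Prop :=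
  DeformEquiv L L' ∨ ∃ M : Fin n → PLine, IsMirror L' M ∧ DeformEquiv L M

noncomputable def joinConfig {n : ℕ} (σ : Equiv.Perm (Fin n)) : Fin n → PLine :=
  fun i => span ℝ {![1, (i.val : ℝ) + 1, 0, 0], ![0, 0, ((σ i).val : ℝ) + 1, 1]}

def IsSchlafliSix (L : Fin 6 → PLine) : Prop :=
  PairwiseSkew L ∧
  ∃ F : MvPolynomial (Fin 4) ℝ,
    F ≠ 0 ∧ F.IsHomogeneous 3 ∧
    (∀ i : Fin 6, ∀ x ∈ L i, MvPolynomial.eval x F = 0) ∧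
    (∀ z : Fin 4 → ℂ, z ≠ 0 →
      MvPolynomial.eval z (MvPolynomial.map (algebraMap ℝ ℂ) F) = 0 →
      ∃ j : Fin 4, MvPolynomial.eval z (MvPolynomial.map (algebraMap ℝ ℂ) (MvPolynomial.pderiv j F)) ≠ 0)

def Reducible {n : ℕ} (L : Fin n → PLine) : Prop :=
  ∃ i j : Fin n, i ≠ j ∧ ∃ F : ℝ → Fin n → PLine,
    (∀ k, ContinuousLineFamily (fun t => F t k)) ∧
    F 0 = L ∧
    (∀ t ∈ Set.Ico (0:ℝ) 1, PairwiseSkew (F t)) ∧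
    F 1 i = F 1 j ∧
    (∀ k l : Fin n, k ≠ l → ¬(k = i ∧ l = j) → ¬(k = j ∧ l = i) → Skew (F 1 k) (F 1 l))


def SchlafliDeformation (L L' : Fin 6 → PLine) : Prop :=
  ∃ π π' : Equiv.Perm (Fin 6), ∃ F : ℝ → Fin 6 → PLine,
    (∀ i, ContinuousLineFamily (fun t => F t i)) ∧
    (∀ t ∈ Set.Icc (0:ℝ) 1, IsSchlafliSix (F t)) ∧
    F 0 = L ∘ π ∧ F 1 = L' ∘ π'

open MvPolynomial in
theorem pderiv_pderiv_swap (i j : Fin 4) (F : MvPolynomial (Fin 4) ℝ) :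
    pderiv i (pderiv j F) = pderiv j (pderiv i F) := by
  have h : ⁅(pderiv i : Derivation ℝ (MvPolynomial (Fin 4) ℝ) (MvPolynomial (Fin 4) ℝ)), (pderiv j : Derivation ℝ (MvPolynomial (Fin 4) ℝ) (MvPolynomial (Fin 4) ℝ))⁆ = 0 := by
    apply derivation_ext
    intro k
    simp [Derivation.commutator_apply, pderiv_X, Pi.single_apply]
    split_ifs <;> simp
  have := congrArg (fun D => D F) h
  simpa [Derivation.commutator_apply, sub_eq_zero] using this

/-- Symmetric trilinear forms on `V4`, the polarizations of cubic forms. -/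
structure SymTri (T : V4 → V4 → V4 → ℝ) : Prop where
  add : ∀ x x' y z, T (x + x') y z = T x y z + T x' y z
  smul : ∀ (c : ℝ) x y z, T (c • x) y z = c * T x y z
  swap : ∀ x y z, T x y z = T y x z
  rot : ∀ x y z, T x y z = T y z x

/-- Nonsingularity of the cubic `T x x x` over `ℂ`, for `z = a + i b`. -/
def NonSing (T : V4 → V4 → V4 → ℝ) : Prop :=
  ∀ a b : V4, (∀ w, T a a w = T b b w) → (∀ w, T a b w = 0) → a = 0 ∧ b = 0

namespace SymTri
variable {T : V4 → V4 → V4 → ℝ} (h : SymTri T)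
include h

theorem swap' (x y z : V4) : T x y z = T x z y := by
  rw [h.rot x y z, h.swap]; rw [← h.rot]

theorem sum {ι : Type*} (s : Finset ι) (f : ι → V4) (y z : V4) :
    T (∑ i ∈ s, f i) y z = ∑ i ∈ s, T (f i) y z := by
  classical
  induction s using Finset.induction_on with
  | empty => simpa using h.smul 0 0 y z
  | insert a s ha ih => rw [Finset.sum_insert ha, Finset.sum_insert ha, h.add, ih]

theorem expand (x y z : V4) :
    T x y z = ∑ j, x j * T (Pi.single j 1) y z := by
  conv_lhs => rw [pi_eq_sum_univ' x]
  rw [h.sum]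
  refine Finset.sum_congr rfl fun j _ => ?_
  rw [h.smul]

theorem comp (A : V4 →ₗ[ℝ] V4) : SymTri (fun x y z => T (A x) (A y) (A z)) where
  add x x' y z := by simp [h.add]
  smul c x y z := by simp [h.smul]
  swap x y z := h.swap _ _ _
  rot x y z := h.rot _ _ _
end SymTri

theorem NonSing.comp {T : V4 → V4 → V4 → ℝ} (h : NonSing T) (A : V4 ≃ₗ[ℝ] V4) :
    NonSing (fun x y z => T (A x) (A y) (A z)) := by
  intro a b h1 h2
  simpa using h (A a) (A b) (fun w => by simpa using h1 (A.symm w)) (fun w => by simpa using h2 (A.symm w))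

section
open MvPolynomial
variable {F : MvPolynomial (Fin 4) ℝ}

noncomputable def thirdDeriv (F : MvPolynomial (Fin 4) ℝ) (j k l : Fin 4) : ℝ :=
  eval 0 (pderiv l (pderiv k (pderiv j F)))

noncomputable def polarForm (F : MvPolynomial (Fin 4) ℝ) (x y z : V4) : ℝ :=
  ∑ j, ∑ k, ∑ l, thirdDeriv F j k l * x j * y k * z l

theorem thirdDeriv_swap (F : MvPolynomial (Fin 4) ℝ) (j k l : Fin 4) :
    thirdDeriv F j k l = thirdDeriv F k j l := by
  unfold thirdDeriv; rw [pderiv_pderiv_swap k j]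

theorem thirdDeriv_swap' (F : MvPolynomial (Fin 4) ℝ) (j k l : Fin 4) :
    thirdDeriv F j k l = thirdDeriv F j l k := by
  unfold thirdDeriv; rw [pderiv_pderiv_swap l k]

theorem symTri_polarForm (F : MvPolynomial (Fin 4) ℝ) : SymTri (polarForm F) where
  add x x' y z := by
    simp only [polarForm, ← Finset.sum_add_distrib]
    refine Finset.sum_congr rfl fun j _ => Finset.sum_congr rfl fun k _ =>
      Finset.sum_congr rfl fun l _ => ?_
    simp; ring
  smul c x y z := by
    simp only [polarForm, Finset.mul_sum]
    refine Finset.sum_congr rfl fun j _ => Finset.sum_congr rfl fun k _ =>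
      Finset.sum_congr rfl fun l _ => ?_
    simp; ring
  swap x y z := by
    simp only [polarForm]
    rw [Finset.sum_comm]
    refine Finset.sum_congr rfl fun j _ => Finset.sum_congr rfl fun k _ =>
      Finset.sum_congr rfl fun l _ => ?_
    rw [thirdDeriv_swap]; ring
  rot x y z := by
    simp only [polarForm]
    rw [Finset.sum_comm]
    refine Finset.sum_congr rfl fun j _ => ?_
    rw [Finset.sum_comm]
    refine Finset.sum_congr rfl fun k _ =>
      Finset.sum_congr rfl fun l _ => ?_
    rw [thirdDeriv_swap, thirdDeriv_swap']; ring

theorem aeval_euler {G : MvPolynomial (Fin 4) ℝ} {n : ℕ} (hG : G.IsHomogeneous n)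
    {K : Type*} [Field K] [Algebra ℝ K] (z : Fin 4 → K) :
    ∑ j, z j * aeval z (pderiv j G) = n * aeval z G := by
  have := congrArg (aeval z) hG.sum_X_mul_pderiv
  simpa using this

theorem aeval_second (hF : F.IsHomogeneous 3) {K : Type*} [Field K] [Algebra ℝ K]
    (z : Fin 4 → K) (j : Fin 4) :
    2 * aeval z (pderiv j F) = ∑ k, ∑ l, algebraMap ℝ K (thirdDeriv F j k l) * z k * z l := by
  have h2 : (pderiv j F).IsHomogeneous 2 := hF.pderiv
  have h := aeval_euler h2 z
  push_cast at h
  rw [← h]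
  refine Finset.sum_congr rfl fun k _ => ?_
  have h1 : (pderiv k (pderiv j F)).IsHomogeneous 1 := h2.pderiv
  have h := aeval_euler h1 z
  push_cast at h
  rw [one_mul] at h
  rw [← h, Finset.mul_sum]
  refine Finset.sum_congr rfl fun l _ => ?_
  have h0 : (pderiv l (pderiv k (pderiv j F))).IsHomogeneous 0 := h1.pderiv
  have := totalDegree_eq_zero_iff_eq_C.1 ((totalDegree_zero_iff_isHomogeneous _).2 h0)
  unfold thirdDeriv
  rw [this]
  simp; ring

theorem polarForm_self (hF : F.IsHomogeneous 3) (x : V4) :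
    polarForm F x x x = 6 * eval x F := by
  have h := aeval_euler hF x
  have h2 := fun j => aeval_second hF x j
  simp only [aeval_eq_eval] at h h2
  push_cast at h
  have : polarForm F x x x = ∑ j, x j * (2 * eval x (pderiv j F)) := by
    unfold polarForm
    refine Finset.sum_congr rfl fun j _ => ?_
    rw [h2, Finset.mul_sum]
    refine Finset.sum_congr rfl fun k _ => ?_
    rw [Finset.mul_sum]
    refine Finset.sum_congr rfl fun l _ => ?_
    simp; ring
  rw [this]
  calc _ = 2 * ∑ j, x j * eval x (pderiv j F) := by
        rw [Finset.mul_sum]; exact Finset.sum_congr rfl fun j _ => by ring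
    _ = _ := by rw [h]; ring

/-- The cubic polynomial of a trilinear form. -/
noncomputable def cubicOf (T : V4 → V4 → V4 → ℝ) : MvPolynomial (Fin 4) ℝ :=
  ∑ j, ∑ k, ∑ l, C (T (Pi.single j 1) (Pi.single k 1) (Pi.single l 1)) * (X j * X k * X l)

variable {T : V4 → V4 → V4 → ℝ} (hT : SymTri T)
include hT

theorem SymTri.expand_sum (x y z : V4) :
    T x y z = ∑ j, ∑ k, ∑ l,
      T (Pi.single j 1) (Pi.single k 1) (Pi.single l 1) * x j * y k * z l := by
  rw [hT.expand]
  refine Finset.sum_congr rfl fun j _ => ?_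
  rw [hT.swap, hT.expand, Finset.mul_sum]
  refine Finset.sum_congr rfl fun k _ => ?_
  rw [← hT.rot, hT.expand, Finset.mul_sum, Finset.mul_sum]
  refine Finset.sum_congr rfl fun l _ => ?_
  rw [hT.rot (Pi.single l 1), hT.swap (Pi.single k 1)]; ring

theorem eval_cubicOf (x : V4) : eval x (cubicOf T) = T x x x := by
  rw [hT.expand_sum]
  simp [cubicOf, map_sum]
  refine Finset.sum_congr rfl fun j _ => Finset.sum_congr rfl fun k _ =>
      Finset.sum_congr rfl fun l _ => by ring

omit hT in
theorem isHomogeneous_cubicOf : (cubicOf T).IsHomogeneous 3 := by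
  refine IsHomogeneous.sum _ _ _ fun j _ => IsHomogeneous.sum _ _ _ fun k _ =>
    IsHomogeneous.sum _ _ _ fun l _ => ?_
  have := (isHomogeneous_C (Fin 4) (T (Pi.single j 1) (Pi.single k 1) (Pi.single l 1))).mul
    (((isHomogeneous_X ℝ j).mul (isHomogeneous_X ℝ k)).mul (isHomogeneous_X ℝ l))
  simpa using this

omit hT in
theorem SymTri.expand3 (hT : SymTri T) (x y z : V4) :
    T (x + y + z) (x + y + z) (x + y + z) = T x x x + T y y y + T z z z
      + 3 * T x x y + 3 * T x x z + 3 * T y y x + 3 * T y y z + 3 * T z z x + 3 * T z z y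
      + 6 * T x y z := by
  have add2 : ∀ u x x' z, T u (x + x') z = T u x z + T u x' z := by
    intro u x x' z; rw [hT.swap, hT.add, hT.swap x, hT.swap x']
  have add3 : ∀ u v x x', T u v (x + x') = T u v x + T u v x' := by
    intro u v x x'; rw [hT.swap', add2, hT.swap' u x, hT.swap' u x']
  simp only [hT.add, add2, add3]
  have q1 : ∀ u v, T u v u = T u u v := fun u v => hT.swap' u v u
  have q2 : ∀ u v, T v u u = T u u v := fun u v => by rw [hT.swap, q1]
  linarith [q1 x y, q2 x y, q1 x z, q2 x z, q1 y x, q2 y x, q1 y z, q2 y z, q1 z x, q2 z x,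
    q1 z y, q2 z y, hT.swap' x z y, hT.swap y x z, hT.rot x y z, hT.rot y z x, hT.swap z y x]

omit hT in
theorem SymTri.eq_of_diag {T' : V4 → V4 → V4 → ℝ} (hT : SymTri T) (hT' : SymTri T')
    (h : ∀ x, T x x x = T' x x x) (x y z : V4) : T x y z = T' x y z := by
  have e : ∀ {S : V4 → V4 → V4 → ℝ}, SymTri S → ∀ x y, S (x + y) (x + y) (x + y) + S (x + (-1:ℝ) • y) (x + (-1:ℝ) • y) (x + (-1:ℝ) • y) = 2 * S x x x + 6 * S y y x := by
    intro S hS x y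
    have h1 := hS.expand3 x y 0
    have h2 := hS.expand3 x ((-1:ℝ) • y) 0
    have z1 : ∀ u v, S 0 u v = 0 := fun u v => by simpa using hS.smul 0 0 u v
    have z2 : ∀ u v, S u 0 v = 0 := fun u v => by rw [hS.swap, z1]
    have z3 : ∀ u v, S u v 0 = 0 := fun u v => by rw [hS.swap', z2]
    have n1 : ∀ u v, S ((-1:ℝ) • y) u v = - S y u v := fun u v => by rw [hS.smul]; ring
    have n2 : ∀ u v, S u ((-1:ℝ) • y) v = - S u y v := fun u v => by rw [hS.swap, n1, hS.swap]
    have n3 : ∀ u v, S u v ((-1:ℝ) • y) = - S u v y := fun u v => by rw [hS.swap', n2, hS.swap']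
    simp only [z1, z3, n1, n2, n3, add_zero] at h1 h2
    rw [h1, h2]; ring
  have e2 : ∀ x y, T y y x = T' y y x := by
    intro x y
    have h1 := e hT x y
    have h2 := e hT' x y
    simp only [h] at h1
    linarith
  have h1 := hT.expand3 x y z
  have h2 := hT'.expand3 x y z
  simp only [h, e2] at h1
  linarith

theorem aeval_pderiv_cubicOf (z : Fin 4 → ℂ) (i : Fin 4) :
    aeval z (pderiv i (cubicOf T)) =
      3 * ∑ k, ∑ l, (T (Pi.single i 1) (Pi.single k 1) (Pi.single l 1) : ℂ) * z k * z l := by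
  have h6 : ∀ j k l, thirdDeriv (cubicOf T) j k l =
      6 * T (Pi.single j 1) (Pi.single k 1) (Pi.single l 1) := by
    intro j k l
    have hS : SymTri (fun x y z => 6 * T x y z) :=
      ⟨fun x x' y z => by simp only [hT.add]; ring, fun c x y z => by simp only [hT.smul]; ring,
        fun x y z => by rw [hT.swap], fun x y z => by rw [hT.rot]⟩
    have := (symTri_polarForm (cubicOf T)).eq_of_diag hS
      (fun x => by rw [polarForm_self isHomogeneous_cubicOf, eval_cubicOf hT])
      (Pi.single j 1) (Pi.single k 1) (Pi.single l 1)
    rw [← this]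
    simp [polarForm, Pi.single_apply]
  have := aeval_second isHomogeneous_cubicOf z i (F := cubicOf T)
  simp only [h6] at this
  have h2 : (2:ℂ) ≠ 0 := two_ne_zero
  apply mul_left_cancel₀ h2
  rw [this, Finset.mul_sum, Finset.mul_sum]
  refine Finset.sum_congr rfl fun k _ => ?_
  rw [Finset.mul_sum, Finset.mul_sum]
  refine Finset.sum_congr rfl fun l _ => ?_
  simp; ring

theorem SymTri.complex_grad (a b : V4) (i : Fin 4) :
    ∑ k, ∑ l, (T (Pi.single i 1) (Pi.single k 1) (Pi.single l 1) : ℂ) *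
      (a k + b k * Complex.I) * (a l + b l * Complex.I)
      = ((T a a (Pi.single i 1) - T b b (Pi.single i 1) : ℝ) : ℂ)
          + 2 * (T a b (Pi.single i 1) : ℝ) * Complex.I := by
  have e1 : ∀ x y : V4, ∑ k, ∑ l, T (Pi.single i 1) (Pi.single k 1) (Pi.single l 1) * x k * y l
        = T x y (Pi.single i 1) := by
    intro x y
    rw [hT.rot, hT.rot, hT.expand_sum]
    simp [Pi.single_apply]
  have e2 : T a b (Pi.single i 1) =
      (T a b (Pi.single i 1) + T b a (Pi.single i 1)) / 2 := by
    rw [hT.swap b a]; ring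
  rw [e2]
  simp only [← e1]
  push_cast
  rw [← Finset.sum_sub_distrib, mul_div_cancel₀ _ two_ne_zero, ← Finset.sum_add_distrib,
    Finset.sum_mul, ← Finset.sum_add_distrib]
  refine Finset.sum_congr rfl fun k _ => ?_
  rw [← Finset.sum_sub_distrib, ← Finset.sum_add_distrib,
    Finset.sum_mul, ← Finset.sum_add_distrib]
  refine Finset.sum_congr rfl fun l _ => ?_
  linear_combination (T (Pi.single i 1) (Pi.single k 1) (Pi.single l 1) : ℂ) * b k * b l * Complex.I_sq
end
section
open MvPolynomial
variable {F : MvPolynomial (Fin 4) ℝ}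
theorem nonSing_polarForm (hF : F.IsHomogeneous 3)
    (hns : ∀ z : Fin 4 → ℂ, z ≠ 0 →
      eval z (map (algebraMap ℝ ℂ) F) = 0 →
      ∃ j : Fin 4, eval z (map (algebraMap ℝ ℂ) (pderiv j F)) ≠ 0) : NonSing (polarForm F) := by
  intro a b h1 h2
  by_contra hne
  set z : Fin 4 → ℂ := fun j => a j + b j * Complex.I with hz
  have hz0 : z ≠ 0 := by
    intro h0
    apply hne
    constructor
    · ext j; have := congrArg Complex.re (congrFun h0 j); simpa [hz] using this
    · ext j; have := congrArg Complex.im (congrFun h0 j); simpa [hz] using this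
  have hd : ∀ j, aeval z (pderiv j F) = 0 := by
    intro j
    have h := aeval_second hF z j
    have h' := (symTri_polarForm F).complex_grad a b j
    have e : ∀ k l, polarForm F (Pi.single j 1) (Pi.single k 1) (Pi.single l 1)
        = thirdDeriv F j k l := by
      intro k l; simp [polarForm, Pi.single_apply]
    simp only [e] at h'
    rw [h1, h2] at h'
    have h3 : (2 : ℂ) * aeval z (pderiv j F) = 0 := by
      rw [h]; simpa [hz] using h'
    simpa using h3
  have h0 := aeval_euler hF z
  simp only [hd, mul_zero, Finset.sum_const_zero] at h0
  have h0' : aeval z F = 0 := by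
    simpa using h0.symm
  obtain ⟨j, hj⟩ := hns z hz0 (by rw [eval_map, ← aeval_def]; exact h0')
  apply hj
  rw [eval_map, ← aeval_def]; exact hd j

theorem NonSing.exists_pderiv_ne {T : V4 → V4 → V4 → ℝ} (hT : SymTri T) (hns : NonSing T)
    (z : Fin 4 → ℂ) (hz : z ≠ 0) :
    ∃ j : Fin 4, eval z (map (algebraMap ℝ ℂ) (pderiv j (cubicOf T))) ≠ 0 := by
  by_contra! hcon
  have hd : ∀ j, aeval z (pderiv j (cubicOf T)) = 0 := fun j => by
    rw [aeval_def, ← eval_map]; exact hcon j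
  set a : V4 := fun k => (z k).re
  set b : V4 := fun k => (z k).im
  have hzk : ∀ k, z k = a k + b k * Complex.I := fun k => (Complex.re_add_im (z k)).symm
  have hg : ∀ j, T a a (Pi.single j 1) - T b b (Pi.single j 1) = 0 ∧ T a b (Pi.single j 1) = 0 := by
    intro j
    have h := hd j
    rw [aeval_pderiv_cubicOf hT] at h
    simp only [hzk] at h
    rw [hT.complex_grad a b j] at h
    have h : ((T a a (Pi.single j 1) - T b b (Pi.single j 1) : ℝ) : ℂ)
          + 2 * (T a b (Pi.single j 1) : ℝ) * Complex.I = 0 := by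
      simpa using h
    have hr := congrArg Complex.re h
    have hi := congrArg Complex.im h
    simp at hr hi
    exact ⟨hr, hi⟩
  have key : ∀ x y w, T x y w = ∑ j, w j * T x y (Pi.single j 1) := by
    intro x y w
    rw [← hT.rot, hT.expand]
    exact Finset.sum_congr rfl fun j _ => by rw [hT.rot]
  obtain ⟨ha, hb⟩ := hns a b
    (fun w => by
      rw [key a, key b]
      exact Finset.sum_congr rfl fun j _ => by rw [sub_eq_zero.1 (hg j).1])
    (fun w => by rw [key]; simp [(hg _).2])
  apply hz
  ext k
  rw [hzk, ha, hb]; simp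
end

theorem isSchlafliSix_iff (L : Fin 6 → PLine) :
    IsSchlafliSix L ↔ PairwiseSkew L ∧ ∃ T, SymTri T ∧ NonSing T ∧ ∀ i, ∀ x ∈ L i, T x x x = 0 := by
  constructor
  · rintro ⟨h1, F, -, hF, hv, hns⟩
    exact ⟨h1, polarForm F, symTri_polarForm F, nonSing_polarForm hF hns,
      fun i x hx => by rw [polarForm_self hF, hv i x hx, mul_zero]⟩
  · rintro ⟨h1, T, hT, hns, hv⟩
    refine ⟨h1, cubicOf T, ?_, isHomogeneous_cubicOf, fun i x hx => by
      rw [eval_cubicOf hT, hv i x hx], fun z hz _ => hns.exists_pderiv_ne hT z hz⟩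
    intro h0
    obtain ⟨j, hj⟩ := hns.exists_pderiv_ne hT 1 one_ne_zero
    rw [h0] at hj
    simp at hj

/-! ### Lines spanned by pairs -/

/-- The subspace spanned by a pair of vectors. -/
def ln (u : V4 × V4) : PLine := span ℝ {u.1, u.2}

theorem mem_ln {u : V4 × V4} {x : V4} : x ∈ ln u ↔ ∃ s t : ℝ, s • u.1 + t • u.2 = x :=
  mem_span_pair

theorem isLine_ln_iff (u : V4 × V4) :
    IsLine (ln u) ↔ ∀ s t : ℝ, s • u.1 + t • u.2 = 0 → s = 0 ∧ t = 0 := by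
  rw [← LinearIndependent.pair_iff, linearIndependent_iff_card_eq_finrank_span]
  unfold IsLine ln Set.finrank
  rw [Matrix.range_cons, Matrix.range_cons, Matrix.range_empty, Set.union_empty]
  simp only [Fintype.card_fin]
  rw [eq_comm]; rfl

theorem IsLine.exists_ln {P : PLine} (h : IsLine P) : ∃ u : V4 × V4, P = ln u := by
  have b := Module.finBasisOfFinrankEq ℝ P h
  refine ⟨((b 0 : P), (b 1 : P)), ?_⟩
  have := congrArg (Submodule.map P.subtype) b.span_eq
  rw [Submodule.map_span, Submodule.map_top, Submodule.range_subtype] at this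
  refine this.symm.trans ?_
  rw [ln]
  congr 1
  ext x; simp [Fin.exists_fin_two, eq_comm]

theorem skew_ln_iff (u v : V4 × V4) :
    Skew (ln u) (ln v) ↔ ∀ a b c d : ℝ, a • u.1 + b • u.2 + c • v.1 + d • v.2 = 0 →
      a = 0 ∧ b = 0 ∧ c = 0 ∧ d = 0 := by
  unfold Skew
  rw [isLine_ln_iff, isLine_ln_iff]
  constructor
  · rintro ⟨h1, h2, h3⟩ a b c d h
    have h4 : a • u.1 + b • u.2 ∈ ln u ⊓ ln v := by
      refine ⟨mem_ln.2 ⟨a, b, rfl⟩, mem_ln.2 ⟨-c, -d, ?_⟩⟩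
      rw [eq_comm, ← sub_eq_zero, ← h]; module
    rw [h3, mem_bot] at h4
    obtain ⟨ha, hb⟩ := h1 _ _ h4
    have h5 : c • v.1 + d • v.2 = 0 := by rw [← h, h4]; module
    obtain ⟨hc, hd⟩ := h2 _ _ h5
    exact ⟨ha, hb, hc, hd⟩
  · intro h
    refine ⟨fun s t hst => ?_, fun s t hst => ?_, ?_⟩
    · obtain ⟨h1, h2, -, -⟩ := h s t 0 0 (by rw [hst]; module)
      exact ⟨h1, h2⟩
    · obtain ⟨-, -, h1, h2⟩ := h 0 0 s t (by rw [← hst]; module)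
      exact ⟨h1, h2⟩
    · rw [eq_bot_iff]
      rintro x ⟨hx1, hx2⟩
      obtain ⟨a, b, hab⟩ := mem_ln.1 hx1
      obtain ⟨c, d, hcd⟩ := mem_ln.1 hx2
      obtain ⟨h1, h2, -, -⟩ := h a b (-c) (-d) (by
        rw [hab, add_assoc, neg_smul, neg_smul, ← neg_add, hcd]; simp)
      rw [mem_bot, ← hab, h1, h2]; simp

theorem skew_ln_iff_det (u v : V4 × V4) :
    Skew (ln u) (ln v) ↔ det2 u.1 u.2 v.1 v.2 ≠ 0 := by
  rw [skew_ln_iff, det2, ← isUnit_iff_ne_zero, ← Matrix.isUnit_iff_isUnit_det,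
    ← Matrix.linearIndependent_rows_iff_isUnit, Fintype.linearIndependent_iff]
  constructor
  · intro h g hg
    rw [Fin.sum_univ_four] at hg
    obtain ⟨h0, h1, h2, h3⟩ := h (g 0) (g 1) (g 2) (g 3) hg
    intro i; fin_cases i <;> assumption
  · intro h a b c d hh
    have := h ![a, b, c, d] (by rw [Fin.sum_univ_four]; exact hh)
    exact ⟨this 0, this 1, this 2, this 3⟩

theorem map_ln (A : V4 →ₗ[ℝ] V4) (u : V4 × V4) : (ln u).map A = ln (A u.1, A u.2) := by
  rw [ln, Submodule.map_span, Set.image_pair]; rfl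

theorem ln_eq_of_comb {u v : V4 × V4} {a b c d : ℝ} (h : a * d - b * c ≠ 0)
    (h1 : v.1 = a • u.1 + b • u.2) (h2 : v.2 = c • u.1 + d • u.2) : ln v = ln u := by
  apply le_antisymm
  · rw [ln, span_le]
    rintro x (rfl | rfl)
    · exact mem_ln.2 ⟨a, b, h1.symm⟩
    · exact mem_ln.2 ⟨c, d, h2.symm⟩
  · rw [ln, span_le]
    rintro x (rfl | rfl)
    · refine mem_ln.2 ⟨d / (a * d - b * c), -b / (a * d - b * c), ?_⟩
      rw [h1, h2]
      have e : u.1 = ((a * d - b * c) / (a * d - b * c)) • u.1 := by rw [div_self h, one_smul]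
      conv_rhs => rw [e]
      module
    · refine mem_ln.2 ⟨-c / (a * d - b * c), a / (a * d - b * c), ?_⟩
      rw [h1, h2]
      have e : u.2 = ((a * d - b * c) / (a * d - b * c)) • u.2 := by rw [div_self h, one_smul]
      conv_rhs => rw [e]
      module

theorem exists_comb_of_ln_eq {u v : V4 × V4} (hv : IsLine (ln v)) (h : ln v = ln u) :
    ∃ a b c d : ℝ, a * d - b * c ≠ 0 ∧ v.1 = a • u.1 + b • u.2 ∧ v.2 = c • u.1 + d • u.2 := by
  have h1 : v.1 ∈ ln u := h ▸ mem_ln.2 ⟨1, 0, by simp⟩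
  have h2 : v.2 ∈ ln u := h ▸ mem_ln.2 ⟨0, 1, by simp⟩
  obtain ⟨a, b, hab⟩ := mem_ln.1 h1
  obtain ⟨c, d, hcd⟩ := mem_ln.1 h2
  refine ⟨a, b, c, d, fun h0 => ?_, hab.symm, hcd.symm⟩
  rw [isLine_ln_iff] at hv
  obtain ⟨hd, hb⟩ := hv d (-b) (by
    rw [← hab, ← hcd]
    have : d • (a • u.1 + b • u.2) + -b • (c • u.1 + d • u.2) = (a * d - b * c) • u.1 := by module
    rw [this, h0, zero_smul])
  obtain ⟨hc, ha⟩ := hv (-c) a (by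
    rw [← hab, ← hcd]
    have : -c • (a • u.1 + b • u.2) + a • (c • u.1 + d • u.2) = (a * d - b * c) • u.2 := by module
    rw [this, h0, zero_smul])
  have hb : b = 0 := by linarith
  subst ha hb
  obtain ⟨h, -⟩ := hv 1 0 (by rw [← hab]; simp)
  exact one_ne_zero h

/-! ### Deformations as paths of spanning vectors -/

/-- The lines of a system of spanning vectors. -/
def lines (u : Fin 6 → V4 × V4) : Fin 6 → PLine := fun i => ln (u i)

/-- Systems of spanning vectors of Schläfli sixes. -/
def SixBases : Set (Fin 6 → V4 × V4) := {u | IsSchlafliSix (lines u)}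

theorem IsSchlafliSix.isLine {L : Fin 6 → PLine} (h : IsSchlafliSix L) (i : Fin 6) :
    IsLine (L i) := by
  obtain ⟨j, hj⟩ := exists_ne i
  exact (h.1 i j hj.symm).1

theorem IsSchlafliSix.comp {L : Fin 6 → PLine} (h : IsSchlafliSix L) (π : Equiv.Perm (Fin 6)) :
    IsSchlafliSix (L ∘ π) := by
  obtain ⟨h1, F, h2, h3, h4, h5⟩ := h
  exact ⟨fun i j hij => h1 _ _ (fun h => hij (π.injective h)), F, h2, h3, fun i => h4 _, h5⟩

theorem IsSchlafliSix.exists_lines {L : Fin 6 → PLine} (h : IsSchlafliSix L) :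
    ∃ u ∈ SixBases, lines u = L := by
  choose u hu using fun i => (h.isLine i).exists_ln
  have : lines u = L := by ext1 i; exact (hu i).symm
  exact ⟨u, by rw [SixBases, Set.mem_ofPred_eq, this]; exact h, this⟩

theorem schlafliDeformation_iff {L L' : Fin 6 → PLine} :
    SchlafliDeformation L L' ↔ ∃ (π π' : Equiv.Perm (Fin 6)) (u u' : Fin 6 → V4 × V4),
      JoinedIn SixBases u u' ∧ lines u = L ∘ π ∧ lines u' = L' ∘ π' := by
  constructor
  · rintro ⟨π, π', F, hc, hS, h0, h1⟩
    choose v w hv hw hvw using hc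
    set f : ℝ → Fin 6 → V4 × V4 := fun t i => (v i t, w i t)
    have hl : ∀ t ∈ Set.Icc (0:ℝ) 1, lines (f t) = F t := by
      intro t ht; ext1 i; exact (hvw i t ht).symm
    refine ⟨π, π', f 0, f 1, JoinedIn.ofLine (f := f) ?_ rfl rfl ?_, ?_, ?_⟩
    · exact continuousOn_pi.2 fun i => (hv i).prodMk (hw i)
    · rintro _ ⟨t, ht, rfl⟩
      rw [SixBases, Set.mem_ofPred_eq, hl t ht]; exact hS t ht
    · rw [hl 0 (by simp), h0]
    · rw [hl 1 (by simp), h1]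
  · rintro ⟨π, π', u, u', h, hu, hu'⟩
    obtain ⟨γ, hγ⟩ := h
    refine ⟨π, π', fun t => lines (γ.extend t), fun i => ⟨fun t => (γ.extend t i).1,
      fun t => (γ.extend t i).2, ?_, ?_, fun t _ => rfl⟩, ?_, ?_, ?_⟩
    · exact (continuous_fst.comp ((continuous_apply i).comp γ.continuous_extend)).continuousOn
    · exact (continuous_snd.comp ((continuous_apply i).comp γ.continuous_extend)).continuousOn
    · intro t ht
      change IsSchlafliSix (lines (γ.extend t))
      rw [Path.extend_apply γ ht]; exact hγ _
    · simp [hu]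
    · simp [hu']

theorem JoinedIn.image {X Y : Type*} [TopologicalSpace X] [TopologicalSpace Y] {S : Set X}
    {S' : Set Y} {x y : X} (h : JoinedIn S x y) {f : X → Y} (hf : ContinuousOn f S)
    (hS : ∀ x ∈ S, f x ∈ S') : JoinedIn S' (f x) (f y) :=
  (h.map_continuousOn hf).mono (by rintro _ ⟨x, hx, rfl⟩; exact hS x hx)

theorem joinedIn_change_basis {u u' w : Fin 6 → V4 × V4} (h : JoinedIn SixBases u u')
    (hw : lines w = lines u) : ∃ w', JoinedIn SixBases w w' ∧ lines w' = lines u' := by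
  have hS : IsSchlafliSix (lines w) := hw ▸ h.source_mem
  choose a b c d hd h1 h2 using fun i => exists_comb_of_ln_eq (hS.isLine i) (congrFun hw i)
  set φ : (Fin 6 → V4 × V4) → (Fin 6 → V4 × V4) := fun x i =>
    (a i • (x i).1 + b i • (x i).2, c i • (x i).1 + d i • (x i).2) with hφ
  have hl : ∀ x, lines (φ x) = lines x := by
    intro x; ext1 i; exact ln_eq_of_comb (hd i) rfl rfl
  have hφw : φ u = w := by
    ext1 i; exact Prod.ext (h1 i).symm (h2 i).symm
  refine ⟨φ u', ?_, hl u'⟩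
  rw [← hφw]
  refine h.image (Continuous.continuousOn (by fun_prop)) fun x hx => ?_
  rw [SixBases, Set.mem_ofPred_eq, hl]; exact hx

namespace SchlafliDeformation

theorem of_joinedIn {u u' : Fin 6 → V4 × V4} (h : JoinedIn SixBases u u') :
    SchlafliDeformation (lines u) (lines u') :=
  schlafliDeformation_iff.2 ⟨1, 1, u, u', h, rfl, rfl⟩

theorem comp_right {L : Fin 6 → PLine} (h : IsSchlafliSix L) (π : Equiv.Perm (Fin 6)) :
    SchlafliDeformation L (L ∘ π) := by
  obtain ⟨u, hu, hl⟩ := h.exists_lines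
  refine schlafliDeformation_iff.2 ⟨1, π⁻¹, u, u, JoinedIn.refl hu, hl, ?_⟩
  rw [hl]; ext1 i; simp

theorem refl {L : Fin 6 → PLine} (h : IsSchlafliSix L) : SchlafliDeformation L L :=
  comp_right h 1

theorem symm {L L' : Fin 6 → PLine} (h : SchlafliDeformation L L') : SchlafliDeformation L' L := by
  obtain ⟨π, π', u, u', h, h1, h2⟩ := schlafliDeformation_iff.1 h
  exact schlafliDeformation_iff.2 ⟨π', π, u', u, h.symm, h2, h1⟩

theorem trans {L L' L'' : Fin 6 → PLine} (h : SchlafliDeformation L L')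
    (h' : SchlafliDeformation L' L'') : SchlafliDeformation L L'' := by
  obtain ⟨π, π', u, u', h, h1, h2⟩ := schlafliDeformation_iff.1 h
  obtain ⟨ρ, ρ', w, w', hw, h3, h4⟩ := schlafliDeformation_iff.1 h'
  set τ : Equiv.Perm (Fin 6) := ρ⁻¹ * π'
  have hj : JoinedIn SixBases (w ∘ τ) (w' ∘ τ) := by
    refine hw.image (f := fun x => x ∘ τ) (Continuous.continuousOn (by fun_prop)) fun x hx => ?_
    exact IsSchlafliSix.comp (L := lines x) hx τ
  have e : lines u' = lines (w ∘ τ) := by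
    rw [h2]
    change _ = lines w ∘ τ
    rw [h3]; ext1 i; simp [τ]
  obtain ⟨z, hz1, hz2⟩ := joinedIn_change_basis hj e
  refine schlafliDeformation_iff.2 ⟨π, ρ' * τ, u, z, h.trans hz1, h1, ?_⟩
  rw [hz2]
  change lines w' ∘ τ = _
  rw [h4]; rfl

end SchlafliDeformation

/-! ### The action of invertible matrices -/

/-- Sign constancy along a path. -/
theorem JoinedIn.pos_of_pos {X : Type*} [TopologicalSpace X] {S : Set X} {x y : X}
    (h : JoinedIn S x y) {f : X → ℝ} (hf : Continuous f) (hS : ∀ x ∈ S, f x ≠ 0)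
    (hx : 0 < f x) : 0 < f y := by
  obtain ⟨γ, hγ⟩ := h
  by_contra hy
  obtain ⟨t, ht⟩ := mem_range_of_exists_le_of_exists_ge (f := fun t => f (γ t)) (c := 0)
    (hf.comp γ.continuous) ⟨1, by simpa using hy⟩ ⟨0, by simpa using hx.le⟩
  exact hS _ (hγ t) ht

theorem JoinedIn.sign_eq {X : Type*} [TopologicalSpace X] {S : Set X} {x y : X}
    (h : JoinedIn S x y) {f : X → ℝ} (hf : Continuous f) (hS : ∀ x ∈ S, f x ≠ 0) :
    SignType.sign (f x) = SignType.sign (f y) := by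
  rcases (hS x h.source_mem).lt_or_gt with hx | hx
  · have := h.pos_of_pos (f := fun x => -f x) hf.neg (fun x hx => neg_ne_zero.2 (hS x hx))
      (neg_pos.2 hx)
    rw [sign_neg hx, sign_neg (neg_pos.1 this)]
  · rw [sign_pos hx, sign_pos (h.pos_of_pos hf hS hx)]

theorem joinedIn_of_path {X : Type*} [TopologicalSpace X] {S : Set X} (f : ℝ → X)
    (hf : Continuous f) (hS : ∀ t ∈ Set.Icc (0:ℝ) 1, f t ∈ S) : JoinedIn S (f 0) (f 1) :=
  JoinedIn.ofLine hf.continuousOn rfl rfl (by rintro _ ⟨t, ht, rfl⟩; exact hS t ht)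

abbrev Mat4 : Type := Matrix (Fin 4) (Fin 4) ℝ

def GLset : Set Mat4 := {M | M.det ≠ 0}

/-- The reflection in the last coordinate. -/
def Refl : Mat4 := Matrix.diagonal ![1, 1, 1, -1]

theorem det_Refl : Refl.det = -1 := by simp [Refl, Matrix.det_diagonal, Fin.prod_univ_four]

theorem Refl_mul_self : Refl * Refl = 1 := by
  rw [Refl, Matrix.diagonal_mul_diagonal, ← Matrix.diagonal_one]
  congr 1; ext i; fin_cases i <;> simp

def JoinedToBase (M : Mat4) : Prop := JoinedIn GLset 1 M ∨ JoinedIn GLset Refl M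

theorem GLset_mul {A B : Mat4} (hA : A ∈ GLset) (hB : B ∈ GLset) : A * B ∈ GLset := by
  unfold GLset at *
  rw [Set.mem_ofPred_eq] at *
  rw [Matrix.det_mul]; exact mul_ne_zero hA hB

theorem JoinedIn.mul_GLset {A A' B B' : Mat4} (h : JoinedIn GLset A A') (h' : JoinedIn GLset B B') :
    JoinedIn GLset (A * B) (A' * B') :=
  (h.image (f := fun X => X * B) (Continuous.continuousOn (by fun_prop))
    (fun _ hx => GLset_mul hx h'.source_mem)).trans
  (h'.image (f := fun X => A' * X) (Continuous.continuousOn (by fun_prop))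
    (fun _ hx => GLset_mul h.target_mem hx))

theorem JoinedToBase.mul {A B : Mat4} (hA : JoinedToBase A) (hB : JoinedToBase B) :
    JoinedToBase (A * B) := by
  rcases hA with hA | hA <;> rcases hB with hB | hB
  · left; simpa using hA.mul_GLset hB
  · right; simpa using hA.mul_GLset hB
  · right; simpa using hA.mul_GLset hB
  · left; simpa [Refl_mul_self] using hA.mul_GLset hB

theorem JoinedToBase.of_joinedIn {A B : Mat4} (hA : JoinedToBase A) (h : JoinedIn GLset A B) :
    JoinedToBase B := hA.imp (·.trans h) (·.trans h)

theorem one_mem_GLset : (1 : Mat4) ∈ GLset := by simp [GLset]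

theorem joinedToBase_one : JoinedToBase 1 := Or.inl (JoinedIn.refl one_mem_GLset)

theorem joinedToBase_flip (i : Fin 4) : JoinedToBase (Matrix.diagonal (Function.update 1 i (-1))) := by
  right
  have key : ∀ f : ℝ → Mat4, Continuous f → f 0 = Refl →
      f 1 = Matrix.diagonal (Function.update 1 i (-1)) →
      (∀ t, (f t).det = -((1 - 2 * t) ^ 2 + (4 * t * (1 - t)) ^ 2)) →
      JoinedIn GLset Refl (Matrix.diagonal (Function.update 1 i (-1))) := by
    intro f hf h0 h1 hd
    rw [← h0, ← h1]
    refine joinedIn_of_path f hf fun t ht => ?_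
    rw [GLset, Set.mem_ofPred_eq, hd]
    by_cases h : t = 1 / 2
    · subst h; norm_num
    · have : 0 < (1 - 2 * t) ^ 2 := by
        apply sq_pos_of_ne_zero; intro h'; apply h; linarith
      nlinarith [sq_nonneg (4 * t * (1 - t))]
  fin_cases i
  · refine key (fun t => !![1 - 2 * t, 0, 0, 4 * t * (1 - t); 0, 1, 0, 0; 0, 0, 1, 0;
      4 * t * (1 - t), 0, 0, -(1 - 2 * t)]) ?_ ?_ ?_ ?_
    · fun_prop
    · ext i j; fin_cases i <;> fin_cases j <;> simp [Refl]
    · ext i j; fin_cases i <;> fin_cases j <;> norm_num [Function.update]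
    · intro t; simp [Matrix.det_succ_row_zero, Fin.sum_univ_succ, Fin.succAbove]; ring
  · refine key (fun t => !![1, 0, 0, 0; 0, 1 - 2 * t, 0, 4 * t * (1 - t); 0, 0, 1, 0;
      0, 4 * t * (1 - t), 0, -(1 - 2 * t)]) ?_ ?_ ?_ ?_
    · fun_prop
    · ext i j; fin_cases i <;> fin_cases j <;> simp [Refl]
    · ext i j; fin_cases i <;> fin_cases j <;> norm_num [Function.update]
    · intro t; simp [Matrix.det_succ_row_zero, Fin.sum_univ_succ, Fin.succAbove]; ring
  · refine key (fun t => !![1, 0, 0, 0; 0, 1, 0, 0; 0, 0, 1 - 2 * t, 4 * t * (1 - t);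
      0, 0, 4 * t * (1 - t), -(1 - 2 * t)]) ?_ ?_ ?_ ?_
    · fun_prop
    · ext i j; fin_cases i <;> fin_cases j <;> simp [Refl]
    · ext i j; fin_cases i <;> fin_cases j <;> norm_num [Function.update]
    · intro t; simp [Matrix.det_succ_row_zero, Fin.sum_univ_succ, Fin.succAbove]; ring
  · convert JoinedIn.refl (x := Refl) (F := GLset) ?_
    · ext i j; fin_cases i <;> fin_cases j <;> simp [Refl, Function.update]
    · rw [GLset, Set.mem_ofPred_eq, det_Refl]; norm_num

theorem det_diagonal_update (i : Fin 4) (c : ℝ) :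
    (Matrix.diagonal (Function.update (1 : Fin 4 → ℝ) i c)).det = c := by
  rw [Matrix.det_diagonal, Finset.prod_update_of_mem (Finset.mem_univ i)]; simp

theorem joinedToBase_single (i : Fin 4) {c : ℝ} (hc : c ≠ 0) :
    JoinedToBase (Matrix.diagonal (Function.update 1 i c)) := by
  have key : ∀ e : ℝ, 0 < e * c →
      JoinedIn GLset (Matrix.diagonal (Function.update 1 i e))
        (Matrix.diagonal (Function.update (1 : Fin 4 → ℝ) i c)) := by
    intro e he
    have := joinedIn_of_path (S := GLset)
      (fun t : ℝ => Matrix.diagonal (Function.update (1 : Fin 4 → ℝ) i ((1 - t) * e + t * c)))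
      (by fun_prop) (fun t ht => by
        rw [GLset, Set.mem_ofPred_eq, det_diagonal_update]
        intro h
        have h1 : ((1 - t) * e + t * c) * c = 0 := by rw [h, zero_mul]
        have h2 : 0 < c ^ 2 := by positivity
        obtain ⟨h3, h4⟩ := ht
        rcases eq_or_lt_of_le h3 with h5 | h5
        · subst h5; nlinarith
        · nlinarith [mul_nonneg (sub_nonneg.2 h4) he.le, mul_pos h5 h2])
    simpa using this
  rcases hc.lt_or_gt with hc | hc
  · exact (joinedToBase_flip i).of_joinedIn (key _ (by linarith))
  · refine JoinedToBase.of_joinedIn ?_ (key 1 (by linarith))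
    have : Matrix.diagonal (Function.update (1 : Fin 4 → ℝ) i 1) = 1 := by
      rw [← Matrix.diagonal_one]; congr 1
      exact Function.update_eq_self i (1 : Fin 4 → ℝ)
    rw [this]; exact joinedToBase_one

theorem joinedToBase_of_det_ne_zero (M : Mat4) (hM : M.det ≠ 0) : JoinedToBase M := by
  refine Matrix.diagonal_transvection_induction_of_det_ne_zero _ M hM ?_ ?_ ?_
  · intro D hD
    have e : Matrix.diagonal D = Matrix.diagonal (Function.update 1 0 (D 0)) *
        Matrix.diagonal (Function.update 1 1 (D 1)) *
        Matrix.diagonal (Function.update 1 2 (D 2)) *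
        Matrix.diagonal (Function.update 1 3 (D 3)) := by
      simp only [Matrix.diagonal_mul_diagonal]
      congr 1; ext i; fin_cases i <;> simp [Function.update]
    rw [Matrix.det_diagonal, Finset.prod_ne_zero_iff] at hD
    rw [e]
    exact (((joinedToBase_single 0 (hD 0 (by simp))).mul (joinedToBase_single 1 (hD 1 (by simp)))).mul
      (joinedToBase_single 2 (hD 2 (by simp)))).mul (joinedToBase_single 3 (hD 3 (by simp)))
  · rintro ⟨i, j, hij, c⟩
    left
    have := joinedIn_of_path (S := GLset) (fun t : ℝ => Matrix.transvection i j (t * c))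
      (by unfold Matrix.transvection;
          refine continuous_const.add ?_
          refine continuous_matrix fun a b => ?_
          simp only [Matrix.single_apply]
          split_ifs <;> fun_prop) (fun t _ => by
        rw [GLset, Set.mem_ofPred_eq, Matrix.det_transvection_of_ne i j hij]; exact one_ne_zero)
    simpa using this
  · exact fun A B _ _ hA hB => hA.mul hB

theorem joinedIn_one_of_det_pos {M : Mat4} (hM : 0 < M.det) : JoinedIn GLset 1 M := by
  refine (joinedToBase_of_det_ne_zero M hM.ne').resolve_right fun h => ?_
  have := h.symm.pos_of_pos (f := fun M => M.det) (by fun_prop) (fun _ h => h) hM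
  rw [det_Refl] at this; linarith

theorem joinedIn_Refl_of_det_neg {M : Mat4} (hM : M.det < 0) : JoinedIn GLset Refl M := by
  refine (joinedToBase_of_det_ne_zero M hM.ne).resolve_left fun h => ?_
  have := h.pos_of_pos (f := fun M => M.det) (by fun_prop) (fun _ h => h) (by simp)
  linarith

/-- The image of a configuration of subspaces under a matrix. -/
noncomputable def act (M : Mat4) (L : Fin 6 → PLine) : Fin 6 → PLine :=
  fun i => (L i).map (Matrix.toLin' M)

theorem act_comp (M : Mat4) (L : Fin 6 → PLine) (π : Equiv.Perm (Fin 6)) :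
    act M (L ∘ π) = act M L ∘ π := rfl

theorem act_one (L : Fin 6 → PLine) : act 1 L = L := by
  ext1 i; simp [act]

theorem act_act (M N : Mat4) (L : Fin 6 → PLine) : act M (act N L) = act (M * N) L := by
  ext1 i; simp [act, Matrix.toLin'_mul, Submodule.map_comp]

theorem act_lines (M : Mat4) (u : Fin 6 → V4 × V4) :
    act M (lines u) = lines (fun i => (M.mulVec (u i).1, M.mulVec (u i).2)) := by
  ext1 i; simp only [act, lines, map_ln, Matrix.toLin'_apply]

theorem IsSchlafliSix.map_equiv {L : Fin 6 → PLine} (h : IsSchlafliSix L) (A : V4 ≃ₗ[ℝ] V4) :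
    IsSchlafliSix (fun i => (L i).map (A : V4 →ₗ[ℝ] V4)) := by
  rw [isSchlafliSix_iff] at h ⊢
  obtain ⟨h1, T, hT, hns, h0⟩ := h
  refine ⟨fun i j hij => ?_, _, hT.comp (A.symm : V4 →ₗ[ℝ] V4), hns.comp A.symm, ?_⟩
  · obtain ⟨ha, hb, hc⟩ := h1 i j hij
    refine ⟨(A.finrank_map_eq _).trans ha, (A.finrank_map_eq _).trans hb, ?_⟩
    rw [← Submodule.map_inf _ A.injective, hc, Submodule.map_bot]
  · rintro i _ ⟨x, hx, rfl⟩
    simpa using h0 i x hx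

theorem IsSchlafliSix.act {L : Fin 6 → PLine} (h : IsSchlafliSix L) {M : Mat4} (hM : M.det ≠ 0) :
    IsSchlafliSix (act M L) :=
  h.map_equiv (Matrix.toLinearEquiv' M (M.invertibleOfIsUnitDet (isUnit_iff_ne_zero.2 hM)))

namespace SchlafliDeformation

theorem act_path {L : Fin 6 → PLine} (h : IsSchlafliSix L) {M N : Mat4} (hMN : JoinedIn GLset M N) :
    SchlafliDeformation (act M L) (act N L) := by
  obtain ⟨u, hu, rfl⟩ := h.exists_lines
  rw [act_lines, act_lines]
  refine of_joinedIn (hMN.image (f := fun X => fun i => (X.mulVec (u i).1, X.mulVec (u i).2))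
    (Continuous.continuousOn ?_) fun X hX => ?_)
  · refine continuous_pi fun i => ?_
    exact (Continuous.matrix_mulVec continuous_id continuous_const).prodMk
      (Continuous.matrix_mulVec continuous_id continuous_const)
  · rw [SixBases, Set.mem_ofPred_eq, ← act_lines]
    exact h.act hX

theorem act_of_det_pos {L : Fin 6 → PLine} (h : IsSchlafliSix L) {M : Mat4} (hM : 0 < M.det) :
    SchlafliDeformation L (act M L) := by
  have := act_path h (joinedIn_one_of_det_pos hM)
  rwa [act_one] at this

theorem act_of_det_neg {L : Fin 6 → PLine} (h : IsSchlafliSix L) {M : Mat4} (hM : M.det < 0) :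
    SchlafliDeformation (act Refl L) (act M L) :=
  act_path h (joinedIn_Refl_of_det_neg hM)

theorem act {L L' : Fin 6 → PLine} (h : SchlafliDeformation L L') {M : Mat4} (hM : M.det ≠ 0) :
    SchlafliDeformation (act M L) (act M L') := by
  obtain ⟨π, π', u, u', hj, h1, h2⟩ := schlafliDeformation_iff.1 h
  refine schlafliDeformation_iff.2 ⟨π, π', _, _, hj.image
    (f := fun u => fun i => (M.mulVec (u i).1, M.mulVec (u i).2)) (Continuous.continuousOn ?_)
    fun x hx => ?_, ?_, ?_⟩
  · refine continuous_pi fun i => ?_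
    exact (Continuous.matrix_mulVec continuous_const (by fun_prop)).prodMk
      (Continuous.matrix_mulVec continuous_const (by fun_prop))
  · rw [SixBases, Set.mem_ofPred_eq, ← act_lines]
    exact IsSchlafliSix.act hx hM
  · rw [← act_lines, h1, act_comp]
  · rw [← act_lines, h2, act_comp]

end SchlafliDeformation

/-! ### Ternary forms in two pairs of variables -/

section tf
variable {K : Type*} [Field K]

/-- The trilinear form with given coefficients, symmetric in its first two arguments. -/
def tf (p : Fin 6 → K) (x x' y : K × K) : K :=
  (p 0 * x.1 * x'.1 + p 1 * (x.1 * x'.2 + x.2 * x'.1) + p 2 * x.2 * x'.2) * y.1 +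
  (p 3 * x.1 * x'.1 + p 4 * (x.1 * x'.2 + x.2 * x'.1) + p 5 * x.2 * x'.2) * y.2

def wd (x y : K × K) : K := x.1 * y.2 - x.2 * y.1

def mv (t : Fin 4 → K) (x : K × K) : K × K := (t 0 * x.1 + t 1 * x.2, t 2 * x.1 + t 3 * x.2)

theorem exists_functional {f : K × K → K} (c1 c2 : K) (hf : ∀ x, f x = c1 * x.1 + c2 * x.2)
    {z : K × K} (hz : z ≠ 0) (h0 : f z = 0) : ∃ a, ∀ x, f x = a * wd z x := by
  rw [hf] at h0
  by_cases h1 : z.1 = 0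
  · have h2 : z.2 ≠ 0 := fun h2 => hz (Prod.ext h1 h2)
    have h3 : c2 = 0 := by
      rw [h1] at h0; simpa [h2] using h0
    refine ⟨-c1 / z.2, fun x => ?_⟩
    rw [hf, wd, h1, h3]; field_simp; ring
  · refine ⟨c2 / z.1, fun x => ?_⟩
    have : c1 = - c2 * z.2 / z.1 := by field_simp; linear_combination h0
    rw [hf, wd, this]; field_simp; ring

theorem exists_smul_of_wd {z x : K × K} (hz : z ≠ 0) (h : wd z x = 0) : ∃ a : K, x = a • z := by
  unfold wd at h
  by_cases h1 : z.1 = 0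
  · have h2 : z.2 ≠ 0 := fun h2 => hz (Prod.ext h1 h2)
    refine ⟨x.2 / z.2, Prod.ext ?_ ?_⟩
    · rw [h1] at h; have : x.1 = 0 := by simpa [h2] using h
      simp [h1, this]
    · simp [h2]
  · refine ⟨x.1 / z.1, Prod.ext ?_ ?_⟩
    · simp [h1]
    · simp; field_simp; linear_combination h

end tf

/-- Nonsingularity of the cubic `p(x,x,y) + q(y,y,x)`. -/
def NSPair (p q : Fin 6 → ℂ) : Prop :=
  ∀ x y : ℂ × ℂ, (∀ h, 2 * tf p x h y + tf q y y h = 0) → (∀ h, tf p x x h + 2 * tf q y h x = 0) →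
    x = 0 ∧ y = 0

section
variable {p q : Fin 6 → ℂ} (hns : NSPair p q) (hV : ∀ x, tf p x x x + tf q x x x = 0)
include hns hV

theorem NSPair.no_double_root {z : ℂ × ℂ} (hz : ∀ h, 2 * tf p z h z + tf p z z h = 0) : z = 0 := by
  by_contra h0
  have hz0 : tf p z z z = 0 := by linear_combination (1 / 3) * hz z
  have hq0 : tf q z z z = 0 := by linear_combination hV z - hz0
  have hq : ∀ h, 2 * tf q z h z + tf q z z h = 0 := by
    intro h
    have h1 := hV (z + h)
    have h2 := hV (z - h)
    have h3 := hV h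
    have h4 := hz h
    simp only [tf, Prod.fst_add, Prod.snd_add, Prod.fst_sub, Prod.snd_sub] at *
    linear_combination (1 / 2) * h1 - (1 / 2) * h2 - h3 - h4
  obtain ⟨A, hA⟩ := exists_functional (f := fun k => 2 * tf p z k z)
    (2 * ((p 0 * z.1 + p 1 * z.2) * z.1 + (p 3 * z.1 + p 4 * z.2) * z.2))
    (2 * ((p 1 * z.1 + p 2 * z.2) * z.1 + (p 4 * z.1 + p 5 * z.2) * z.2))
    (fun x => by simp only [tf]; ring) h0 (by rw [hz0, mul_zero])
  obtain ⟨B, hB⟩ := exists_functional (f := fun k => tf q z z k)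
    (q 0 * z.1 * z.1 + q 1 * (z.1 * z.2 + z.2 * z.1) + q 2 * z.2 * z.2)
    (q 3 * z.1 * z.1 + q 4 * (z.1 * z.2 + z.2 * z.1) + q 5 * z.2 * z.2)
    (fun x => by simp only [tf]) h0 hq0
  have key : ∀ α β : ℂ, α * A + β * B = 0 → α • z = 0 ∧ β • z = 0 := by
    intro α β hαβ
    refine hns _ _ (fun h => ?_) fun h => ?_
    · have e1 := hA h
      have e2 := hB h
      have e : 2 * tf p (α • z) h (β • z) + tf q (β • z) (β • z) h
        = α * β * (2 * tf p z h z) + β ^ 2 * tf q z z h := by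
        simp only [tf, Prod.smul_fst, Prod.smul_snd, smul_eq_mul]; ring
      rw [e, e1, e2]; linear_combination β * wd z h * hαβ
    · have e1 := hA h
      have e2 := hB h
      have e : tf p (α • z) (α • z) h + 2 * tf q (β • z) h (α • z)
        = α ^ 2 * tf p z z h + α * β * (2 * tf q z h z) := by
        simp only [tf, Prod.smul_fst, Prod.smul_snd, smul_eq_mul]; ring
      rw [e]
      linear_combination -α * wd z h * hαβ + α ^ 2 * hz h + α * β * hq h - α ^ 2 * e1 - α * β * e2
  by_cases h : A = 0 ∧ B = 0
  · have := (key 1 1 (by rw [h.1, h.2]; ring)).1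
    rw [one_smul] at this; exact h0 this
  · obtain ⟨h1, h2⟩ := key B (-A) (by ring)
    rw [smul_eq_zero] at h1 h2
    exact h ⟨neg_eq_zero.1 (h2.resolve_right h0), h1.resolve_right h0⟩

variable {t : Fin 4 → ℂ} (hT : ∀ x, tf p x x (mv t x) + tf q (mv t x) (mv t x) x = 0)
include hT

omit hns in
theorem root_of_eigen {z : ℂ × ℂ} {l : ℂ} (hl : l ≠ 0) (hl1 : l ≠ 1) (hz : mv t z = l • z) :
    tf p z z z = 0 := by
  have h1 := hT z
  have h2 := hV z
  rw [hz] at h1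
  have : l * (1 - l) * tf p z z z = 0 := by
    simp only [tf, Prod.smul_fst, Prod.smul_snd, smul_eq_mul] at *
    linear_combination h1 - l ^ 2 * h2
  exact (mul_eq_zero.1 this).resolve_left (mul_ne_zero hl (sub_ne_zero.2 hl1.symm))

theorem NSPair.no_double_eigen {z : ℂ × ℂ} {l : ℂ} (hl : l ≠ 0) (hl1 : l ≠ 1) (hz : mv t z = l • z)
    (hd : ∀ h, ∃ n : ℂ, mv t h = l • h + n • z) : z = 0 := by
  have h0 := root_of_eigen hV hT hl hl1 hz
  have hq0 : tf q z z z = 0 := by linear_combination hV z - h0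
  refine hns.no_double_root hV fun h => ?_
  obtain ⟨n, hn⟩ := hd h
  have a1 := hV (z + h)
  have a2 := hV (z - h)
  have a3 := hV h
  have b1 := hT (z + h)
  have b2 := hT (z - h)
  have b3 := hT h
  have e1 : mv t (z + h) = l • z + (l • h + n • z) := by
    rw [← hz, ← hn]; simp only [mv]; ext <;> simp <;> ring
  have e2 : mv t (z - h) = l • z - (l • h + n • z) := by
    rw [← hz, ← hn]; simp only [mv]; ext <;> simp <;> ring
  rw [e1] at b1
  rw [e2] at b2
  rw [hn] at b3
  have : l * (1 - l) * (2 * tf p z h z + tf p z z h) = 0 := by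
    simp only [tf, Prod.fst_add, Prod.snd_add, Prod.fst_sub, Prod.snd_sub, Prod.smul_fst,
      Prod.smul_snd, smul_eq_mul] at *
    linear_combination (1 / 2) * b1 - (1 / 2) * b2 - b3 - l ^ 2 * ((1 / 2) * a1 - (1 / 2) * a2 - a3)
      - n * h0 - 2 * l * n * hq0
  exact (mul_eq_zero.1 this).resolve_left (mul_ne_zero hl (sub_ne_zero.2 hl1.symm))

end

theorem NSPair.disc_ne_zero {p q : Fin 6 → ℂ} (hns : NSPair p q)
    (hV : ∀ x, tf p x x x + tf q x x x = 0) {t : Fin 4 → ℂ}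
    (hT : ∀ x, tf p x x (mv t x) + tf q (mv t x) (mv t x) x = 0)
    (h0 : t 0 * t 3 - t 1 * t 2 ≠ 0) (h1 : (t 0 - 1) * (t 3 - 1) - t 1 * t 2 ≠ 0) :
    (t 3 - t 0) ^ 2 + 4 * t 1 * t 2 ≠ 0 := by
  intro hd
  set l : ℂ := (t 0 + t 3) / 2 with hl
  have hl0 : l ≠ 0 := by
    intro h; apply h0
    have : t 0 + t 3 = 0 := by linear_combination 2 * h
    linear_combination (1/4) * (t 0 + t 3) * this - (1 / 4) * hd
  have hl1 : l ≠ 1 := by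
    intro h; apply h1
    have : t 0 + t 3 = 2 := by linear_combination 2 * h
    linear_combination (1/4) * (t 0 + t 3 - 2) * this - (1 / 4) * hd
  by_cases ht : t 1 = 0
  · have h03 : t 3 = t 0 := by
      rw [ht] at hd; simpa [sub_eq_zero] using hd
    have hl' : l = t 0 := by rw [hl, h03]; ring
    have := hns.no_double_eigen hV hT (z := (0, 1)) hl0 hl1
      (by rw [hl']; ext <;> simp [mv, ht, h03]) fun h =>
        ⟨t 2 * h.1, by rw [hl']; ext <;> simp [mv, ht, h03]; ring⟩
    simp at this
  · have := hns.no_double_eigen hV hT (z := (t 1, (t 3 - t 0) / 2)) hl0 hl1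
      (by ext <;> simp [mv, hl] <;> first | ring1 | linear_combination (1 / 4) * hd) fun h =>
        ⟨((t 0 - t 3) / 2 * h.1 + t 1 * h.2) / t 1, by
          ext <;> simp [mv, hl] <;> field_simp <;> first | ring1 | linear_combination h.1 * hd⟩
    simp [ht] at this

theorem exists_indep_roots {A B C : ℂ} (hd : B ^ 2 - 4 * A * C ≠ 0) : ∃ z z' : ℂ × ℂ, wd z z' ≠ 0 ∧
    A * z.1 ^ 2 + B * z.1 * z.2 + C * z.2 ^ 2 = 0 ∧
    A * z'.1 ^ 2 + B * z'.1 * z'.2 + C * z'.2 ^ 2 = 0 := by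
  by_cases hA : A = 0
  · subst hA
    have hB : B ≠ 0 := by rintro rfl; simp at hd
    exact ⟨(1, 0), (-C, B), by simpa [wd], by simp, by simp; ring⟩
  · obtain ⟨s, hs⟩ := IsAlgClosed.exists_pow_nat_eq (B ^ 2 - 4 * A * C) (n := 2) (by norm_num)
    have hs0 : s ≠ 0 := by rintro rfl; apply hd; rw [← hs]; ring
    refine ⟨(-B + s, 2 * A), (-B - s, 2 * A), ?_, ?_, ?_⟩
    · have : wd ((-B + s, 2 * A) : ℂ × ℂ) (-B - s, 2 * A) = 4 * A * s := by simp only [wd]; ring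
      rw [this]; simp [hA, hs0]
    · simp only; linear_combination A * hs
    · simp only; linear_combination A * hs

theorem exists_linear_factor {A B C c0 c1 c2 c3 : ℝ} (hd : B ^ 2 - 4 * A * C ≠ 0)
    (h : ∀ z : ℂ × ℂ, A * z.1 ^ 2 + B * z.1 * z.2 + C * z.2 ^ 2 = 0 →
      c0 * z.1 ^ 3 + c1 * z.1 ^ 2 * z.2 + c2 * z.1 * z.2 ^ 2 + c3 * z.2 ^ 3 = 0) :
    ∃ l0 l1 : ℝ, c0 = A * l0 ∧ c1 = B * l0 + A * l1 ∧ c2 = C * l0 + B * l1 ∧ c3 = C * l1 := by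
  by_cases hA : A = 0
  · subst hA
    have hB : B ≠ 0 := by rintro rfl; simp at hd
    have h1 := h (1, 0) (by simp)
    have h2 := h (-C, B) (by simp; ring)
    norm_num at h1 h2
    norm_cast at h1 h2
    refine ⟨c1 / B, (c2 - C * (c1 / B)) / B, by simp [h1], by field_simp; ring, by field_simp; ring, ?_⟩
    field_simp
    have h3 : B * (c3 * B ^ 2 - C * (c2 * B - C * c1)) = 0 := by
      rw [h1] at h2; linear_combination h2
    have := (mul_eq_zero.1 h3).resolve_left hB
    linear_combination this
  · obtain ⟨s, hs⟩ := IsAlgClosed.exists_pow_nat_eq ((B : ℂ) ^ 2 - 4 * A * C) (n := 2) (by norm_num)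
    have hs0 : s ≠ 0 := by
      rintro rfl; apply hd
      have : (B : ℂ) ^ 2 - 4 * A * C = 0 := by rw [← hs]; ring
      exact_mod_cast this
    have h1 := h (-B + s, 2 * A) (by simp only; linear_combination A * hs)
    have h2 := h (-B - s, 2 * A) (by simp only; linear_combination A * hs)
    simp only at h1 h2
    have hA' : (A : ℂ) ≠ 0 := by exact_mod_cast hA
    set l0 := c0 / A with hl0
    set l1 := (c1 - B * l0) / A with hl1
    have e0 : c0 = A * l0 := by rw [hl0]; field_simp
    have e1 : c1 = B * l0 + A * l1 := by rw [hl1]; field_simp; ring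
    have e0' : (c0 : ℂ) = A * l0 := by exact_mod_cast e0
    have e1' : (c1 : ℂ) = B * l0 + A * l1 := by exact_mod_cast e1
    have f1 : 8 * (A : ℂ) ^ 2 * s * (c2 - C * l0 - B * l1) = 0 := by
      rw [e0', e1'] at h1 h2
      linear_combination h1 - h2 - 2 * A * l0 * s * hs
    have f2 : (c2 - C * l0 - B * l1 : ℂ) = 0 := by
      refine (mul_eq_zero.1 f1).resolve_left ?_
      simp [hA', hs0]
    have f3 : 8 * (A : ℂ) ^ 3 * (c3 - C * l1) = 0 := by
      rw [e0', e1'] at h1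
      linear_combination h1 - 4 * A ^ 2 * (-B + s) * f2 - hs * (2 * A ^ 2 * l1 + A * l0 * (-B + s))
    have f4 : (c3 - C * l1 : ℂ) = 0 := by
      refine (mul_eq_zero.1 f3).resolve_left ?_
      simp [hA']
    norm_cast at f2 f4
    exact ⟨l0, l1, e0, e1, by linarith, by linarith⟩

theorem lead_eq_zero_of_four_roots {e0 e1 e2 e3 : ℂ} {m : Fin 4 → ℂ} (hm : Function.Injective m)
    (h : ∀ i, e3 * m i ^ 3 + e2 * m i ^ 2 + e1 * m i + e0 = 0) : e3 = 0 := by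
  have d : ∀ i j, i ≠ j → m i - m j ≠ 0 := fun i j hij => sub_ne_zero.2 (hm.ne hij)
  have q : ∀ i : Fin 4, i ≠ 0 →
      e3 * (m i ^ 2 + m i * m 0 + m 0 ^ 2) + e2 * (m i + m 0) + e1 = 0 := fun i hi =>
    (mul_eq_zero.1 (by linear_combination h i - h 0 :
      (m i - m 0) * (e3 * (m i ^ 2 + m i * m 0 + m 0 ^ 2) + e2 * (m i + m 0) + e1) = 0)).resolve_left
      (d _ _ hi)
  have r : ∀ i : Fin 4, i ≠ 0 → i ≠ 1 → e3 * (m i + m 1 + m 0) + e2 = 0 := fun i hi hi' =>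
    (mul_eq_zero.1 (by linear_combination q i hi - q 1 (by decide) :
      (m i - m 1) * (e3 * (m i + m 1 + m 0) + e2) = 0)).resolve_left (d _ _ hi')
  exact (mul_eq_zero.1 (by linear_combination (r 2 (by decide) (by decide)) -
      (r 3 (by decide) (by decide)) : (m 2 - m 3) * e3 = 0)).resolve_left (d _ _ (by decide))

theorem NSPair.tf_ne_zero_left {p q : Fin 6 → ℂ} (hns : NSPair p q) {z z' : ℂ × ℂ}
    (hz : wd z z' ≠ 0) (h0 : tf p z z z = 0) : tf p z z z' ≠ 0 := by
  intro h1
  have hz0 : z ≠ 0 := by rintro rfl; simp [wd] at hz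
  refine hz0 (hns z 0 (fun h => by simp [tf]) fun h => ?_).1
  have e : wd z z' * (tf p z z h + 2 * tf q 0 h z) = wd h z' * tf p z z z + wd z h * tf p z z z' := by
    simp only [tf, wd, Prod.fst_zero, Prod.snd_zero]; ring
  rw [h0, h1] at e
  exact (mul_eq_zero.1 (by rw [e]; ring)).resolve_left hz

theorem NSPair.tf_ne_zero_right {p q : Fin 6 → ℂ} (hns : NSPair p q) {z z' : ℂ × ℂ}
    (hz : wd z z' ≠ 0) (h0 : tf q z z z = 0) : tf q z z z' ≠ 0 := by
  intro h1
  have hz0 : z ≠ 0 := by rintro rfl; simp [wd] at hz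
  refine hz0 (hns 0 z (fun h => ?_) fun h => by simp [tf]).2
  have e : wd z z' * (2 * tf p 0 h z + tf q z z h) = wd h z' * tf q z z z + wd z h * tf q z z z' := by
    simp only [tf, wd, Prod.fst_zero, Prod.snd_zero]; ring
  rw [h0, h1] at e
  exact (mul_eq_zero.1 (by rw [e]; ring)).resolve_left hz

/-- There are no four simultaneously diagonalisable graphs on a nonsingular cubic. -/
theorem NSPair.no_common_eigenbasis {p q : Fin 6 → ℂ} (hns : NSPair p q) {z z' : ℂ × ℂ}
    (hz : wd z z' ≠ 0) {a b : Fin 4 → ℂ} (ha : Function.Injective a) (ha0 : ∀ k, a k ≠ 0)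
    (hp : tf p z z z = 0) (hq : tf q z z z = 0) (hq' : tf q z' z' z' = 0)
    (h1 : ∀ k, a k * (2 * tf p z z' z) + b k * tf p z z z' + a k * b k * (2 * tf q z z' z)
      + a k ^ 2 * tf q z z z' = 0)
    (h2 : ∀ k, a k * tf p z' z' z + b k * (2 * tf p z z' z') + b k ^ 2 * tf q z' z' z
      + a k * b k * (2 * tf q z z' z') = 0) : False := by
  have hz' : wd z' z ≠ 0 := by
    intro h; apply hz; unfold wd at *; linear_combination -h
  have nα := hns.tf_ne_zero_left hz hp
  have nγ := hns.tf_ne_zero_right hz' hq'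
  have ndet : 2 * tf p z z' z * (2 * tf q z z' z) - tf p z z z' * tf q z z z' ≠ 0 := by
    intro h
    have hz0 : z ≠ 0 := by rintro rfl; simp [wd] at hz
    have key : ∀ ξ η : ℂ, ξ * (2 * tf p z z' z) + η * tf q z z z' = 0 →
        ξ * tf p z z z' + η * (2 * tf q z z' z) = 0 → ξ • z = 0 ∧ η • z = 0 := by
      intro ξ η e1 e2
      refine hns _ _ (fun h => ?_) fun h => ?_
      · refine (mul_eq_zero.1 (?_ : wd z z' * _ = 0)).resolve_left hz
        have : wd z z' * (2 * tf p (ξ • z) h (η • z) + tf q (η • z) (η • z) h) =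
          wd h z' * (2 * ξ * η * tf p z z z + η ^ 2 * tf q z z z) +
          wd z h * η * (ξ * (2 * tf p z z' z) + η * tf q z z z') := by
          simp only [tf, wd, Prod.smul_fst, Prod.smul_snd, smul_eq_mul]; ring
        rw [this, e1, hp, hq]; ring
      · refine (mul_eq_zero.1 (?_ : wd z z' * _ = 0)).resolve_left hz
        have : wd z z' * (tf p (ξ • z) (ξ • z) h + 2 * tf q (η • z) h (ξ • z)) =
          wd h z' * (ξ ^ 2 * tf p z z z + 2 * ξ * η * tf q z z z) +
          wd z h * ξ * (ξ * tf p z z z' + η * (2 * tf q z z' z)) := by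
          simp only [tf, wd, Prod.smul_fst, Prod.smul_snd, smul_eq_mul]; ring
        rw [this, e2, hp, hq]; ring
    obtain ⟨k1, k2⟩ := key (2 * tf q z z' z) (-tf p z z z') (by linear_combination h) (by ring)
    rw [smul_eq_zero] at k2
    exact nα (neg_eq_zero.1 (k2.resolve_right hz0))
  generalize tf p z z z' = α at *
  generalize 2 * tf p z z' z = β at *
  generalize 2 * tf q z z' z = γ at *
  generalize tf q z z z' = δ at *
  generalize 2 * tf p z z' z' = α' at *
  generalize tf p z' z' z = β' at *
  generalize tf q z' z' z = γ' at *
  generalize 2 * tf q z z' z' = δ' at *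
  set m : Fin 4 → ℂ := fun k => b k / a k with hm
  have hb : ∀ k, b k = a k * m k := fun k => by rw [hm]; field_simp [ha0 k]
  have g1 : ∀ k, β + α * m k + a k * (m k * γ + δ) = 0 := fun k => by
    refine (mul_eq_zero.1 (?_ : a k * _ = 0)).resolve_left (ha0 k)
    have := h1 k
    rw [hb k] at this; linear_combination this
  have g2 : ∀ k, β' + α' * m k + a k * m k * (m k * γ' + δ') = 0 := fun k => by
    refine (mul_eq_zero.1 (?_ : a k * _ = 0)).resolve_left (ha0 k)
    have := h2 k
    rw [hb k] at this; linear_combination this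
  have minj : Function.Injective m := by
    intro i j hij
    by_contra hne
    have e1 := g1 i
    have e2 := g1 j
    rw [← hij] at e2
    have e3 : m i * γ + δ = 0 := by
      refine (mul_eq_zero.1 (?_ : (a i - a j) * _ = 0)).resolve_left (sub_ne_zero.2 (ha.ne hne))
      linear_combination e1 - e2
    rw [e3] at e1
    apply ndet
    linear_combination γ * e1 - α * e3
  refine mul_ne_zero nα nγ (lead_eq_zero_of_four_roots (m := m)
    (e2 := β * γ' + α * δ' - γ * α') (e1 := β * δ' - γ * β' - δ * α') (e0 := -δ * β') minj fun k => ?_)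
  linear_combination m k * (m k * γ' + δ') * g1 k - (m k * γ + δ) * g2 k

/-! ### Real coordinates for three graphs -/

theorem cubic_coeffs_zero {k0 k1 k2 k3 : ℝ} {f : ℝ × ℝ → ℝ} (h0 : ∀ x, f x = 0)
    (hf : ∀ x, f x = k0 * x.1 ^ 3 + k1 * x.1 ^ 2 * x.2 + k2 * x.1 * x.2 ^ 2 + k3 * x.2 ^ 3) :
    k0 = 0 ∧ k1 = 0 ∧ k2 = 0 ∧ k3 = 0 := by
  have a := hf (1, 0)
  have b := hf (0, 1)
  have c := hf (1, 1)
  have d := hf (1, -1)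
  rw [h0] at a b c d
  norm_num at a b c d
  exact ⟨a.symm, by linarith, by linarith, b.symm⟩

def toC (x : ℝ × ℝ) : ℂ × ℂ := ((x.1 : ℂ), (x.2 : ℂ))

def coeC {n : ℕ} (p : Fin n → ℝ) : Fin n → ℂ := fun i => (p i : ℂ)

structure GraphSystem (p q : Fin 6 → ℝ) (t : Fin 3 → Fin 4 → ℝ) : Prop where
  ns : NSPair (coeC p) (coeC q)
  diag : ∀ x, tf p x x x + tf q x x x = 0
  graph : ∀ k x, tf p x x (mv (t k) x) + tf q (mv (t k) x) (mv (t k) x) x = 0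
  det : ∀ k, t k 0 * t k 3 - t k 1 * t k 2 ≠ 0
  det_one : ∀ k, (t k 0 - 1) * (t k 3 - 1) - t k 1 * t k 2 ≠ 0
  det_sub : ∀ j k, j ≠ k →
    (t j 0 - t k 0) * (t j 3 - t k 3) - (t j 1 - t k 1) * (t j 2 - t k 2) ≠ 0

namespace GraphSystem
variable {p q : Fin 6 → ℝ} {t : Fin 3 → Fin 4 → ℝ} (h : GraphSystem p q t)
include h

theorem diagC (x : ℂ × ℂ) : tf (coeC p) x x x + tf (coeC q) x x x = 0 := by
  obtain ⟨a0, a1, a2, a3⟩ := cubic_coeffs_zero (k0 := p 0 + q 0) (k1 := 2 * p 1 + p 3 + 2 * q 1 + q 3)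
    (k2 := p 2 + 2 * p 4 + q 2 + 2 * q 4) (k3 := p 5 + q 5) h.diag (fun x => by simp only [tf]; ring)
  have b0 : (p 0 + q 0 : ℂ) = 0 := by exact_mod_cast a0
  have b1 : (2 * p 1 + p 3 + 2 * q 1 + q 3 : ℂ) = 0 := by exact_mod_cast a1
  have b2 : (p 2 + 2 * p 4 + q 2 + 2 * q 4 : ℂ) = 0 := by exact_mod_cast a2
  have b3 : (p 5 + q 5 : ℂ) = 0 := by exact_mod_cast a3
  simp only [tf, coeC]
  linear_combination x.1 ^ 3 * b0 + x.1 ^ 2 * x.2 * b1 + x.1 * x.2 ^ 2 * b2 + x.2 ^ 3 * b3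

theorem graphC (k : Fin 3) (x : ℂ × ℂ) :
    tf (coeC p) x x (mv (coeC (t k)) x) + tf (coeC q) (mv (coeC (t k)) x) (mv (coeC (t k)) x) x = 0 := by
  have hg := h.graph k
  generalize t k = t at *
  obtain ⟨a0, a1, a2, a3⟩ := cubic_coeffs_zero
    (k0 := p 0 * t 0 + p 3 * t 2 + q 0 * t 0 ^ 2 + 2 * q 1 * t 0 * t 2 + q 2 * t 2 ^ 2)
    (k1 := p 0 * t 1 + 2 * p 1 * t 0 + p 3 * t 3 + 2 * p 4 * t 2 + 2 * q 0 * t 0 * t 1 +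
      2 * q 1 * (t 0 * t 3 + t 1 * t 2) + 2 * q 2 * t 2 * t 3 + q 3 * t 0 ^ 2 + 2 * q 4 * t 0 * t 2 +
      q 5 * t 2 ^ 2)
    (k2 := 2 * p 1 * t 1 + p 2 * t 0 + 2 * p 4 * t 3 + p 5 * t 2 + q 0 * t 1 ^ 2 +
      2 * q 1 * t 1 * t 3 + q 2 * t 3 ^ 2 + 2 * q 3 * t 0 * t 1 + 2 * q 4 * (t 0 * t 3 + t 1 * t 2) +
      2 * q 5 * t 2 * t 3)
    (k3 := p 2 * t 1 + p 5 * t 3 + q 3 * t 1 ^ 2 + 2 * q 4 * t 1 * t 3 + q 5 * t 3 ^ 2)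
    hg (fun x => by simp only [tf, mv]; ring)
  have b0 := congrArg (fun x : ℝ => (x : ℂ)) a0
  have b1 := congrArg (fun x : ℝ => (x : ℂ)) a1
  have b2 := congrArg (fun x : ℝ => (x : ℂ)) a2
  have b3 := congrArg (fun x : ℝ => (x : ℂ)) a3
  push_cast at b0 b1 b2 b3
  simp only [tf, coeC, mv]
  linear_combination x.1 ^ 3 * b0 + x.1 ^ 2 * x.2 * b1 + x.1 * x.2 ^ 2 * b2 + x.2 ^ 3 * b3

theorem no_double_root {z : ℝ × ℝ} (hz : ∀ h, 2 * tf p z h z + tf p z z h = 0) : z = 0 := by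
  have := h.ns.no_double_root h.diagC (z := toC z) fun k => by
    have e1 := congrArg (fun x : ℝ => (x : ℂ)) (hz (1, 0))
    have e2 := congrArg (fun x : ℝ => (x : ℂ)) (hz (0, 1))
    simp only [tf] at e1 e2
    push_cast at e1 e2
    simp only [tf, coeC, toC]
    linear_combination k.1 * e1 + k.2 * e2
  simpa [toC, Prod.ext_iff] using this

theorem disc_ne_zero (k : Fin 3) : (t k 3 - t k 0) ^ 2 - 4 * t k 2 * (- t k 1) ≠ 0 := by
  have := h.ns.disc_ne_zero h.diagC (h.graphC k) (by
    have := h.det k; simp only [coeC]; exact_mod_cast this) (by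
    have := h.det_one k; simp only [coeC]; exact_mod_cast this)
  intro h0
  apply this
  simp only [coeC]
  have : (t k 3 - t k 0) ^ 2 + 4 * t k 1 * t k 2 = 0 := by linarith
  exact_mod_cast this

theorem exists_eigenvalue (k : Fin 3) {z : ℂ × ℂ} (hz0 : z ≠ 0) (hz : wd z (mv (coeC (t k)) z) = 0) :
    ∃ l : ℂ, mv (coeC (t k)) z = l • z ∧ l ≠ 0 ∧ l ≠ 1 := by
  obtain ⟨l, hl⟩ := exists_smul_of_wd hz0 hz
  have key : ∀ d : ℂ, d * z.1 = 0 → d * z.2 = 0 → d = 0 := by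
    intro d h1 h2
    by_contra hd
    exact hz0 (Prod.ext ((mul_eq_zero.1 h1).resolve_left hd) ((mul_eq_zero.1 h2).resolve_left hd))
  have e1 := congrArg Prod.fst hl
  have e2 := congrArg Prod.snd hl
  simp only [mv, coeC, Prod.smul_fst, Prod.smul_snd, smul_eq_mul] at e1 e2
  refine ⟨l, hl, ?_, ?_⟩
  · rintro rfl
    refine h.det k ?_
    have := key (t k 0 * t k 3 - t k 1 * t k 2) (by linear_combination t k 3 * e1 - t k 1 * e2)
      (by linear_combination t k 0 * e2 - t k 2 * e1)
    exact_mod_cast this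
  · rintro rfl
    refine h.det_one k ?_
    have := key ((t k 0 - 1) * (t k 3 - 1) - t k 1 * t k 2)
      (by linear_combination (t k 3 - 1) * e1 - t k 1 * e2)
      (by linear_combination (t k 0 - 1) * e2 - t k 2 * e1)
    exact_mod_cast this

theorem exists_factor (k : Fin 3) : ∃ l : ℝ × ℝ, l ≠ 0 ∧ ∀ x, tf p x x x =
    wd x (mv (t k) x) * (l.1 * x.1 + l.2 * x.2) := by
  obtain ⟨l0, l1, e0, e1, e2, e3⟩ := exists_linear_factor (A := t k 2) (B := t k 3 - t k 0)
    (C := -t k 1) (c0 := p 0) (c1 := 2 * p 1 + p 3) (c2 := p 2 + 2 * p 4) (c3 := p 5)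
    (h.disc_ne_zero k) (fun z hz => by
      by_cases hz0 : z = 0
      · simp [hz0]
      obtain ⟨l, hl, hl0, hl1⟩ := h.exists_eigenvalue k hz0 (by
        simp only [wd, mv, coeC]; push_cast at hz; linear_combination hz)
      have := root_of_eigen h.diagC (h.graphC k) hl0 hl1 hl
      simp only [tf, coeC] at this
      push_cast
      linear_combination this)
  have hx : ∀ x, tf p x x x = wd x (mv (t k) x) * (l0 * x.1 + l1 * x.2) := by
    intro x
    simp only [tf, wd, mv]
    linear_combination x.1 ^ 3 * e0 + x.1 ^ 2 * x.2 * e1 + x.1 * x.2 ^ 2 * e2 + x.2 ^ 3 * e3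
  refine ⟨(l0, l1), fun hl => ?_, hx⟩
  have hl0 : l0 = 0 := congrArg Prod.fst hl
  have hl1 : l1 = 0 := congrArg Prod.snd hl
  subst hl0 hl1
  have := h.no_double_root (z := (1, 0)) fun k => by
    simp only [tf]; linear_combination 3 * k.1 * e0 + k.2 * e1
  simp at this

end GraphSystem

namespace GraphSystem
variable {p q : Fin 6 → ℝ} {t : Fin 3 → Fin 4 → ℝ} (h : GraphSystem p q t)
include h

theorem factor_ne_zero {k : Fin 3} {l : ℝ × ℝ}
    (hl : ∀ x, tf p x x x = wd x (mv (t k) x) * (l.1 * x.1 + l.2 * x.2)) {r : ℝ × ℝ} (hr : r ≠ 0)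
    (h0 : wd r (mv (t k) r) = 0) : l.1 * r.1 + l.2 * r.2 ≠ 0 := by
  intro h1
  refine hr (h.no_double_root fun k => ?_)
  have a := hl (r + k)
  have b := hl (r - k)
  have c := hl k
  simp only [tf, wd, mv, Prod.fst_add, Prod.snd_add, Prod.fst_sub, Prod.snd_sub] at *
  rename_i k₀
  linear_combination (1 / 2) * a - (1 / 2) * b - c + (l.1 * k.1 + l.2 * k.2) * h0 +
    (r.1 * (t k₀ 2 * k.1 + t k₀ 3 * k.2) - r.2 * (t k₀ 0 * k.1 + t k₀ 1 * k.2) +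
      k.1 * (t k₀ 2 * r.1 + t k₀ 3 * r.2) - k.2 * (t k₀ 0 * r.1 + t k₀ 1 * r.2)) * h1

/-- The linear factors are not all proportional. -/
theorem exists_not_parallel {l : Fin 3 → ℝ × ℝ} (hl0 : ∀ k, l k ≠ 0)
    (hl : ∀ k x, tf p x x x = wd x (mv (t k) x) * ((l k).1 * x.1 + (l k).2 * x.2)) :
    ∃ i j, wd (l i) (l j) ≠ 0 := by
  by_contra! hpar
  choose s hs using fun k => exists_smul_of_wd (hl0 0) (hpar 0 k)
  have hs0 : ∀ k, s k ≠ 0 := fun k h0 => hl0 k (by rw [hs, h0, zero_smul])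
  obtain ⟨z, z', hzz, hz, hz'⟩ := exists_indep_roots (A := (t 0 2 : ℂ)) (B := ((t 0 3 : ℂ) - t 0 0))
    (C := -(t 0 1 : ℂ)) (by have := h.disc_ne_zero 0; exact_mod_cast this)
  have hprop : ∀ k, t k 2 * s k = t 0 2 ∧ (t k 3 - t k 0) * s k = t 0 3 - t 0 0 ∧
      t k 1 * s k = t 0 1 := by
    intro k
    obtain ⟨a0, a1, a2, a3⟩ := cubic_coeffs_zero (k0 := (t k 2 * s k - t 0 2) * (l 0).1)
      (k1 := (t k 2 * s k - t 0 2) * (l 0).2 + ((t k 3 - t k 0) * s k - (t 0 3 - t 0 0)) * (l 0).1)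
      (k2 := ((t k 3 - t k 0) * s k - (t 0 3 - t 0 0)) * (l 0).2 - (t k 1 * s k - t 0 1) * (l 0).1)
      (k3 := - (t k 1 * s k - t 0 1) * (l 0).2)
      (f := fun x => tf p x x x - tf p x x x) (fun x => sub_self _) (fun x => by
        nth_rw 1 [hl k]
        rw [hl 0, hs k]
        simp only [wd, mv, Prod.smul_fst, Prod.smul_snd, smul_eq_mul]; ring)
    by_cases h1 : (l 0).1 = 0
    · have h2 : (l 0).2 ≠ 0 := fun h2 => hl0 0 (Prod.ext h1 h2)
      rw [h1] at a1 a2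
      simp only [mul_zero, add_zero, sub_zero, mul_eq_zero, h2, or_false, neg_eq_zero] at a1 a2 a3
      exact ⟨by linarith, by linarith, by linarith⟩
    · have b0 := (mul_eq_zero.1 a0).resolve_right h1
      rw [b0, zero_mul, zero_add] at a1
      have b1 := (mul_eq_zero.1 a1).resolve_right h1
      rw [b1, zero_mul, zero_sub, neg_eq_zero] at a2
      have b2 := (mul_eq_zero.1 a2).resolve_right h1
      exact ⟨by linarith, by linarith, by linarith⟩
  have hroot : ∀ k (x : ℂ × ℂ), t 0 2 * x.1 ^ 2 + ((t 0 3 : ℂ) - t 0 0) * x.1 * x.2 + -t 0 1 * x.2 ^ 2 = 0 →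
      wd x (mv (coeC (t k)) x) = 0 := by
    intro k x hx
    obtain ⟨e1, e2, e3⟩ := hprop k
    have f1 : (t k 2 : ℂ) * s k = t 0 2 := by exact_mod_cast e1
    have f2 : ((t k 3 : ℂ) - t k 0) * s k = t 0 3 - t 0 0 := by exact_mod_cast e2
    have f3 : (t k 1 : ℂ) * s k = t 0 1 := by exact_mod_cast e3
    have hsk : (s k : ℂ) ≠ 0 := by exact_mod_cast hs0 k
    refine (mul_eq_zero.1 (?_ : (s k : ℂ) * _ = 0)).resolve_left hsk
    simp only [wd, mv, coeC]
    linear_combination hx + x.1 ^ 2 * f1 + x.1 * x.2 * f2 - x.2 ^ 2 * f3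
  have hz0 : z ≠ 0 := by rintro rfl; simp [wd] at hzz
  have hz0' : z' ≠ 0 := by rintro rfl; simp [wd] at hzz
  choose a ha ha0 ha1 using fun k => h.exists_eigenvalue k hz0 (hroot k z hz)
  choose b hb hb0 hb1 using fun k => h.exists_eigenvalue k hz0' (hroot k z' hz')
  have hp := root_of_eigen h.diagC (h.graphC 0) (ha0 0) (ha1 0) (ha 0)
  have hp' := root_of_eigen h.diagC (h.graphC 0) (hb0 0) (hb1 0) (hb 0)
  have hq : tf (coeC q) z z z = 0 := by linear_combination h.diagC z - hp
  have hq' : tf (coeC q) z' z' z' = 0 := by linear_combination h.diagC z' - hp'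
  have key : ∀ (τ : Fin 4 → ℂ) (a b : ℂ), mv τ z = a • z → mv τ z' = b • z' →
      (∀ x, tf (coeC p) x x (mv τ x) + tf (coeC q) (mv τ x) (mv τ x) x = 0) →
      (a * (2 * tf (coeC p) z z' z) + b * tf (coeC p) z z z' + a * b * (2 * tf (coeC q) z z' z)
        + a ^ 2 * tf (coeC q) z z z' = 0) ∧
      (a * tf (coeC p) z' z' z + b * (2 * tf (coeC p) z z' z') + b ^ 2 * tf (coeC q) z' z' z
        + a * b * (2 * tf (coeC q) z z' z') = 0) := by
    intro τ a b h1 h2 h3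
    have c1 := h3 (z + z')
    have c2 := h3 (z - z')
    have e1 : mv τ (z + z') = a • z + b • z' := by
      rw [← h1, ← h2]; simp only [mv]; ext <;> simp <;> ring
    have e2 : mv τ (z - z') = a • z - b • z' := by
      rw [← h1, ← h2]; simp only [mv]; ext <;> simp <;> ring
    rw [e1] at c1
    rw [e2] at c2
    generalize coeC p = p at *
    generalize coeC q = q at *
    simp only [tf, Prod.fst_add, Prod.snd_add, Prod.fst_sub, Prod.snd_sub, Prod.smul_fst,
      Prod.smul_snd, smul_eq_mul] at c1 c2 hp hp' hq hq' ⊢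
    constructor
    · linear_combination (1 / 2) * c1 - (1 / 2) * c2 - b * hp' - b ^ 2 * hq'
    · linear_combination (1 / 2) * c1 + (1 / 2) * c2 - a * hp - a ^ 2 * hq
  have ainj : Function.Injective a := by
    intro i j hij
    by_contra hne
    have e := (ha i).trans (hij ▸ (ha j).symm)
    have e1 := congrArg Prod.fst e
    have e2 := congrArg Prod.snd e
    simp only [mv, coeC] at e1 e2
    have f : ∀ d : ℂ, d * z.1 = 0 → d * z.2 = 0 → d = 0 := by
      intro d h1 h2
      by_contra hd
      exact hz0 (Prod.ext ((mul_eq_zero.1 h1).resolve_left hd) ((mul_eq_zero.1 h2).resolve_left hd))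
    refine h.det_sub i j hne ?_
    have := f ((t i 0 - t j 0) * (t i 3 - t j 3) - (t i 1 - t j 1) * (t i 2 - t j 2))
      (by linear_combination (t i 3 - t j 3) * e1 - (t i 1 - t j 1) * e2)
      (by linear_combination (t i 0 - t j 0) * e2 - (t i 2 - t j 2) * e1)
    exact_mod_cast this
  refine h.ns.no_common_eigenbasis hzz (a := Fin.cons 1 a) (b := Fin.cons 1 b) ?_ ?_ hp hq hq' ?_ ?_
  · rw [Fin.cons_injective_iff]
    exact ⟨by rintro ⟨k, hk⟩; exact ha1 k hk, ainj⟩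
  · intro k; refine Fin.cases ?_ (fun k => ?_) k
    · simp
    · simpa using ha0 k
  · have := (key ![1, 0, 0, 1] 1 1 (by ext <;> simp [mv]) (by ext <;> simp [mv])
      (fun x => by simpa [mv] using h.diagC x)).1
    intro k; refine Fin.cases ?_ (fun k => ?_) k
    · simpa using this
    · simpa using (key _ _ _ (ha k) (hb k) (h.graphC k)).1
  · have := (key ![1, 0, 0, 1] 1 1 (by ext <;> simp [mv]) (by ext <;> simp [mv])
      (fun x => by simpa [mv] using h.diagC x)).2
    intro k; refine Fin.cases ?_ (fun k => ?_) k
    · simpa using this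
    · simpa using (key _ _ _ (ha k) (hb k) (h.graphC k)).2

theorem exists_real_root : ∃ r : ℝ × ℝ, r ≠ 0 ∧ tf p r r r = 0 ∧ ∃ i, wd r (mv (t i) r) ≠ 0 ∧
    ∀ j, j ≠ i → wd r (mv (t j) r) = 0 := by
  choose l hl0 hl using h.exists_factor
  have hroot : ∀ i j, wd (l i) (l j) ≠ 0 → ((-(l i).2, (l i).1) : ℝ × ℝ) ≠ 0 ∧
      tf p (-(l i).2, (l i).1) (-(l i).2, (l i).1) (-(l i).2, (l i).1) = 0 ∧
      wd (-(l i).2, (l i).1) (mv (t i) (-(l i).2, (l i).1)) ≠ 0 ∧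
      wd (-(l i).2, (l i).1) (mv (t j) (-(l i).2, (l i).1)) = 0 := by
    intro i j hij
    have hr : ((-(l i).2, (l i).1) : ℝ × ℝ) ≠ 0 := by
      intro h0
      apply hl0 i
      rw [Prod.mk_eq_zero, neg_eq_zero] at h0
      exact Prod.ext h0.2 h0.1
    have h1 : tf p (-(l i).2, (l i).1) (-(l i).2, (l i).1) (-(l i).2, (l i).1) = 0 := by
      rw [hl i]; simp only; ring
    refine ⟨hr, h1, fun h0 => h.factor_ne_zero (hl i) hr h0 (by simp only; ring), ?_⟩
    rw [hl j] at h1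
    refine (mul_eq_zero.1 h1).resolve_right fun h0 => hij ?_
    simp only [wd]; simp only at h0; linear_combination h0
  obtain ⟨i, j, hij⟩ := exists_not_parallel h hl0 hl
  have hne : i ≠ j := by rintro rfl; apply hij; simp only [wd]; ring
  have hji : wd (l j) (l i) ≠ 0 := by
    intro h0; apply hij; simp only [wd] at *; linear_combination -h0
  obtain ⟨k, hki, hkj, hk⟩ : ∃ k, k ≠ i ∧ k ≠ j ∧ ∀ m, m = i ∨ m = j ∨ m = k :=
    (by decide : ∀ i j : Fin 3, i ≠ j → ∃ k, k ≠ i ∧ k ≠ j ∧ ∀ m, m = i ∨ m = j ∨ m = k) i j hne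
  by_cases hik : wd (l i) (l k) = 0
  · have hjk : wd (l j) (l k) ≠ 0 := by
      intro h0
      obtain ⟨a, ha⟩ := exists_smul_of_wd (hl0 k) (by simp only [wd] at *; linear_combination -hik :
        wd (l k) (l i) = 0)
      obtain ⟨b, hb⟩ := exists_smul_of_wd (hl0 k) (by simp only [wd] at *; linear_combination -h0 :
        wd (l k) (l j) = 0)
      apply hij; rw [ha, hb]; simp [wd]; ring
    obtain ⟨a1, a2, a3, a4⟩ := hroot j i hji
    obtain ⟨-, -, -, a5⟩ := hroot j k hjk
    refine ⟨_, a1, a2, j, a3, fun m hm => ?_⟩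
    rcases hk m with rfl | rfl | rfl
    · exact a4
    · exact absurd rfl hm
    · exact a5
  · obtain ⟨a1, a2, a3, a4⟩ := hroot i j hij
    obtain ⟨-, -, -, a5⟩ := hroot i k hik
    refine ⟨_, a1, a2, i, a3, fun m hm => ?_⟩
    rcases hk m with rfl | rfl | rfl
    · exact absurd rfl hm
    · exact a4
    · exact a5

end GraphSystem

/-- Linear combinations of a pair of vectors. -/
def comb (u : V4 × V4) (x : ℝ × ℝ) : V4 := x.1 • u.1 + x.2 • u.2

theorem comb_mem_ln (u : V4 × V4) (x : ℝ × ℝ) : comb u x ∈ ln u := mem_ln.2 ⟨_, _, rfl⟩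

theorem mem_ln_iff_comb {u : V4 × V4} {x : V4} : x ∈ ln u ↔ ∃ s, comb u s = x := by
  rw [mem_ln]
  exact ⟨fun ⟨s, t, h⟩ => ⟨(s, t), h⟩, fun ⟨s, h⟩ => ⟨s.1, s.2, h⟩⟩

theorem comb_smul (u : V4 × V4) (c : ℝ) (x : ℝ × ℝ) : comb u (c • x) = c • comb u x := by
  simp [comb, mul_smul]

theorem comb_eq_zero {u : V4 × V4} (h : IsLine (ln u)) {x : ℝ × ℝ} (hx : comb u x = 0) : x = 0 := by
  obtain ⟨h1, h2⟩ := (isLine_ln_iff u).1 h _ _ hx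
  exact Prod.ext h1 h2

theorem Skew.symm {P Q : PLine} (h : Skew P Q) : Skew Q P := ⟨h.2.1, h.1, inf_comm P Q ▸ h.2.2⟩

theorem Skew.sup_eq_top {P Q : PLine} (h : Skew P Q) : P ⊔ Q = ⊤ := by
  obtain ⟨h1, h2, h3⟩ := h
  have := Submodule.finrank_sup_add_finrank_inf_eq P Q
  rw [h1, h2, h3, finrank_bot] at this
  refine Submodule.eq_top_of_finrank_eq ?_
  rw [Module.finrank_fin_fun]; omega

theorem Skew.exists_add {P Q : PLine} (h : Skew P Q) (x : V4) : ∃ a ∈ P, ∃ b ∈ Q, a + b = x :=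
  Submodule.mem_sup.1 (h.sup_eq_top ▸ Submodule.mem_top)

theorem Skew.eq_zero {P Q : PLine} (h : Skew P Q) {x : V4} (h1 : x ∈ P) (h2 : x ∈ Q) : x = 0 := by
  have : x ∈ P ⊓ Q := ⟨h1, h2⟩
  rwa [h.2.2, mem_bot] at this

theorem IsLine.eq_ln {P : PLine} (h : IsLine P) {u : V4 × V4} (h1 : u.1 ∈ P) (h2 : u.2 ∈ P)
    (hu : ∀ x, comb u x = 0 → x = 0) : P = ln u := by
  have : IsLine (ln u) := (isLine_ln_iff u).2 fun s t hst => by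
    have := hu (s, t) hst
    exact ⟨congrArg Prod.fst this, congrArg Prod.snd this⟩
  refine (Submodule.eq_of_le_of_finrank_eq ?_ (this.trans h.symm)).symm
  rw [ln, span_le]
  rintro x (rfl | rfl) <;> assumption

theorem skew_ln_iff_comb (u v : V4 × V4) :
    Skew (ln u) (ln v) ↔ ∀ x y, comb u x + comb v y = 0 → x = 0 ∧ y = 0 := by
  rw [skew_ln_iff]
  constructor
  · intro h x y hxy
    obtain ⟨h1, h2, h3, h4⟩ := h x.1 x.2 y.1 y.2 (by rw [← hxy]; simp only [comb]; module)
    exact ⟨Prod.ext h1 h2, Prod.ext h3 h4⟩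
  · intro h a b c d hh
    obtain ⟨h1, h2⟩ := h (a, b) (c, d) (by rw [← hh]; simp only [comb]; module)
    simp only [Prod.mk_eq_zero] at h1 h2
    exact ⟨h1.1, h1.2, h2.1, h2.2⟩

namespace SymTri
variable {T : V4 → V4 → V4 → ℝ} (h : SymTri T)
include h

theorem add₂ (x y y' z : V4) : T x (y + y') z = T x y z + T x y' z := by
  rw [h.swap, h.add, h.swap y, h.swap y']

theorem add₃ (x y z z' : V4) : T x y (z + z') = T x y z + T x y z' := by
  rw [h.swap', h.add₂, h.swap' x z, h.swap' x z']

theorem smul₂ (c : ℝ) (x y z : V4) : T x (c • y) z = c * T x y z := by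
  rw [h.swap, h.smul, h.swap y]

theorem smul₃ (c : ℝ) (x y z : V4) : T x y (c • z) = c * T x y z := by
  rw [h.swap', h.smul₂, h.swap' x z]

theorem polar {P : PLine} (hP : ∀ x ∈ P, T x x x = 0) {x y z : V4} (hx : x ∈ P) (hy : y ∈ P)
    (hz : z ∈ P) : T x y z = 0 := by
  have key : ∀ x ∈ P, ∀ y ∈ P, T x y y = 0 := by
    intro x hx y hy
    have h1 := hP _ (P.add_mem hx hy)
    have h2 := hP _ (P.add_mem hx (P.smul_mem (-1) hy))
    have h3 := hP x hx
    simp only [h.add, h.add₂, h.add₃, h.smul, h.smul₂, h.smul₃] at h1 h2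
    rw [h.swap y x y, h.rot y y x, h.swap y x y] at h1 h2
    linarith
  have h1 := key x hx _ (P.add_mem hy hz)
  rw [h.add₂, h.add₃, h.add₃, key x hx y hy, key x hx z hz, h.swap' x z y] at h1
  linarith

theorem comb₃ (u v w : V4 × V4) (x y z : ℝ × ℝ) : T (comb u x) (comb v y) (comb w z) =
    ((T u.1 v.1 w.1 * x.1 * y.1 + (T u.1 v.2 w.1 * x.1 * y.2 + T u.2 v.1 w.1 * x.2 * y.1) +
      T u.2 v.2 w.1 * x.2 * y.2) * z.1 +
    (T u.1 v.1 w.2 * x.1 * y.1 + (T u.1 v.2 w.2 * x.1 * y.2 + T u.2 v.1 w.2 * x.2 * y.1) +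
      T u.2 v.2 w.2 * x.2 * y.2) * z.2) := by
  simp only [comb, h.add, h.add₂, h.add₃, h.smul, h.smul₂, h.smul₃]; ring

end SymTri

/-- The coefficients of a symmetric trilinear form with respect to two pairs of vectors. -/
def coeffs (T : V4 → V4 → V4 → ℝ) (u v : V4 × V4) : Fin 6 → ℝ :=
  ![T u.1 u.1 v.1, T u.1 u.2 v.1, T u.2 u.2 v.1, T u.1 u.1 v.2, T u.1 u.2 v.2, T u.2 u.2 v.2]

theorem SymTri.tf_coeffs {T : V4 → V4 → V4 → ℝ} (h : SymTri T) (u v : V4 × V4) (x x' y : ℝ × ℝ) :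
    tf (coeffs T u v) x x' y = T (comb u x) (comb u x') (comb v y) := by
  rw [h.comb₃, h.swap u.2 u.1, h.swap u.2 u.1]
  simp [tf, coeffs]; ring

/-- The value of the form on a sum of vectors of two lines on the cubic. -/
theorem SymTri.add_self {T : V4 → V4 → V4 → ℝ} (h : SymTri T) {P Q : PLine}
    (hP : ∀ x ∈ P, T x x x = 0) (hQ : ∀ x ∈ Q, T x x x = 0) {x y : V4} (hx : x ∈ P) (hy : y ∈ Q) :
    T (x + y) (x + y) (x + y) = 3 * (T x x y + T y y x) := by
  simp only [h.add, h.add₂, h.add₃]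
  rw [hP x hx, hQ y hy, h.swap y x y, h.rot y y x, h.swap y x y, h.rot y x x, h.rot x y x, h.swap y x x,
    h.rot x y x, h.rot y x x]
  linarith

theorem nsPair_coeffs {T : V4 → V4 → V4 → ℝ} (h : SymTri T) (hns : NonSing T) {u v : V4 × V4}
    (huv : Skew (ln u) (ln v)) (hu : ∀ x ∈ ln u, T x x x = 0) (hv : ∀ x ∈ ln v, T x x x = 0) :
    NSPair (coeC (coeffs T u v)) (coeC (coeffs T v u)) := by
  intro x y h1 h2
  set xr : ℝ × ℝ := (x.1.re, x.2.re) with hxr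
  set xi : ℝ × ℝ := (x.1.im, x.2.im) with hxi
  set yr : ℝ × ℝ := (y.1.re, y.2.re) with hyr
  set yi : ℝ × ℝ := (y.1.im, y.2.im) with hyi
  have re1 : ∀ (p : Fin 6 → ℝ) (x y : ℂ × ℂ) (k : ℝ × ℝ), (tf (coeC p) x (toC k) y).re =
      tf p (x.1.re, x.2.re) k (y.1.re, y.2.re) - tf p (x.1.im, x.2.im) k (y.1.im, y.2.im) := by
    intro p x y k; simp [tf, coeC, toC]; ring
  have im1 : ∀ (p : Fin 6 → ℝ) (x y : ℂ × ℂ) (k : ℝ × ℝ), (tf (coeC p) x (toC k) y).im =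
      tf p (x.1.re, x.2.re) k (y.1.im, y.2.im) + tf p (x.1.im, x.2.im) k (y.1.re, y.2.re) := by
    intro p x y k; simp [tf, coeC, toC]; ring
  have re2 : ∀ (p : Fin 6 → ℝ) (x : ℂ × ℂ) (k : ℝ × ℝ), (tf (coeC p) x x (toC k)).re =
      tf p (x.1.re, x.2.re) (x.1.re, x.2.re) k - tf p (x.1.im, x.2.im) (x.1.im, x.2.im) k := by
    intro p x k; simp [tf, coeC, toC]; ring
  have im2 : ∀ (p : Fin 6 → ℝ) (x : ℂ × ℂ) (k : ℝ × ℝ), (tf (coeC p) x x (toC k)).im =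
      2 * tf p (x.1.re, x.2.re) (x.1.im, x.2.im) k := by
    intro p x k; simp [tf, coeC, toC]; ring
  have A1 : ∀ k, 2 * (tf (coeffs T u v) xr k yr - tf (coeffs T u v) xi k yi) +
      (tf (coeffs T v u) yr yr k - tf (coeffs T v u) yi yi k) = 0 := by
    intro k
    have := congrArg Complex.re (h1 (toC k))
    rw [Complex.add_re, Complex.zero_re, re2] at this
    rw [← re1, ← this]; simp; rfl
  have A2 : ∀ k, (tf (coeffs T u v) xr k yi + tf (coeffs T u v) xi k yr) +
      tf (coeffs T v u) yr yi k = 0 := by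
    intro k
    have := congrArg Complex.im (h1 (toC k))
    rw [Complex.add_im, Complex.zero_im, im2] at this
    rw [← im1]
    have e : (2 * tf (coeC (coeffs T u v)) x (toC k) y).im = 2 * (tf (coeC (coeffs T u v)) x (toC k) y).im := by
      simp
    rw [e] at this; linarith
  have B1 : ∀ k, 2 * (tf (coeffs T v u) yr k xr - tf (coeffs T v u) yi k xi) +
      (tf (coeffs T u v) xr xr k - tf (coeffs T u v) xi xi k) = 0 := by
    intro k
    have := congrArg Complex.re (h2 (toC k))
    rw [Complex.add_re, Complex.zero_re, re2] at this
    rw [← re1, ← this]; simp; ring!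
  have B2 : ∀ k, (tf (coeffs T v u) yr k xi + tf (coeffs T v u) yi k xr) +
      tf (coeffs T u v) xr xi k = 0 := by
    intro k
    have := congrArg Complex.im (h2 (toC k))
    rw [Complex.add_im, Complex.zero_im, im2] at this
    rw [← im1]
    have e : (2 * tf (coeC (coeffs T v u)) y (toC k) x).im = 2 * (tf (coeC (coeffs T v u)) y (toC k) x).im := by
      simp
    rw [e] at this; linarith
  simp only [h.tf_coeffs] at A1 A2 B1 B2
  have pu : ∀ a b c, T (comb u a) (comb u b) (comb u c) = 0 := fun a b c =>
    h.polar hu (comb_mem_ln u a) (comb_mem_ln u b) (comb_mem_ln u c)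
  have pv : ∀ a b c, T (comb v a) (comb v b) (comb v c) = 0 := fun a b c =>
    h.polar hv (comb_mem_ln v a) (comb_mem_ln v b) (comb_mem_ln v c)
  obtain ⟨e1, e2⟩ := hns (comb u xr + comb v yr) (comb u xi + comb v yi) (fun w => by
    obtain ⟨a, ha, b, hb, rfl⟩ := huv.exists_add w
    obtain ⟨a, rfl⟩ := mem_ln_iff_comb.1 ha
    obtain ⟨b, rfl⟩ := mem_ln_iff_comb.1 hb
    have a1 := A1 a
    have b1 := B1 b
    simp only [h.add, h.add₂, h.add₃, pu, pv]
    rw [h.swap' (comb u xr) (comb v yr) (comb u a), h.rot (comb v yr) (comb u xr) (comb u a),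
      h.swap' (comb u xi) (comb v yi) (comb u a), h.rot (comb v yi) (comb u xi) (comb u a),
      h.swap' (comb v yr) (comb u xr) (comb v b), h.rot (comb u xr) (comb v yr) (comb v b),
      h.swap' (comb v yi) (comb u xi) (comb v b), h.rot (comb u xi) (comb v yi) (comb v b)]
    linarith) (fun w => by
    obtain ⟨a, ha, b, hb, rfl⟩ := huv.exists_add w
    obtain ⟨a, rfl⟩ := mem_ln_iff_comb.1 ha
    obtain ⟨b, rfl⟩ := mem_ln_iff_comb.1 hb
    have a2 := A2 a
    have b2 := B2 b
    simp only [h.add, h.add₂, h.add₃, pu, pv]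
    rw [h.swap' (comb u xr) (comb v yi) (comb u a), h.rot (comb v yr) (comb u xi) (comb u a),
      h.swap' (comb v yr) (comb u xi) (comb v b), h.rot (comb u xr) (comb v yi) (comb v b)]
    linarith)
  rw [skew_ln_iff_comb] at huv
  obtain ⟨f1, f2⟩ := huv _ _ e1
  obtain ⟨f3, f4⟩ := huv _ _ e2
  simp only [hxr, hxi, hyr, hyi, Prod.mk_eq_zero] at f1 f2 f3 f4
  exact ⟨Prod.ext (Complex.ext f1.1 f3.1) (Complex.ext f1.2 f3.2),
    Prod.ext (Complex.ext f2.1 f4.1) (Complex.ext f2.2 f4.2)⟩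

/-- A basis of the graph of a linear map between two lines. -/
def graphPair (α β : V4 × V4) (t : Fin 4 → ℝ) : V4 × V4 :=
  (α.1 + comb β (t 0, t 2), α.2 + comb β (t 1, t 3))

theorem comb_graphPair (α β : V4 × V4) (t : Fin 4 → ℝ) (x : ℝ × ℝ) :
    comb (graphPair α β t) x = comb α x + comb β (mv t x) := by
  simp only [comb, graphPair, mv]; module

theorem exists_graph {α β : V4 × V4} {L : PLine} (h : Skew L (ln β)) (hαβ : Skew (ln α) (ln β)) :
    ∃ t, L = ln (graphPair α β t) := by
  obtain ⟨l, hl, b, hb, e⟩ := h.exists_add α.1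
  obtain ⟨l', hl', b', hb', e'⟩ := h.exists_add α.2
  obtain ⟨s, rfl⟩ := mem_ln_iff_comb.1 hb
  obtain ⟨s', rfl⟩ := mem_ln_iff_comb.1 hb'
  have hg : graphPair α β ![-s.1, -s'.1, -s.2, -s'.2] = (l, l') := by
    refine Prod.ext ?_ ?_ <;> simp only [graphPair, ← e, ← e', comb] <;> simp <;> abel
  refine ⟨_, h.1.eq_ln (by rw [hg]; exact hl) (by rw [hg]; exact hl') fun x hx => ?_⟩
  rw [comb_graphPair] at hx
  exact ((skew_ln_iff_comb _ _).1 hαβ _ _ hx).1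

theorem det_ne_zero_of_mv {s : Fin 4 → ℝ} (h : ∀ x, mv s x = 0 → x = 0) :
    s 0 * s 3 - s 1 * s 2 ≠ 0 := by
  intro hd
  have h1 := h (s 1, -s 0) (by simp only [mv, Prod.mk_eq_zero]; constructor <;> linarith)
  have h2 := h (s 3, -s 2) (by simp only [mv, Prod.mk_eq_zero]; constructor <;> linarith)
  simp only [Prod.mk_eq_zero, neg_eq_zero] at h1 h2
  have := h (1, 0) (by simp [mv, h1, h2])
  simp at this

theorem SymTri.graphSystem {T : V4 → V4 → V4 → ℝ} (h : SymTri T) (hns : NonSing T)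
    {α β : V4 × V4} {t : Fin 3 → Fin 4 → ℝ} (hαβ : Skew (ln α) (ln β))
    (h1 : ∀ k, Skew (ln α) (ln (graphPair α β (t k))))
    (h2 : ∀ k, Skew (ln (graphPair α β ![1, 0, 0, 1])) (ln (graphPair α β (t k))))
    (h3 : ∀ j k, j ≠ k → Skew (ln (graphPair α β (t j))) (ln (graphPair α β (t k))))
    (Tα : ∀ x ∈ ln α, T x x x = 0) (Tβ : ∀ x ∈ ln β, T x x x = 0)
    (Tγ : ∀ x ∈ ln (graphPair α β ![1, 0, 0, 1]), T x x x = 0)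
    (Tt : ∀ k, ∀ x ∈ ln (graphPair α β (t k)), T x x x = 0) :
    GraphSystem (coeffs T α β) (coeffs T β α) t := by
  have graph : ∀ s, (∀ x ∈ ln (graphPair α β s), T x x x = 0) → ∀ x,
      tf (coeffs T α β) x x (mv s x) + tf (coeffs T β α) (mv s x) (mv s x) x = 0 := by
    intro s hs x
    have := hs _ (comb_mem_ln _ x)
    rw [comb_graphPair, h.add_self Tα Tβ (comb_mem_ln _ _) (comb_mem_ln _ _)] at this
    rw [h.tf_coeffs, h.tf_coeffs]
    linarith
  have graph_mem : ∀ s x, comb α x + comb β (mv s x) ∈ ln (graphPair α β s) := fun s x => by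
    rw [← comb_graphPair]; exact comb_mem_ln _ _
  have zero_of : ∀ {P Q : PLine} {x y : ℝ × ℝ}, Skew P Q → comb α x + comb β y ∈ P →
      comb α x + comb β y ∈ Q → x = 0 := fun hPQ hP hQ =>
    ((skew_ln_iff_comb _ _).1 hαβ _ _ (hPQ.eq_zero hP hQ)).1
  have one_mv : ∀ x : ℝ × ℝ, mv ![1, 0, 0, 1] x = x := fun x => by simp [mv]
  refine ⟨nsPair_coeffs h hns hαβ Tα Tβ, fun x => ?_, fun k => graph _ (Tt k), fun k => ?_,
    fun k => ?_, fun j k hjk => ?_⟩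
  · have := graph _ Tγ x
    rwa [one_mv] at this
  · refine det_ne_zero_of_mv fun x hx => zero_of (h1 k) (y := mv (t k) x) ?_ (graph_mem _ _)
    rw [hx]; simpa [comb] using comb_mem_ln α x
  · refine det_ne_zero_of_mv (s := ![t k 0 - 1, t k 1, t k 2, t k 3 - 1]) fun x hx =>
      zero_of (h2 k) (y := mv (t k) x) ?_ (graph_mem _ _)
    have e : mv (t k) x = mv ![1, 0, 0, 1] x := by
      simp only [mv, Prod.mk_eq_zero] at hx
      refine Prod.ext ?_ ?_ <;> simp [mv] at hx ⊢ <;> linarith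
    rw [e]; exact graph_mem _ _
  · refine det_ne_zero_of_mv (s := ![t j 0 - t k 0, t j 1 - t k 1, t j 2 - t k 2, t j 3 - t k 3])
      fun x hx => zero_of (h3 j k hjk) (y := mv (t k) x) ?_ (graph_mem _ _)
    have e : mv (t k) x = mv (t j) x := by
      simp only [mv, Prod.mk_eq_zero] at hx
      refine Prod.ext ?_ ?_ <;> simp [mv] at hx ⊢ <;> linarith
    rw [e]; exact graph_mem _ _

/-- Every real Schläfli six has a real line of the opposite six. -/
theorem IsSchlafliSix.exists_transversal {L : Fin 6 → PLine} (hL : IsSchlafliSix L) :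
    ∃ T, SymTri T ∧ NonSing T ∧ (∀ i, ∀ x ∈ L i, T x x x = 0) ∧ ∃ i₀ u, Skew (ln u) (L i₀) ∧
      (∀ i, i ≠ i₀ → ∃ x ∈ L i, x ∈ ln u ∧ x ≠ 0) ∧ ∀ x ∈ ln u, T x x x = 0 := by
  obtain ⟨hs, T, h, hns, hT⟩ := (isSchlafliSix_iff L).1 hL
  refine ⟨T, h, hns, hT, ?_⟩
  obtain ⟨α, hα⟩ := (hs 0 1 (by decide)).1.exists_ln
  obtain ⟨β₀, hβ₀⟩ := (hs 0 1 (by decide)).2.1.exists_ln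
  have h0 := hs 0 1 (by decide)
  have h20 := hs 2 0 (by decide)
  have h21 := hs 2 1 (by decide)
  rw [hβ₀] at h0 h21
  rw [hα] at h0 h20
  obtain ⟨s, hs2⟩ := exists_graph h21 h0
  set β : V4 × V4 := (comb β₀ (s 0, s 2), comb β₀ (s 1, s 3)) with hβ
  have hcβ : ∀ x, comb β x = comb β₀ (mv s x) := fun x => by
    simp only [comb, hβ, mv]; module
  have hL1 : L 1 = ln β := by
    rw [hβ₀]
    refine h0.2.1.eq_ln ?_ ?_ fun x hx => ?_
    · exact comb_mem_ln _ _
    · exact comb_mem_ln _ _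
    · have h1 : comb α x ∈ L 2 := by
        rw [hs2]
        have := comb_mem_ln (graphPair α β₀ s) x
        rwa [comb_graphPair, ← hcβ, hx, add_zero] at this
      exact comb_eq_zero h0.1 (h20.eq_zero h1 (comb_mem_ln _ _))
  have hL2 : L 2 = ln (graphPair α β ![1, 0, 0, 1]) := by
    rw [hs2]; congr 1
    refine Prod.ext ?_ ?_ <;> simp [graphPair, comb, hβ]
  have hαβ : Skew (ln α) (ln β) := by rw [← hα, ← hL1]; exact hs 0 1 (by decide)
  choose t ht using fun k : Fin 3 => exists_graph (α := α) (L := L (Fin.natAdd 3 k))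
    (by rw [← hL1]; exact hs _ _ (by fin_cases k <;> decide)) hαβ
  have hG : GraphSystem (coeffs T α β) (coeffs T β α) t := by
    refine h.graphSystem hns hαβ (fun k => ?_) (fun k => ?_) (fun j k hjk => ?_) ?_ ?_ ?_ fun k => ?_
    · rw [← hα, ← ht]; exact hs _ _ (by fin_cases k <;> decide)
    · rw [← hL2, ← ht]; exact hs _ _ (by fin_cases k <;> decide)
    · rw [← ht, ← ht]; exact hs _ _ fun e => hjk (Fin.natAdd_injective _ _ e)
    · rw [← hα]; exact hT 0
    · rw [← hL1]; exact hT 1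
    · rw [← hL2]; exact hT 2
    · rw [← ht]; exact hT _
  obtain ⟨r, hr, hr0, i, hi, hj⟩ := hG.exists_real_root
  have inj := (skew_ln_iff_comb _ _).1 hαβ
  have cu : ∀ ξ : ℝ × ℝ, comb (comb α r, comb β r) ξ = comb α (ξ.1 • r) + comb β (ξ.2 • r) := by
    intro ξ; rw [comb_smul, comb_smul]; rfl
  refine ⟨Fin.natAdd 3 i, (comb α r, comb β r), ?_, ?_, ?_⟩
  · rw [ht, skew_ln_iff_comb]
    intro ξ x hx
    rw [cu, comb_graphPair] at hx
    obtain ⟨e1, e2⟩ := inj (ξ.1 • r + x) (ξ.2 • r + mv (t i) x) (by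
      rw [← hx]; simp only [comb, Prod.fst_add, Prod.snd_add]; module)
    have ex : x = -(ξ.1 • r) := by linear_combination (exp := 1) e1
    have hξ : ξ.1 * wd r (mv (t i) r) = 0 := by
      rw [ex] at e2
      have a := congrArg Prod.fst e2
      have b := congrArg Prod.snd e2
      simp [mv] at a b
      simp only [wd, mv]
      linear_combination r.2 * a - r.1 * b
    have h1 : ξ.1 = 0 := (mul_eq_zero.1 hξ).resolve_right hi
    have hx0 : x = 0 := by rw [ex, h1]; simp
    rw [hx0] at e2
    have h2 : ξ.2 = 0 := by
      have e3 : ξ.2 • r = 0 := by rw [← e2]; ext <;> simp [mv]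
      exact (smul_eq_zero.1 e3).resolve_right hr
    exact ⟨Prod.ext h1 h2, hx0⟩
  · intro k hk
    have mem : ∀ a b : ℝ, comb α (a • r) + comb β (b • r) ∈ ln (comb α r, comb β r) := fun a b => by
      have := comb_mem_ln (comb α r, comb β r) (a, b)
      rwa [cu] at this
    have ne : ∀ a b : ℝ, a ≠ 0 ∨ b ≠ 0 → comb α (a • r) + comb β (b • r) ≠ 0 := fun a b hab h0 => by
      obtain ⟨h1, h2⟩ := inj _ _ h0
      rcases hab with hh | hh
      · exact hr ((smul_eq_zero.1 h1).resolve_left hh)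
      · exact hr ((smul_eq_zero.1 h2).resolve_left hh)
    have g3 : ∀ j : Fin 3, j ≠ i → ∃ x ∈ L (Fin.natAdd 3 j), x ∈ ln (comb α r, comb β r) ∧ x ≠ 0 := by
      intro j hji
      obtain ⟨a, ha⟩ := exists_smul_of_wd hr (hj j hji)
      refine ⟨_, ?_, mem 1 a, ne 1 a (Or.inl one_ne_zero)⟩
      rw [ht, one_smul, ← ha, ← comb_graphPair]
      exact comb_mem_ln _ _
    induction k using Fin.addCases (m := 3) (n := 3) with
    | right j => exact g3 j (by rintro rfl; exact hk rfl)
    | left j =>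
      fin_cases j
      · refine ⟨_, ?_, mem 1 0, ne 1 0 (by simp)⟩
        change _ ∈ L 0
        rw [hα]; simpa [comb] using comb_mem_ln α r
      · refine ⟨_, ?_, mem 0 1, ne 0 1 (by simp)⟩
        change _ ∈ L 1
        rw [hL1]; simpa [comb] using comb_mem_ln β r
      · refine ⟨_, ?_, mem 1 1, ne 1 1 (by simp)⟩
        change _ ∈ L 2
        rw [hL2]
        have := comb_mem_ln (graphPair α β ![1, 0, 0, 1]) r
        rw [comb_graphPair] at this
        simpa [mv] using this
  · intro x hx
    obtain ⟨ξ, rfl⟩ := mem_ln_iff_comb.1 hx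
    have Tα : ∀ x ∈ ln α, T x x x = 0 := by rw [← hα]; exact hT 0
    have Tβ : ∀ x ∈ ln β, T x x x = 0 := by rw [← hL1]; exact hT 1
    have hq0 : tf (coeffs T β α) r r r = 0 := by have := hG.diag r; linarith
    rw [h.tf_coeffs] at hr0 hq0
    rw [cu, h.add_self Tα Tβ (comb_mem_ln _ _) (comb_mem_ln _ _)]
    simp only [comb_smul, h.smul, h.smul₂, h.smul₃, hr0, hq0]
    ring

section NormalForm
variable {K : Type*} [Field K]

/-- The bilinear form `x₁y₁ + κx₂y₂`. -/
def bf (κ : K) (x y : K × K) : K := x.1 * y.1 + κ * (x.2 * y.2)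

/-- The quadratic map with `P x x y = y ∧ w x`. -/
def wf (κ : K) (v : K × K) : K × K := (-2 * (v.1 * v.2), v.1 ^ 2 - κ * v.2 ^ 2)

/-- The derivative of `wf`. -/
def dwf (κ : K) (v k : K × K) : K × K :=
  (-2 * (v.1 * k.2 + v.2 * k.1), 2 * (v.1 * k.1 - κ * (v.2 * k.2)))

/-- The rotation by a right angle with respect to `bf`. -/
def sg (κ : K) (v : K × K) : K × K := (-(κ * v.2), v.1)

/-- Coefficients of the pencil in normal form. -/
def pk (κ : K) : Fin 6 → K := ![1, 0, -κ, 0, 1, 0]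

/-- The second pencil attached to a binary quintic. -/
def qk (κ : K) (r : Fin 6 → K) : Fin 6 → K :=
  ![(r 2 + 2 * κ * r 0 + κ * (r 4 - r 0)) / 4, (r 5 - r 1) / 4, r 0,
    (r 3 - κ * (r 5 - r 1) + 2 * κ * r 5) / 4, κ * (r 4 - r 0) / 4, r 5]

/-- The value of a binary quartic. -/
def quart (g : Fin 5 → K) (x : K × K) : K :=
  g 0 * x.1 ^ 4 + g 1 * x.1 ^ 3 * x.2 + g 2 * x.1 ^ 2 * x.2 ^ 2 + g 3 * x.1 * x.2 ^ 3 + g 4 * x.2 ^ 4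

/-- The value of a binary quintic. -/
def quint (r : Fin 6 → K) (x : K × K) : K :=
  r 0 * x.1 ^ 5 + r 1 * x.1 ^ 4 * x.2 + r 2 * x.1 ^ 3 * x.2 ^ 2 + r 3 * x.1 ^ 2 * x.2 ^ 3 +
    r 4 * x.1 * x.2 ^ 4 + r 5 * x.2 ^ 5

/-- The product of a quartic with the linear form `v ∧ x`. -/
def mulForm (v : K × K) (g : Fin 5 → K) : Fin 6 → K :=
  ![-(v.2 * g 0), v.1 * g 0 - v.2 * g 1, v.1 * g 1 - v.2 * g 2, v.1 * g 2 - v.2 * g 3,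
    v.1 * g 3 - v.2 * g 4, v.1 * g 4]

/-- The quartic with four prescribed zeros. -/
def quartOf (u : Fin 4 → K × K) : Fin 5 → K :=
  ![(u 0).2 * (u 1).2 * (u 2).2 * (u 3).2,
    -((u 0).1 * (u 1).2 * (u 2).2 * (u 3).2 + (u 0).2 * (u 1).1 * (u 2).2 * (u 3).2 +
      (u 0).2 * (u 1).2 * (u 2).1 * (u 3).2 + (u 0).2 * (u 1).2 * (u 2).2 * (u 3).1),
    (u 0).1 * (u 1).1 * (u 2).2 * (u 3).2 + (u 0).1 * (u 1).2 * (u 2).1 * (u 3).2 +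
      (u 0).1 * (u 1).2 * (u 2).2 * (u 3).1 + (u 0).2 * (u 1).1 * (u 2).1 * (u 3).2 +
      (u 0).2 * (u 1).1 * (u 2).2 * (u 3).1 + (u 0).2 * (u 1).2 * (u 2).1 * (u 3).1,
    -((u 0).2 * (u 1).1 * (u 2).1 * (u 3).1 + (u 0).1 * (u 1).2 * (u 2).1 * (u 3).1 +
      (u 0).1 * (u 1).1 * (u 2).2 * (u 3).1 + (u 0).1 * (u 1).1 * (u 2).1 * (u 3).2),
    (u 0).1 * (u 1).1 * (u 2).1 * (u 3).1]

theorem quart_quartOf (u : Fin 4 → K × K) (x : K × K) : quart (quartOf u) x = ∏ k, wd (u k) x := by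
  rw [Fin.prod_univ_four]; simp [quart, quartOf, wd]; ring

theorem mulForm_quartOf (v : Fin 5 → K × K) (i : Fin 5) :
    mulForm (v 0) (quartOf fun k => v ((0 : Fin 5).succAbove k)) =
      mulForm (v i) (quartOf fun k => v (i.succAbove k)) := by
  fin_cases i
  · rfl
  all_goals
    ext j
    fin_cases j <;> simp [mulForm, quartOf, Fin.succAbove, Fin.lt_def] <;> ring

theorem quint_mulForm (v : K × K) (g : Fin 5 → K) (x : K × K) :
    quint (mulForm v g) x = wd v x * quart g x := by
  simp [quint, mulForm, wd, quart]; ring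

variable {κ : K}

theorem tf_pk_self (x y : K × K) : tf (pk κ) x x y = wd y (wf κ x) := by
  simp [tf, pk, wd, wf]; ring

theorem tf_pk_wf (v x h : K × K) :
    tf (pk κ) x h (wf κ v) = wd v x * bf κ v h + wd v h * bf κ v x := by
  simp [tf, pk, wd, wf, bf]; ring

theorem wd_dwf (v k : K × K) : wd (dwf κ v k) (wf κ v) = 2 * (wd k v * bf κ v v) := by
  simp only [dwf, wd, wf, bf]; ring

theorem wd_wf (v v' : K × K) : wd (wf κ v) (wf κ v') = 2 * (wd v v' * bf κ v v') := by
  simp only [wd, wf, bf]; ring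

theorem wd_sg (v v' : K × K) : wd v (sg κ v') = bf κ v' v := by
  simp only [wd, sg, bf]; ring

theorem wf_smul (c : K) (v : K × K) : wf κ (c • v) = c ^ 2 • wf κ v := by
  simp only [wf, Prod.smul_fst, Prod.smul_snd, smul_eq_mul, Prod.smul_mk]
  refine Prod.ext ?_ ?_ <;> simp only <;> ring

theorem wd_self (v : K × K) : wd v v = 0 := by simp only [wd]; ring

theorem wd_comm (v w : K × K) : wd v w = -wd w v := by simp only [wd]; ring

theorem eq_zero_of_wd {z : K × K} (h : ∀ k, wd z k = 0) : z = 0 := by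
  have a := h (0, 1)
  have b := h (1, 0)
  simp [wd] at a b
  exact Prod.ext a b

theorem wf_eq_zero [CharZero K] (hκ : κ ^ 2 = 1) {x : K × K} (h : wf κ x = 0) : x = 0 := by
  simp only [wf, Prod.mk_eq_zero] at h
  obtain ⟨h1, h2⟩ := h
  have h1' : x.1 * x.2 = 0 := (mul_eq_zero.1 h1).resolve_left (by norm_num)
  have hκ0 : κ ≠ 0 := by rintro rfl; simp at hκ
  rcases mul_eq_zero.1 h1' with h3 | h3
  · rw [h3] at h2
    have : x.2 = 0 := by
      simpa [hκ0] using h2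
    exact Prod.ext h3 this
  · rw [h3] at h2
    have : x.1 = 0 := by simpa using h2
    exact Prod.ext this h3

variable [CharZero K]

theorem tf_qk_wf (hκ : κ ^ 2 = 1) (r : Fin 6 → K) (x : K × K) :
    tf (qk κ r) (wf κ x) (wf κ x) x = quint r x := by
  simp [tf, qk, wf, quint]
  linear_combination (x.1 * x.2 ^ 4 * r 4 + x.2 ^ 5 * r 5) * hκ

theorem tf_qk_mulForm (hκ : κ ^ 2 = 1) (g : Fin 5 → K) (v h : K × K) :
    tf (qk κ (mulForm v g)) (wf κ v) (wf κ v) h = wd v h * quart g (sg κ v) := by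
  simp [tf, qk, wf, mulForm, wd, sg, quart]
  linear_combination (-(v.1 * g 1 * v.2 ^ 4 * κ * h.1) - v.1 * v.2 ^ 4 * κ ^ 2 * g 0 * h.2 + v.1 ^ 2 * g 1 * v.2 ^ 3 * κ * h.2 +
    v.1 ^ 2 * v.2 ^ 3 * g 2 * h.1 + v.1 ^ 2 * v.2 ^ 3 * g 3 * h.2 - v.1 ^ 3 * v.2 ^ 2 * g 2 * h.2 +
    v.2 ^ 5 * κ ^ 2 * g 0 * h.1) * hκ

theorem tf_qk_dwf (hκ : κ ^ 2 = 1) (g : Fin 5 → K) (v k : K × K) :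
    2 * tf (qk κ (mulForm v g)) (wf κ v) (dwf κ v k) v =
      wd v k * (quart g v - quart g (sg κ v)) := by
  simp [tf, qk, wf, dwf, mulForm, wd, sg, quart]
  linear_combination (v.1 * g 1 * v.2 ^ 4 * κ * k.1 + v.1 * v.2 ^ 4 * κ ^ 2 * g 0 * k.2 + v.1 * v.2 ^ 4 * g 3 * k.1 +
    v.1 * v.2 ^ 4 * g 4 * k.2 - v.1 ^ 2 * g 1 * v.2 ^ 3 * κ * k.2 - v.1 ^ 2 * v.2 ^ 3 * g 2 * k.1 +
    3 * v.1 ^ 2 * v.2 ^ 3 * g 3 * k.2 + v.1 ^ 3 * v.2 ^ 2 * g 2 * k.2 - v.2 ^ 5 * κ ^ 2 * g 0 * k.1 - v.2 ^ 5 * g 4 * k.1) * hκ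

end NormalForm

section
variable {K : Type*} [Field K]

/-- The quintic with five prescribed zeros. -/
def quinticOf (v : Fin 5 → K × K) : Fin 6 → K :=
  mulForm (v 0) (quartOf fun k => v ((0 : Fin 5).succAbove k))

theorem quint_quinticOf (v : Fin 5 → K × K) (x : K × K) : quint (quinticOf v) x = ∏ i, wd (v i) x := by
  rw [quinticOf, quint_mulForm, quart_quartOf, Fin.prod_univ_succAbove (fun i => wd (v i) x) 0]

/-- Valid parameters of the normal form. -/
def Valid (κ : K) (v : Fin 5 → K × K) : Prop := ∀ i j, i ≠ j → wd (v i) (v j) ≠ 0 ∧ bf κ (v i) (v j) ≠ 0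

theorem Valid.ne_zero {κ : K} {v : Fin 5 → K × K} (h : Valid κ v) (i : Fin 5) : v i ≠ 0 := by
  intro h0
  obtain ⟨j, hj⟩ := exists_ne i
  exact (h i j hj.symm).1 (by rw [h0]; simp [wd])

/-- The product of the `bf κ (v i) (v j)` over `j ≠ i`. -/
def mu (κ : K) (v : Fin 5 → K × K) (i : Fin 5) : K := ∏ j, if j = i then 1 else bf κ (v i) (v j)

theorem mu_eq (κ : K) (v : Fin 5 → K × K) (i : Fin 5) :
    mu κ v i = quart (quartOf fun k => v (i.succAbove k)) (sg κ (v i)) := by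
  rw [mu, Fin.prod_univ_succAbove (fun j => if j = i then 1 else bf κ (v i) (v j)) i, quart_quartOf]
  simp [wd_sg]

theorem Valid.mu_ne_zero {κ : K} {v : Fin 5 → K × K} (h : Valid κ v) (i : Fin 5) : mu κ v i ≠ 0 := by
  rw [mu, Finset.prod_ne_zero_iff]
  intro j _
  split_ifs with hij
  · exact one_ne_zero
  · exact (h i j (Ne.symm hij)).2

end

theorem exists_wf_eq {κ : ℂ} (hκ : κ ^ 2 = 1) (y : ℂ × ℂ) : ∃ x, wf κ x = y := by
  obtain ⟨s, hs⟩ := IsAlgClosed.exists_pow_nat_eq (-κ) (n := 2) (by norm_num)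
  have hs0 : s ≠ 0 := by
    rintro rfl
    have : κ = 0 := by simpa using hs.symm
    simp [this] at hκ
  obtain ⟨c, hc⟩ := IsAlgClosed.exists_pow_nat_eq (y.2 - s * y.1) (n := 2) (by norm_num)
  obtain ⟨d, hd⟩ := IsAlgClosed.exists_pow_nat_eq (y.2 + s * y.1) (n := 2) (by norm_num)
  refine ⟨((c + d) / 2, (c - d) / (2 * s)), Prod.ext ?_ ?_⟩ <;> simp only [wf]
  · field_simp
    linear_combination hd - hc
  · have : κ = -s ^ 2 := by rw [hs]; ring
    rw [this]
    field_simp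
    linear_combination 2 * hd + 2 * hc

theorem nsPair_normal {κ : ℂ} (hκ : κ ^ 2 = 1) {v : Fin 5 → ℂ × ℂ} (hv : Valid κ v) :
    NSPair (pk κ) (qk κ (quinticOf v)) := by
  have hI : ∀ i, quinticOf v = mulForm (v i) (quartOf fun k => v (i.succAbove k)) :=
    fun i => mulForm_quartOf v i
  have parallel : ∀ x, quint (quinticOf v) x = 0 → ∃ (i : Fin 5) (a : ℂ), x = a • v i := by
    intro x hx
    rw [quint_quinticOf, Finset.prod_eq_zero_iff] at hx
    obtain ⟨i, -, hi⟩ := hx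
    exact ⟨i, exists_smul_of_wd (hv.ne_zero i) hi⟩
  have key : ∀ i h, tf (qk κ (quinticOf v)) (wf κ (v i)) (wf κ (v i)) h = wd (v i) h * mu κ v i := by
    intro i h
    rw [mu_eq, hI i, tf_qk_mulForm hκ]
  have exists_wd : ∀ i, ∃ h, wd (v i) h ≠ 0 := fun i => by
    by_contra! hh
    exact hv.ne_zero i (eq_zero_of_wd hh)
  intro x y h1 h2
  by_cases hy : y = 0
  · subst hy
    refine ⟨wf_eq_zero hκ (eq_zero_of_wd fun k => ?_), rfl⟩
    have := h2 k
    rw [tf_pk_self, wd_comm] at this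
    simp only [tf, Prod.fst_zero, Prod.snd_zero] at this
    linear_combination -this
  exfalso
  by_cases hx : x = 0
  · subst hx
    have h1' : ∀ h, tf (qk κ (quinticOf v)) y y h = 0 := fun h => by
      have := h1 h
      simp only [tf, Prod.fst_zero, Prod.snd_zero] at this ⊢
      linear_combination this
    obtain ⟨x', rfl⟩ := exists_wf_eq hκ y
    have hR := h1' x'
    rw [tf_qk_wf hκ] at hR
    obtain ⟨i, a, rfl⟩ := parallel x' hR
    obtain ⟨h, hh⟩ := exists_wd i
    have := h1' h
    rw [wf_smul] at this
    have e : a ^ 4 * (wd (v i) h * mu κ v i) = 0 := by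
      rw [← key i h, ← this]
      simp only [tf, Prod.smul_fst, Prod.smul_snd, smul_eq_mul]; ring
    have ha : a = 0 := by
      simpa [hh, hv.mu_ne_zero i] using e
    exact hy (by rw [ha]; simp [wf])
  have e1 := h1 x
  have e2 := h2 y
  have hP : tf (pk κ) x x y = 0 := by linear_combination (2 * e1 - e2) / 3
  have hQ : tf (qk κ (quinticOf v)) y y x = 0 := by linear_combination (2 * e2 - e1) / 3
  rw [tf_pk_self, wd_comm, neg_eq_zero] at hP
  obtain ⟨l, rfl⟩ := exists_smul_of_wd (fun h => hx (wf_eq_zero hκ h)) hP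
  have hl : l ≠ 0 := by rintro rfl; simp at hy
  have hR : quint (quinticOf v) x = 0 := by
    rw [← tf_qk_wf hκ]
    have : l ^ 2 * tf (qk κ (quinticOf v)) (wf κ x) (wf κ x) x = 0 := by
      rw [← hQ]; simp only [tf, Prod.smul_fst, Prod.smul_snd, smul_eq_mul]; ring
    exact (mul_eq_zero.1 this).resolve_left (pow_ne_zero 2 hl)
  obtain ⟨i, a, rfl⟩ := parallel x hR
  have ha : a ≠ 0 := by rintro rfl; simp at hx
  rw [wf_smul, smul_smul] at h1 h2
  set l' := l * a ^ 2 with hl'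
  have hl0 : l' ≠ 0 := mul_ne_zero hl (pow_ne_zero 2 ha)
  obtain ⟨h, hh⟩ := exists_wd i
  have f1 : 2 * a * bf κ (v i) (v i) + l' * mu κ v i = 0 := by
    have := h1 h
    have e : 2 * tf (pk κ) (a • v i) h (l' • wf κ (v i)) +
        tf (qk κ (quinticOf v)) (l' • wf κ (v i)) (l' • wf κ (v i)) h =
        2 * a * l' * tf (pk κ) (v i) h (wf κ (v i)) +
          l' ^ 2 * tf (qk κ (quinticOf v)) (wf κ (v i)) (wf κ (v i)) h := by
      simp only [tf, Prod.smul_fst, Prod.smul_snd, smul_eq_mul]; ring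
    rw [e, tf_pk_wf, key, wd_self] at this
    have e' : l' * wd (v i) h * (2 * a * bf κ (v i) (v i) + l' * mu κ v i) = 0 := by
      linear_combination this
    exact (mul_eq_zero.1 e').resolve_left (mul_ne_zero hl0 hh)
  have f2 : l' * (quart (quartOf fun k => v (i.succAbove k)) (v i) - mu κ v i) -
      2 * a * bf κ (v i) (v i) = 0 := by
    have := h2 (dwf κ (v i) h)
    have e : tf (pk κ) (a • v i) (a • v i) (dwf κ (v i) h) +
        2 * tf (qk κ (quinticOf v)) (l' • wf κ (v i)) (dwf κ (v i) h) (a • v i) =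
        a ^ 2 * tf (pk κ) (v i) (v i) (dwf κ (v i) h) +
          a * l' * (2 * tf (qk κ (quinticOf v)) (wf κ (v i)) (dwf κ (v i) h) (v i)) := by
      simp only [tf, Prod.smul_fst, Prod.smul_snd, smul_eq_mul]; ring
    rw [e, tf_pk_self, wd_dwf, hI i, tf_qk_dwf hκ, ← mu_eq, wd_comm h] at this
    have e' : a * wd (v i) h * (l' * (quart (quartOf fun k => v (i.succAbove k)) (v i) - mu κ v i) -
      2 * a * bf κ (v i) (v i)) = 0 := by linear_combination this
    exact (mul_eq_zero.1 e').resolve_left (mul_ne_zero ha hh)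
  have f3 : l' * quart (quartOf fun k => v (i.succAbove k)) (v i) = 0 := by
    linear_combination f1 + f2
  rw [quart_quartOf, mul_eq_zero, Finset.prod_eq_zero_iff] at f3
  obtain ⟨k, -, hk⟩ := f3.resolve_left hl0
  exact (hv _ _ (Fin.succAbove_ne i k)).1 hk

/-- A vector of `ℝ⁴` from two vectors of the plane. -/
def vec (x y : ℝ × ℝ) : V4 := ![x.1, x.2, y.1, y.2]

def hd (X : V4) : ℝ × ℝ := (X 0, X 1)

def tl (X : V4) : ℝ × ℝ := (X 2, X 3)

@[simp] theorem hd_vec (x y : ℝ × ℝ) : hd (vec x y) = x := rfl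

@[simp] theorem tl_vec (x y : ℝ × ℝ) : tl (vec x y) = y := rfl

theorem vec_hd_tl (X : V4) : vec (hd X) (tl X) = X := by
  ext i; fin_cases i <;> rfl

theorem det2_vec (a b c a' b' c' : ℝ × ℝ) :
    det2 (vec a 0) (vec b c) (vec a' 0) (vec b' c') = -(wd a a' * wd c c') := by
  simp [det2, vec, Matrix.det_succ_row_zero, Fin.sum_univ_succ, wd, Fin.succAbove]
  ring

theorem det2_vec_last (a b c : ℝ × ℝ) :
    det2 (vec a 0) (vec b c) (vec 0 (1, 0)) (vec 0 (0, 1)) = wd a b := by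
  simp [det2, vec, Matrix.det_succ_row_zero, Fin.sum_univ_succ, wd, Fin.succAbove]
  ring

/-- The symmetric trilinear form of the cubic `p(x,x,y) + q(y,y,x)`. -/
noncomputable def cubicForm (p q : Fin 6 → ℝ) (X Y Z : V4) : ℝ :=
  tf p (hd X) (hd Y) (tl Z) + tf p (hd X) (hd Z) (tl Y) + tf p (hd Y) (hd Z) (tl X) +
    (tf q (tl X) (tl Y) (hd Z) + tf q (tl X) (tl Z) (hd Y) + tf q (tl Y) (tl Z) (hd X))

theorem symTri_cubicForm (p q : Fin 6 → ℝ) : SymTri (cubicForm p q) := by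
  constructor <;> intros <;> simp [cubicForm, tf, hd, tl] <;> ring

theorem cubicForm_self (p q : Fin 6 → ℝ) (X : V4) : cubicForm p q X X X =
    3 * (tf p (hd X) (hd X) (tl X) + tf q (tl X) (tl X) (hd X)) := by
  simp [cubicForm]; ring

theorem cubicForm_vec_left (p q : Fin 6 → ℝ) (X Y : V4) (k : ℝ × ℝ) : cubicForm p q X Y (vec k 0) =
    tf p (hd X) k (tl Y) + tf p (hd Y) k (tl X) + tf q (tl X) (tl Y) k := by
  simp [cubicForm, tf]

theorem cubicForm_vec_right (p q : Fin 6 → ℝ) (X Y : V4) (k : ℝ × ℝ) : cubicForm p q X Y (vec 0 k) =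
    tf p (hd X) (hd Y) k + tf q (tl X) k (hd Y) + tf q (tl Y) k (hd X) := by
  simp [cubicForm, tf]; ring

theorem nonSing_cubicForm {p q : Fin 6 → ℝ} (h : NSPair (coeC p) (coeC q)) :
    NonSing (cubicForm p q) := by
  intro a b h1 h2
  have re1 : ∀ (p : Fin 6 → ℝ) (x x' y : ℂ × ℂ), (tf (coeC p) x x' y).re =
      tf p (x.1.re, x.2.re) (x'.1.re, x'.2.re) (y.1.re, y.2.re) -
      tf p (x.1.im, x.2.im) (x'.1.im, x'.2.im) (y.1.re, y.2.re) -
      tf p (x.1.re, x.2.re) (x'.1.im, x'.2.im) (y.1.im, y.2.im) -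
      tf p (x.1.im, x.2.im) (x'.1.re, x'.2.re) (y.1.im, y.2.im) := by
    intro p x x' y; simp [tf, coeC]; ring
  have im1 : ∀ (p : Fin 6 → ℝ) (x x' y : ℂ × ℂ), (tf (coeC p) x x' y).im =
      tf p (x.1.im, x.2.im) (x'.1.re, x'.2.re) (y.1.re, y.2.re) +
      tf p (x.1.re, x.2.re) (x'.1.im, x'.2.im) (y.1.re, y.2.re) +
      tf p (x.1.re, x.2.re) (x'.1.re, x'.2.re) (y.1.im, y.2.im) -
      tf p (x.1.im, x.2.im) (x'.1.im, x'.2.im) (y.1.im, y.2.im) := by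
    intro p x x' y; simp [tf, coeC]; ring
  have two : ∀ z : ℂ, 2 * z = z + z := fun z => two_mul z
  suffices H : ((⟨a 0, b 0⟩, ⟨a 1, b 1⟩) : ℂ × ℂ) = 0 ∧ ((⟨a 2, b 2⟩, ⟨a 3, b 3⟩) : ℂ × ℂ) = 0 by
    obtain ⟨e1, e2⟩ := H
    simp only [Prod.mk_eq_zero, Complex.ext_iff, Complex.zero_re, Complex.zero_im] at e1 e2
    constructor <;> ext i <;> fin_cases i <;> simp [e1, e2]
  refine h _ _ (fun k => ?_) fun k => ?_
  · have a1 := h1 (vec (k.1.re, k.2.re) 0)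
    have a2 := h2 (vec (k.1.re, k.2.re) 0)
    have b1 := h1 (vec (k.1.im, k.2.im) 0)
    have b2 := h2 (vec (k.1.im, k.2.im) 0)
    rw [cubicForm_vec_left] at a2 b2
    rw [cubicForm_vec_left, cubicForm_vec_left] at a1 b1
    apply Complex.ext
    · rw [two, Complex.add_re, Complex.add_re, re1, re1, Complex.zero_re]
      simp only [tf, hd, tl] at a1 b2 ⊢
      linear_combination a1 - 2 * b2
    · rw [two, Complex.add_im, Complex.add_im, im1, im1, Complex.zero_im]
      simp only [tf, hd, tl] at b1 a2 ⊢
      linear_combination b1 + 2 * a2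
  · have a1 := h1 (vec 0 (k.1.re, k.2.re))
    have a2 := h2 (vec 0 (k.1.re, k.2.re))
    have b1 := h1 (vec 0 (k.1.im, k.2.im))
    have b2 := h2 (vec 0 (k.1.im, k.2.im))
    rw [cubicForm_vec_right] at a2 b2
    rw [cubicForm_vec_right, cubicForm_vec_right] at a1 b1
    apply Complex.ext
    · rw [two, Complex.add_re, Complex.add_re, re1, re1, Complex.zero_re]
      simp only [tf, hd, tl] at a1 b2 ⊢
      linear_combination a1 - 2 * b2
    · rw [two, Complex.add_im, Complex.add_im, im1, im1, Complex.zero_im]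
      simp only [tf, hd, tl] at b1 a2 ⊢
      linear_combination b1 + 2 * a2

/-- A line through `(x, 0)`-space and `(u, w)`. -/
def linePair (s u w : ℝ × ℝ) : V4 × V4 := (vec s 0, vec u w)

/-- The normal form of a Schläfli six. -/
noncomputable def nf (κ : ℝ) (v : Fin 5 → ℝ × ℝ) : Fin 6 → V4 × V4 :=
  Fin.snoc (fun i => linePair (sg κ (v i)) (-(mu κ v i) • ((v i).1, κ * (v i).2))
    ((2 * ((v i).1 ^ 2 + (v i).2 ^ 2)) • wf κ (v i))) (vec 0 (1, 0), vec 0 (0, 1))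

theorem nf_castSucc (κ : ℝ) (v : Fin 5 → ℝ × ℝ) (i : Fin 5) : nf κ v i.castSucc =
    linePair (sg κ (v i)) (-(mu κ v i) • ((v i).1, κ * (v i).2))
    ((2 * ((v i).1 ^ 2 + (v i).2 ^ 2)) • wf κ (v i)) := by
  simp [nf]

theorem nf_last (κ : ℝ) (v : Fin 5 → ℝ × ℝ) :
    nf κ v (Fin.last 5) = (vec 0 (1, 0), vec 0 (0, 1)) :=
  Fin.snoc_last _ _

theorem normSq_pos {v : ℝ × ℝ} (h : v ≠ 0) : 0 < v.1 ^ 2 + v.2 ^ 2 := by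
  by_contra! h'
  have h1 : v.1 = 0 := by nlinarith [sq_nonneg v.1, sq_nonneg v.2]
  have h2 : v.2 = 0 := by nlinarith [sq_nonneg v.1, sq_nonneg v.2]
  exact h (Prod.ext h1 h2)

theorem wd_smul_smul {K : Type*} [Field K] (a b : K) (x y : K × K) :
    wd (a • x) (b • y) = a * b * wd x y := by
  simp only [wd, Prod.smul_fst, Prod.smul_snd, smul_eq_mul]; ring

theorem det2_nf (κ : ℝ) (v : Fin 5 → ℝ × ℝ) (i j : Fin 5) :
    det2 (nf κ v i.castSucc).1 (nf κ v i.castSucc).2 (nf κ v j.castSucc).1 (nf κ v j.castSucc).2 =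
      -(8 * κ * ((v i).1 ^ 2 + (v i).2 ^ 2) * ((v j).1 ^ 2 + (v j).2 ^ 2) * wd (v i) (v j) ^ 2 *
        bf κ (v i) (v j)) := by
  rw [nf_castSucc, nf_castSucc, linePair, linePair, det2_vec, wd_smul_smul, wd_wf]
  simp only [wd, sg]; ring

theorem det2_nf_last {κ : ℝ} (hκ : κ ^ 2 = 1) (v : Fin 5 → ℝ × ℝ) (i : Fin 5) :
    det2 (nf κ v i.castSucc).1 (nf κ v i.castSucc).2 (nf κ v (Fin.last 5)).1 (nf κ v (Fin.last 5)).2 =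
      mu κ v i * ((v i).1 ^ 2 + (v i).2 ^ 2) := by
  rw [nf_castSucc, nf_last, linePair, det2_vec_last]
  simp only [wd, sg, Prod.smul_fst, Prod.smul_snd, smul_eq_mul]
  linear_combination mu κ v i * (v i).2 ^ 2 * hκ

theorem isSchlafliSix_nf {κ : ℝ} (hκ : κ ^ 2 = 1) {v : Fin 5 → ℝ × ℝ} (hv : Valid κ v) :
    IsSchlafliSix (lines (nf κ v)) := by
  have hκ0 : κ ≠ 0 := by rintro rfl; simp at hκ
  rw [isSchlafliSix_iff]
  constructor
  · intro i j hij
    rw [lines, lines, skew_ln_iff_det]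
    induction i using Fin.lastCases with
    | last =>
      induction j using Fin.lastCases with
      | last => exact absurd rfl hij
      | cast j =>
        rw [← skew_ln_iff_det]
        refine Skew.symm ?_
        rw [skew_ln_iff_det, det2_nf_last hκ]
        exact mul_ne_zero (hv.mu_ne_zero j) (normSq_pos (hv.ne_zero j)).ne'
    | cast i =>
      induction j using Fin.lastCases with
      | last =>
        rw [det2_nf_last hκ]
        exact mul_ne_zero (hv.mu_ne_zero i) (normSq_pos (hv.ne_zero i)).ne'
      | cast j =>
        rw [det2_nf]
        obtain ⟨h1, h2⟩ := hv i j (by rintro rfl; exact hij rfl)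
        have := (normSq_pos (hv.ne_zero i)).ne'
        have := (normSq_pos (hv.ne_zero j)).ne'
        simp [*]
  · refine ⟨cubicForm (pk κ) (qk κ (quinticOf v)), symTri_cubicForm _ _, ?_, ?_⟩
    · apply nonSing_cubicForm
      have hv' : Valid (κ : ℂ) fun i => toC (v i) := by
        intro i j hij
        obtain ⟨h1, h2⟩ := hv i j hij
        constructor
        · have : wd (toC (v i)) (toC (v j)) = ((wd (v i) (v j) : ℝ) : ℂ) := by simp [wd, toC]
          rw [this]; exact_mod_cast h1
        · have : bf (κ : ℂ) (toC (v i)) (toC (v j)) = ((bf κ (v i) (v j) : ℝ) : ℂ) := by simp [bf, toC]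
          rw [this]; exact_mod_cast h2
      convert nsPair_normal (κ := (κ : ℂ)) (by exact_mod_cast hκ) hv' using 1
      · ext i; fin_cases i <;> simp [pk, coeC]
      · ext i; fin_cases i <;> simp [qk, coeC, quinticOf, mulForm, quartOf, toC]
    · intro i x hx
      rw [lines, mem_ln_iff_comb] at hx
      obtain ⟨s, rfl⟩ := hx
      rw [cubicForm_self]
      induction i using Fin.lastCases with
      | last =>
        rw [nf_last]; simp [comb, tf, vec, hd, tl]
      | cast i =>
        have key : ∀ h, tf (qk κ (quinticOf v)) (wf κ (v i)) (wf κ (v i)) h = wd (v i) h * mu κ v i := by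
          intro h
          rw [mu_eq, show quinticOf v = _ from mulForm_quartOf v i, tf_qk_mulForm hκ]
        have e1 : hd (comb (nf κ v i.castSucc) s) =
            s.1 • sg κ (v i) + s.2 • -(mu κ v i) • ((v i).1, κ * (v i).2) := by
          rw [nf_castSucc]; refine Prod.ext ?_ ?_ <;> simp [comb, linePair, hd, vec]
        have e2 : tl (comb (nf κ v i.castSucc) s) =
            (s.2 * (2 * ((v i).1 ^ 2 + (v i).2 ^ 2))) • wf κ (v i) := by
          rw [nf_castSucc]; refine Prod.ext ?_ ?_ <;> simp [comb, linePair, tl, vec] <;> ring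
        rw [e1, e2]
        set X := s.1 • sg κ (v i) + s.2 • -(mu κ v i) • ((v i).1, κ * (v i).2) with hX
        set c := s.2 * (2 * ((v i).1 ^ 2 + (v i).2 ^ 2)) with hc
        have e3 : tf (pk κ) X X (c • wf κ (v i)) + tf (qk κ (quinticOf v)) (c • wf κ (v i)) (c • wf κ (v i)) X
            = c * tf (pk κ) X X (wf κ (v i)) + c ^ 2 * tf (qk κ (quinticOf v)) (wf κ (v i)) (wf κ (v i)) X := by
          simp only [tf, Prod.smul_fst, Prod.smul_snd, smul_eq_mul]; ring
        rw [e3, key, tf_pk_wf]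
        simp only [hX, hc, sg, wd, bf, Prod.fst_add, Prod.snd_add, Prod.smul_fst, Prod.smul_snd, smul_eq_mul]
        linear_combination (-12 * (1 + κ) * s.2 ^ 2 * (v i).1 ^ 2 * (v i).2 ^ 4 * s.1 * mu κ v i -
          12 * s.2 ^ 2 * (v i).1 ^ 4 * (v i).2 ^ 2 * s.1 * mu κ v i -
          12 * κ * s.2 ^ 2 * (v i).2 ^ 6 * s.1 * mu κ v i -
          12 * (1 - κ) * s.2 ^ 3 * (v i).1 * (v i).2 ^ 5 * mu κ v i ^ 2 -
          12 * (1 - κ) * s.2 ^ 3 * (v i).1 ^ 3 * (v i).2 ^ 3 * mu κ v i ^ 2) * hκ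

theorem exists_binary_root (A B C : ℂ) : ∃ x : ℂ × ℂ, x ≠ 0 ∧
    A * x.1 * x.1 + B * (x.1 * x.2 + x.2 * x.1) + C * x.2 * x.2 = 0 := by
  by_cases hA : A = 0
  · exact ⟨(1, 0), by simp, by simp [hA]⟩
  · obtain ⟨s, hs⟩ := IsAlgClosed.exists_pow_nat_eq (B ^ 2 - A * C) (n := 2) (by norm_num)
    exact ⟨(-B + s, A), by simp [hA], by simp only; linear_combination A * hs⟩

/-- A pencil without base points is spanned by its apolar conjugate pairs. -/
theorem exists_apolar {p : Fin 6 → ℝ} (hp : ∀ x : ℂ × ℂ, (∀ k, tf (coeC p) x x k = 0) → x = 0) :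
    ∃ (d₁ d₂ : ℝ) (f₁ f₂ : ℝ × ℝ), d₁ ≠ 0 ∧ d₂ ≠ 0 ∧ wd f₁ f₂ ≠ 0 ∧
      ∀ y, d₁ * tf p f₁ f₁ y + d₂ * tf p f₂ f₂ y = 0 := by
  have hp' : ∀ x : ℝ × ℝ, (∀ k, tf p x x k = 0) → x = 0 := by
    intro x hx
    have a := hx (1, 0)
    have b := hx (0, 1)
    have := hp (toC x) (fun k => by
      simp [tf, coeC, toC] at a b ⊢
      have a' := congrArg (fun r : ℝ => (r : ℂ)) a
      have b' := congrArg (fun r : ℝ => (r : ℂ)) b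
      push_cast at a' b'
      linear_combination k.1 * a' + k.2 * b')
    simpa [toC, Prod.ext_iff] using this
  set n₀ := p 1 * p 5 - p 2 * p 4 with hn₀
  set n₁ := p 2 * p 3 - p 0 * p 5 with hn₁
  set n₂ := p 0 * p 4 - p 1 * p 3 with hn₂
  by_cases h0 : n₀ = 0
  · by_cases h2 : n₂ = 0
    · by_cases h1 : n₁ = 0
      · exfalso
        by_cases hz : p 0 = 0 ∧ p 1 = 0 ∧ p 2 = 0
        · obtain ⟨x, hx, h⟩ := exists_binary_root (p 3) (p 4) (p 5)
          refine hx (hp x fun k => ?_)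
          simp only [tf, coeC, hz]
          push_cast
          linear_combination k.2 * h
        · obtain ⟨x, hx, h⟩ := exists_binary_root (p 0) (p 1) (p 2)
          have c0 : (p 1 * p 5 - p 2 * p 4 : ℂ) = 0 := by exact_mod_cast h0
          have c1 : (p 2 * p 3 - p 0 * p 5 : ℂ) = 0 := by exact_mod_cast h1
          have c2 : (p 0 * p 4 - p 1 * p 3 : ℂ) = 0 := by exact_mod_cast h2
          have e : ∀ i : Fin 3, (p (Fin.castLE (by norm_num) i) : ℂ) *
              (p 3 * x.1 * x.1 + p 4 * (x.1 * x.2 + x.2 * x.1) + p 5 * x.2 * x.2) = 0 := by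
            intro i
            fin_cases i <;> simp only [Fin.castLE]
            · change (p 0 : ℂ) * _ = 0
              linear_combination p 3 * h - x.2 * x.2 * c1 + 2 * x.1 * x.2 * c2
            · change (p 1 : ℂ) * _ = 0
              linear_combination p 4 * h + x.2 * x.2 * c0 - x.1 * x.1 * c2
            · change (p 2 : ℂ) * _ = 0
              linear_combination p 5 * h - 2 * x.1 * x.2 * c0 + x.1 * x.1 * c1
          have h' : p 3 * x.1 * x.1 + p 4 * (x.1 * x.2 + x.2 * x.1) + p 5 * x.2 * x.2 = 0 := by
            by_contra hne
            refine hz ⟨?_, ?_, ?_⟩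
            · exact_mod_cast (mul_eq_zero.1 (e 0)).resolve_right hne
            · exact_mod_cast (mul_eq_zero.1 (e 1)).resolve_right hne
            · exact_mod_cast (mul_eq_zero.1 (e 2)).resolve_right hne
          refine hx (hp x fun k => ?_)
          simp only [tf, coeC]
          linear_combination k.1 * h + k.2 * h'
      · refine ⟨1, -1, (1, 1), (1, -1), by norm_num, by norm_num, by norm_num [wd], fun y => ?_⟩
        have a : p 1 = 0 := by
          refine (mul_eq_zero.1 (?_ : n₁ * p 1 = 0)).resolve_left h1
          linear_combination -p 0 * h0 - p 2 * h2
        have b : p 4 = 0 := by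
          refine (mul_eq_zero.1 (?_ : n₁ * p 4 = 0)).resolve_left h1
          linear_combination -p 3 * h0 - p 5 * h2
        simp only [tf, a, b]; ring
    · refine ⟨n₂, n₀ - n₁ ^ 2 / (4 * n₂), (n₁ / (2 * n₂), 1), (1, 0), h2, fun h => ?_, ?_, fun y => ?_⟩
      · have := hp' (n₁ / (2 * n₂), 1) fun k => ?_
        · simp at this
        · refine (mul_eq_zero.1 (?_ : n₂ * _ = 0)).resolve_left h2
          have e : n₀ = n₁ ^ 2 / (4 * n₂) := by linarith
          have e1 : n₀ * p 0 + n₁ * p 1 + n₂ * p 2 = 0 := by simp only [n₀, n₁, n₂]; ring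
          have e2 : n₀ * p 3 + n₁ * p 4 + n₂ * p 5 = 0 := by simp only [n₀, n₁, n₂]; ring
          rw [e] at e1 e2
          simp only [tf]
          field_simp at e1 e2 ⊢
          linear_combination k.1 * e1 + k.2 * e2
      · simp [wd]
      · have e1 : n₀ * p 0 + n₁ * p 1 + n₂ * p 2 = 0 := by simp only [n₀, n₁, n₂]; ring
        have e2 : n₀ * p 3 + n₁ * p 4 + n₂ * p 5 = 0 := by simp only [n₀, n₁, n₂]; ring
        simp only [tf]
        field_simp
        linear_combination 4 * n₂ * y.1 * e1 + 4 * n₂ * y.2 * e2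
  · refine ⟨n₀, n₂ - n₁ ^ 2 / (4 * n₀), (1, n₁ / (2 * n₀)), (0, 1), h0, fun h => ?_, ?_, fun y => ?_⟩
    · have := hp' (1, n₁ / (2 * n₀)) fun k => ?_
      · simp at this
      · refine (mul_eq_zero.1 (?_ : n₀ * _ = 0)).resolve_left h0
        have e : n₂ = n₁ ^ 2 / (4 * n₀) := by linarith
        have e1 : n₀ * p 0 + n₁ * p 1 + n₂ * p 2 = 0 := by simp only [n₀, n₁, n₂]; ring
        have e2 : n₀ * p 3 + n₁ * p 4 + n₂ * p 5 = 0 := by simp only [n₀, n₁, n₂]; ring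
        rw [e] at e1 e2
        simp only [tf]
        field_simp at e1 e2 ⊢
        linear_combination k.1 * e1 + k.2 * e2
    · simp [wd]
    · have e1 : n₀ * p 0 + n₁ * p 1 + n₂ * p 2 = 0 := by simp only [n₀, n₁, n₂]; ring
      have e2 : n₀ * p 3 + n₁ * p 4 + n₂ * p 5 = 0 := by simp only [n₀, n₁, n₂]; ring
      simp only [tf]
      field_simp
      linear_combination 4 * n₀ * y.1 * e1 + 4 * n₀ * y.2 * e2

theorem exists_apolar_unit {p : Fin 6 → ℝ} (hp : ∀ x : ℂ × ℂ, (∀ k, tf (coeC p) x x k = 0) → x = 0) :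
    ∃ (κ : ℝ) (e₁ e₂ : ℝ × ℝ), κ ^ 2 = 1 ∧ wd e₁ e₂ ≠ 0 ∧
      ∀ y, κ * tf p e₁ e₁ y + tf p e₂ e₂ y = 0 := by
  obtain ⟨d₁, d₂, f₁, f₂, h1, h2, hf, h⟩ := exists_apolar hp
  have hd : d₁ / d₂ ≠ 0 := div_ne_zero h1 h2
  have key : ∀ κ : ℝ, κ ^ 2 = 1 → 0 < κ * (d₁ / d₂) → ∃ (κ : ℝ) (e₁ e₂ : ℝ × ℝ), κ ^ 2 = 1 ∧ wd e₁ e₂ ≠ 0 ∧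
      ∀ y, κ * tf p e₁ e₁ y + tf p e₂ e₂ y = 0 := by
    intro κ hκ hpos
    refine ⟨κ, √(κ * (d₁ / d₂)) • f₁, f₂, hκ, ?_, fun y => ?_⟩
    · have := wd_smul_smul (√(κ * (d₁ / d₂))) 1 f₁ f₂
      rw [one_smul] at this
      rw [this]
      have := Real.sqrt_pos.2 hpos
      simp [hf, this.ne']
    · have hs := Real.sq_sqrt hpos.le
      set c := √(κ * (d₁ / d₂))
      have e : tf p (c • f₁) (c • f₁) y = c ^ 2 * tf p f₁ f₁ y := by
        simp only [tf, Prod.smul_fst, Prod.smul_snd, smul_eq_mul]; ring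
      rw [e, hs]
      have := h y
      field_simp
      linear_combination this + d₁ * tf p f₁ f₁ y * hκ
  rcases lt_or_gt_of_ne hd with hh | hh
  · exact key (-1) (by norm_num) (by linarith)
  · exact key 1 (by norm_num) (by linarith)

theorem quint_ext {r : Fin 6 → ℝ} {v : Fin 6 → ℝ × ℝ} (hv : ∀ i j, i ≠ j → wd (v i) (v j) ≠ 0)
    (h : ∀ i, quint r (v i) = 0) : r = 0 := by
  have hd : (Matrix.projVandermonde (fun i => (v i).2) (fun i => (v i).1)).det ≠ 0 := by
    rw [Matrix.det_projVandermonde, Finset.prod_ne_zero_iff]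
    intro i _
    rw [Finset.prod_ne_zero_iff]
    intro j hj
    have := hv i j (Finset.mem_Ioi.1 hj).ne
    simp only [wd] at this
    intro h0
    exact this (by linear_combination h0)
  refine Matrix.eq_zero_of_mulVec_eq_zero hd (funext fun i => ?_)
  have := h i
  simp only [quint] at this
  simp [Matrix.mulVec, dotProduct, Fin.sum_univ_succ, Matrix.projVandermonde_apply, Fin.rev]
  linear_combination this

theorem exists_smul_quinticOf {r : Fin 6 → ℝ} {v : Fin 5 → ℝ × ℝ}
    (hv : ∀ i j, i ≠ j → wd (v i) (v j) ≠ 0) (h : ∀ i, quint r (v i) = 0) :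
    ∃ c : ℝ, r = c • quinticOf v := by
  have hv0 : ∀ i, v i ≠ 0 := fun i h0 => by
    obtain ⟨j, hj⟩ := exists_ne i
    exact hv i j hj.symm (by rw [h0]; simp [wd])
  obtain ⟨t, ht⟩ := Infinite.exists_notMem_finset (Finset.univ.image fun i => (v i).2 / (v i).1)
  have hz : ∀ i, wd (v i) (1, t) ≠ 0 := by
    intro i h0
    simp only [wd, mul_one] at h0
    by_cases h1 : (v i).1 = 0
    · exact hv0 i (Prod.ext h1 (by simpa [h1] using h0))
    · refine ht (Finset.mem_image.2 ⟨i, Finset.mem_univ _, ?_⟩)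
      field_simp; linear_combination -h0
  have hp : quint (quinticOf v) (1, t) ≠ 0 := by
    rw [quint_quinticOf, Finset.prod_ne_zero_iff]; exact fun i _ => hz i
  refine ⟨quint r (1, t) / quint (quinticOf v) (1, t), ?_⟩
  set c := quint r (1, t) / quint (quinticOf v) (1, t) with hc
  have lin : ∀ x, quint (r - c • quinticOf v) x = quint r x - c * quint (quinticOf v) x := by
    intro x; simp [quint]; ring
  rw [← sub_eq_zero]
  refine quint_ext (v := Fin.snoc v (1, t)) (fun i j hij => ?_) fun i => ?_
  · induction i using Fin.lastCases with
    | last =>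
      induction j using Fin.lastCases with
      | last => exact absurd rfl hij
      | cast j =>
        rw [wd_comm, Fin.snoc_last, Fin.snoc_castSucc]; exact neg_ne_zero.2 (hz j)
    | cast i =>
      induction j using Fin.lastCases with
      | last => rw [Fin.snoc_last, Fin.snoc_castSucc]; exact hz i
      | cast j =>
        rw [Fin.snoc_castSucc, Fin.snoc_castSucc]; exact hv i j (by rintro rfl; exact hij rfl)
  · induction i using Fin.lastCases with
    | last => rw [lin]; simp only [Fin.snoc_last]; rw [hc]; field_simp; ring
    | cast i =>
      rw [lin, Fin.snoc_castSucc, h, quint_quinticOf, Finset.prod_eq_zero (Finset.mem_univ i) (wd_self _)]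
      ring

theorem exists_qk {κ : ℝ} (hκ : κ ^ 2 = 1) (q : Fin 6 → ℝ) : ∃ r, q = qk κ r := by
  refine ⟨![q 2, -4 * q 1 + q 5, 4 * q 0 - 2 * κ * q 2 - 4 * q 4, 4 * κ * q 1 + 4 * q 3 - 2 * κ * q 5,
    q 2 + 4 * κ * q 4, q 5], ?_⟩
  ext i
  fin_cases i <;> simp [qk]
  all_goals first
    | ring1
    | linear_combination -q 4 * hκ

/-- A rank-one graph on the cubic surface. -/
theorem exists_wf_of_graph {κ : ℝ} (hκ : κ ^ 2 = 1) {q : Fin 6 → ℝ} {t : Fin 4 → ℝ} {s : ℝ × ℝ} (hs : s ≠ 0)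
    (hts : mv t s = 0) (h : ∀ x, tf (pk κ) x x (mv t x) + tf q (mv t x) (mv t x) x = 0) :
    ∃ (v : ℝ × ℝ) (c : ℝ), v ≠ 0 ∧ sg κ v = s ∧ (∀ x, mv t x = (wd (sg κ v) x * c) • wf κ v) ∧
      (c ≠ 0 → ∀ x, tf q (wf κ v) (wf κ v) x = 2 / c * wd v x) := by
  simp only [mv, Prod.mk_eq_zero] at hts
  have hn : (-s.2, s.1) ≠ (0 : ℝ × ℝ) := fun h0 => hs (by
    simp only [Prod.mk_eq_zero, neg_eq_zero] at h0; exact Prod.ext h0.2 h0.1)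
  obtain ⟨a, ha⟩ := exists_smul_of_wd hn (x := (t 0, t 1)) (by simp only [wd]; linear_combination -hts.1)
  obtain ⟨b, hb⟩ := exists_smul_of_wd hn (x := (t 2, t 3)) (by simp only [wd]; linear_combination -hts.2)
  simp only [Prod.smul_mk, smul_eq_mul, Prod.mk.injEq] at ha hb
  have hmv : ∀ x, mv t x = wd s x • (a, b) := by
    intro x
    simp only [mv, wd, ha, hb, Prod.smul_mk, smul_eq_mul]
    refine Prod.ext ?_ ?_ <;> simp only <;> ring
  have hF' : ∀ x, wd s x ≠ 0 → tf (pk κ) x x (a, b) + wd s x * tf q (a, b) (a, b) x = 0 := by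
    intro x hx
    have := h x
    rw [hmv] at this
    refine (mul_eq_zero.1 (?_ : wd s x * _ = 0)).resolve_left hx
    rw [← this]; simp only [tf, Prod.smul_fst, Prod.smul_snd, smul_eq_mul]; ring
  set n : ℝ × ℝ := (-s.2, s.1) with hnd
  have hsn : wd s n ≠ 0 := by
    have := normSq_pos hs
    simp only [wd, hnd]; nlinarith
  have hF : tf (pk κ) s s (a, b) = 0 := by
    have e1 := hF' n hsn
    have e2 := hF' (s + n) (by simpa [wd, mul_add, mul_comm s.2 s.1] using hsn)
    have e3 := hF' (s - n) (by
      have : wd s (s - n) = -wd s n := by simp only [wd, Prod.fst_sub, Prod.snd_sub]; ring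
      rw [this]; exact neg_ne_zero.2 hsn)
    simp only [tf, wd, Prod.fst_add, Prod.snd_add, Prod.fst_sub, Prod.snd_sub] at e1 e2 e3 ⊢
    linear_combination (e2 + e3) / 2 - e1
  rw [tf_pk_self, wd_comm, neg_eq_zero] at hF
  obtain ⟨d, hd⟩ := exists_smul_of_wd (fun h0 => hs (wf_eq_zero hκ h0)) hF
  have hsg : sg κ (s.2, -(κ * s.1)) = s := by
    refine Prod.ext ?_ ?_ <;> simp only [sg]
    linear_combination s.1 * hκ
  set v : ℝ × ℝ := (s.2, -(κ * s.1)) with hvd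
  have hwf : wf κ s = -κ • wf κ v := by
    refine Prod.ext ?_ ?_ <;> simp only [wf, hvd, Prod.smul_fst, Prod.smul_snd, smul_eq_mul]
    · linear_combination 2 * s.1 * s.2 * hκ
    · linear_combination (-(κ ^ 2 * s.1 ^ 2 ) - s.1 ^ 2) * hκ
  have hc : (a, b) = (-(d * κ)) • wf κ v := by
    rw [hd, hwf, smul_smul]; congr 1; ring
  have hv : v ≠ 0 := by
    intro h0
    rw [h0] at hsg
    exact hs (by rw [← hsg]; simp [sg])
  refine ⟨v, -(d * κ), hv, hsg, fun x => by rw [hmv, hc, hsg, smul_smul], fun hc0 => ?_⟩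
  set c := -(d * κ) with hcd
  rw [hc] at hF'
  have hG' : ∀ x, wd s x ≠ 0 → 2 * wd v x - c * tf q (wf κ v) (wf κ v) x = 0 := by
    intro x hx
    have hb : bf κ v x = -wd s x := by rw [← wd_sg, hsg, wd_comm]
    have e := hF' x hx
    have e' : tf (pk κ) x x (c • wf κ v) + wd s x * tf q (c • wf κ v) (c • wf κ v) x =
        c * tf (pk κ) x x (wf κ v) + c ^ 2 * wd s x * tf q (wf κ v) (wf κ v) x := by
      simp only [tf, Prod.smul_fst, Prod.smul_snd, smul_eq_mul]; ring
    rw [e', tf_pk_wf, hb] at e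
    refine (mul_eq_zero.1 (?_ : (c * wd s x) * _ = 0)).resolve_left (mul_ne_zero hc0 hx)
    linear_combination -e
  intro x
  have hG : 2 * wd v x - c * tf q (wf κ v) (wf κ v) x = 0 := by
    by_cases hx : wd s x = 0
    · have e1 := hG' (x + n) (by
        have : wd s (x + n) = wd s x + wd s n := by simp only [wd, Prod.fst_add, Prod.snd_add]; ring
        rw [this, hx, zero_add]; exact hsn)
      have e2 := hG' n hsn
      simp only [tf, wd, Prod.fst_add, Prod.snd_add] at e1 e2 ⊢
      linear_combination e1 - e2
    · exact hG' x hx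
  field_simp
  linear_combination -hG

theorem exists_apolar_bases {T : V4 → V4 → V4 → ℝ} (h : SymTri T) (hns : NonSing T) {u α : V4 × V4}
    (huα : Skew (ln u) (ln α)) (hu : ∀ x ∈ ln u, T x x x = 0) (hα : ∀ x ∈ ln α, T x x x = 0) :
    ∃ (κ : ℝ) (u' α' : V4 × V4), κ ^ 2 = 1 ∧ ln u' = ln u ∧ ln α' = ln α ∧ coeffs T u' α' = pk κ := by
  have hNS := nsPair_coeffs h hns huα hu hα
  have hp : ∀ x : ℂ × ℂ, (∀ k, tf (coeC (coeffs T u α)) x x k = 0) → x = 0 := fun x hx =>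
    (hNS x 0 (fun k => by simp [tf]) fun k => by rw [hx]; simp [tf]).1
  obtain ⟨κ, e₁, e₂, hκ, he, hap⟩ := exists_apolar_unit hp
  set p := coeffs T u α with hpd
  have hD : tf p e₁ e₁ (1, 0) * tf p e₁ e₂ (0, 1) - tf p e₁ e₁ (0, 1) * tf p e₁ e₂ (1, 0) ≠ 0 := by
    intro hD
    obtain ⟨y, hy, h1, h2⟩ : ∃ y : ℝ × ℝ, y ≠ 0 ∧ tf p e₁ e₁ y = 0 ∧ tf p e₁ e₂ y = 0 := by
      have lin : ∀ x x' (y : ℝ × ℝ), tf p x x' y = y.1 * tf p x x' (1, 0) + y.2 * tf p x x' (0, 1) := by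
        intro x x' y; simp only [tf]; ring
      by_cases h1 : tf p e₁ e₁ (1, 0) = 0 ∧ tf p e₁ e₁ (0, 1) = 0
      · by_cases h2 : tf p e₁ e₂ (1, 0) = 0 ∧ tf p e₁ e₂ (0, 1) = 0
        · exact ⟨(1, 0), by simp, h1.1, h2.1⟩
        · refine ⟨(tf p e₁ e₂ (0, 1), -tf p e₁ e₂ (1, 0)), fun h0 => h2 ?_, ?_, ?_⟩
          · simp only [Prod.mk_eq_zero, neg_eq_zero] at h0; exact ⟨h0.2, h0.1⟩
          · rw [lin, h1.1, h1.2]; ring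
          · rw [lin]; ring
      · refine ⟨(tf p e₁ e₁ (0, 1), -tf p e₁ e₁ (1, 0)), fun h0 => h1 ?_, ?_, ?_⟩
        · simp only [Prod.mk_eq_zero, neg_eq_zero] at h0; exact ⟨h0.2, h0.1⟩
        · rw [lin]; ring
        · rw [lin]; linear_combination -hD
    have h3 : tf p e₂ e₂ y = 0 := by have := hap y; rw [h1] at this; linarith
    have hall : ∀ x, tf p x x y = 0 := by
      intro x
      have : wd e₁ e₂ ^ 2 * tf p x x y = wd x e₂ ^ 2 * tf p e₁ e₁ y + 2 * (wd x e₂ * wd e₁ x) * tf p e₁ e₂ y +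
          wd e₁ x ^ 2 * tf p e₂ e₂ y := by simp only [tf, wd]; ring
      rw [h1, h2, h3] at this
      refine (mul_eq_zero.1 (?_ : wd e₁ e₂ ^ 2 * _ = 0)).resolve_left (pow_ne_zero 2 he)
      rw [this]; ring
    have a1 := hall (1, 0)
    have a2 := hall (0, 1)
    have a3 := hall (1, 1)
    simp only [tf] at a1 a2 a3
    have b0 : p 0 * y.1 + p 3 * y.2 = 0 := by linear_combination a1
    have b2 : p 2 * y.1 + p 5 * y.2 = 0 := by linear_combination a2
    have b1 : p 1 * y.1 + p 4 * y.2 = 0 := by linear_combination (a3 - a1 - a2) / 2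
    have c0 : (p 0 : ℂ) * y.1 + p 3 * y.2 = 0 := by exact_mod_cast b0
    have c1 : (p 1 : ℂ) * y.1 + p 4 * y.2 = 0 := by exact_mod_cast b1
    have c2 : (p 2 : ℂ) * y.1 + p 5 * y.2 = 0 := by exact_mod_cast b2
    by_cases hy1 : y.1 = 0
    · have hy2 : (y.2 : ℂ) ≠ 0 := by
        intro h0; exact hy (Prod.ext hy1 (by exact_mod_cast h0))
      obtain ⟨x, hx, e⟩ := exists_binary_root (p 0) (p 1) (p 2)
      refine hx (hp x fun k => (mul_eq_zero.1 (?_ : (y.2 : ℂ) * _ = 0)).resolve_left hy2)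
      simp only [tf, coeC]
      linear_combination (y.2 * k.1 - y.1 * k.2 : ℂ) * e + k.2 * (x.1 * x.1 * c0 + 2 * x.1 * x.2 * c1 + x.2 * x.2 * c2)
    · have hy2 : (y.1 : ℂ) ≠ 0 := by exact_mod_cast hy1
      obtain ⟨x, hx, e⟩ := exists_binary_root (p 3) (p 4) (p 5)
      refine hx (hp x fun k => (mul_eq_zero.1 (?_ : (y.1 : ℂ) * _ = 0)).resolve_left hy2)
      simp only [tf, coeC]
      linear_combination (y.1 * k.2 - y.2 * k.1 : ℂ) * e + k.1 * (x.1 * x.1 * c0 + 2 * x.1 * x.2 * c1 + x.2 * x.2 * c2)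
  set A := tf p e₁ e₁ (1, 0)
  set B := tf p e₁ e₁ (0, 1)
  set C := tf p e₁ e₂ (1, 0)
  set D := tf p e₁ e₂ (0, 1)
  set f₁ : ℝ × ℝ := (D / (A * D - B * C), -C / (A * D - B * C)) with hf1
  set f₂ : ℝ × ℝ := (-B / (A * D - B * C), A / (A * D - B * C)) with hf2
  have tlin : ∀ x x' (y : ℝ × ℝ), tf p x x' y = y.1 * tf p x x' (1, 0) + y.2 * tf p x x' (0, 1) := by
    intro x x' y; simp only [tf]; ring
  have g11 : tf p e₁ e₁ f₁ = 1 := by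
    rw [tlin]; change D / (A * D - B * C) * A + -C / (A * D - B * C) * B = 1
    rw [← div_self hD]; ring
  have g12 : tf p e₁ e₁ f₂ = 0 := by
    rw [tlin]; change -B / (A * D - B * C) * A + A / (A * D - B * C) * B = 0; field_simp; ring
  have g21 : tf p e₁ e₂ f₁ = 0 := by
    rw [tlin]; change D / (A * D - B * C) * C + -C / (A * D - B * C) * D = 0; field_simp; ring
  have g22 : tf p e₁ e₂ f₂ = 1 := by
    rw [tlin]; change -B / (A * D - B * C) * C + A / (A * D - B * C) * D = 1
    rw [← div_self hD]; ring
  have hf : wd f₁ f₂ ≠ 0 := by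
    have : wd f₁ f₂ = 1 / (A * D - B * C) := by simp only [wd, hf1, hf2]; field_simp
    rw [this]; exact one_div_ne_zero hD
  refine ⟨κ, (comb u e₁, comb u e₂), (comb α f₁, comb α f₂), hκ,
    ln_eq_of_comb (a := e₁.1) (b := e₁.2) (c := e₂.1) (d := e₂.2) (by simpa [wd] using he) rfl rfl,
    ln_eq_of_comb (a := f₁.1) (b := f₁.2) (c := f₂.1) (d := f₂.2) (by simpa [wd] using hf) rfl rfl, ?_⟩
  have k1 := hap f₁
  have k2 := hap f₂
  rw [g11] at k1
  rw [g12] at k2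
  have Tc : ∀ x x' y, T (comb u x) (comb u x') (comb α y) = tf p x x' y :=
    fun x x' y => (h.tf_coeffs u α x x' y).symm
  ext i
  fin_cases i <;> simp only [coeffs, pk, Tc] <;> simp [g11, g12, g21, g22]
  all_goals linarith

/-- The matrix with given columns. -/
def colMat (u α : V4 × V4) : Mat4 := (Matrix.of ![u.1, u.2, α.1, α.2]).transpose

theorem colMat_mulVec (u α : V4 × V4) (X : V4) : (colMat u α).mulVec X = comb u (hd X) + comb α (tl X) := by
  ext i
  simp [colMat, Matrix.mulVec, dotProduct, Fin.sum_univ_succ, comb, hd, tl, Matrix.transpose]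
  fin_cases i <;> simp <;> ring

theorem det_colMat {u α : V4 × V4} (h : Skew (ln u) (ln α)) : (colMat u α).det ≠ 0 := by
  rw [colMat, Matrix.det_transpose]; exact (skew_ln_iff_det _ _).1 h

theorem comb_add (u : V4 × V4) (x y : ℝ × ℝ) : comb u (x + y) = comb u x + comb u y := by
  simp only [comb, Prod.fst_add, Prod.snd_add]; module

/-- Every line of a normal form is a rank-one graph. -/
theorem eq_act_nf {κ : ℝ} (hκ : κ ^ 2 = 1) {v : Fin 5 → ℝ × ℝ} (hv : Valid κ v) {u α : V4 × V4}
    (huα : Skew (ln u) (ln α)) {L : Fin 6 → PLine} (hL : ∀ i, IsLine (L i)) (h5 : L (Fin.last 5) = ln α)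
    (h : ∀ (i : Fin 5) x, comb u x + comb α ((wd (sg κ (v i)) x * (2 / mu κ v i)) • wf κ (v i)) ∈ L i.castSucc) :
    L = act (colMat u α) (lines (nf κ v)) := by
  have sk := (skew_ln_iff_comb _ _).1 huα
  have hS := isSchlafliSix_nf hκ hv
  have hcombM : ∀ i x, comb ((colMat u α).mulVec (nf κ v i).1, (colMat u α).mulVec (nf κ v i).2) x =
      (colMat u α).mulVec (comb (nf κ v i) x) := by
    intro i x; simp only [comb, Matrix.mulVec_add, Matrix.mulVec_smul]
  rw [act_lines]
  ext1 i
  refine (hL i).eq_ln ?_ ?_ fun x hx => ?_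
  · change (colMat u α).mulVec (nf κ v i).1 ∈ L i
    rw [colMat_mulVec]
    induction i using Fin.lastCases with
    | last => rw [nf_last, h5]; simpa [comb] using comb_mem_ln α (1, 0)
    | cast i =>
      have := h i (sg κ (v i))
      rw [wd_self, zero_mul, zero_smul] at this
      rw [nf_castSucc, linePair, hd_vec, tl_vec]; exact this
  · change (colMat u α).mulVec (nf κ v i).2 ∈ L i
    rw [colMat_mulVec]
    induction i using Fin.lastCases with
    | last => rw [nf_last, h5]; simpa [comb] using comb_mem_ln α (0, 1)
    | cast i =>
      rw [nf_castSucc, linePair, hd_vec, tl_vec]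
      convert h i (-(mu κ v i) • ((v i).1, κ * (v i).2)) using 4
      have := hv.mu_ne_zero i
      simp only [wd, sg, Prod.smul_fst, Prod.smul_snd, smul_eq_mul]
      field_simp
      linear_combination -(v i).2 ^ 2 * hκ
  · beta_reduce at hx
    rw [hcombM, colMat_mulVec] at hx
    obtain ⟨h1, h2⟩ := sk _ _ hx
    refine comb_eq_zero (hS.isLine i) ?_
    rw [← vec_hd_tl (comb _ _), h1, h2]
    ext j; fin_cases j <;> rfl

theorem valid_of_graphs {κ : ℝ} {v : Fin 5 → ℝ × ℝ} {c : Fin 5 → ℝ} {u α : V4 × V4}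
    (huα : Skew (ln u) (ln α)) (hv : ∀ i, v i ≠ 0) (hκ : κ ^ 2 = 1) (hc : ∀ i, c i ≠ 0)
    {L : Fin 5 → PLine} (hL : ∀ i j, i ≠ j → Skew (L i) (L j))
    (h : ∀ i x, comb u x + comb α ((wd (sg κ (v i)) x * c i) • wf κ (v i)) ∈ L i) : Valid κ v := by
  have sk := (skew_ln_iff_comb _ _).1 huα
  have hs : ∀ i, sg κ (v i) ≠ 0 := fun i h0 => hv i (by
    have hκ0 : κ ≠ 0 := by rintro rfl; simp at hκ
    simp only [sg, Prod.mk_eq_zero, neg_eq_zero, mul_eq_zero, hκ0, false_or] at h0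
    exact Prod.ext h0.2 h0.1)
  intro i j hij
  have hwd : wd (v i) (v j) ≠ 0 := by
    intro h0
    obtain ⟨a, ha⟩ := exists_smul_of_wd (hv i) h0
    have e1 := h i (sg κ (v i))
    have e2 := h j (sg κ (v i))
    have : wd (sg κ (v j)) (sg κ (v i)) = 0 := by
      rw [ha]; simp only [sg, wd, Prod.smul_fst, Prod.smul_snd, smul_eq_mul]; ring
    rw [this, zero_mul, zero_smul] at e2
    rw [wd_self, zero_mul, zero_smul] at e1
    exact hs i (sk _ _ ((hL i j hij).eq_zero e1 e2)).1
  refine ⟨hwd, fun h0 => ?_⟩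
  have hww : wd (wf κ (v i)) (wf κ (v j)) = 0 := by rw [wd_wf, h0]; ring
  obtain ⟨a, ha⟩ := exists_smul_of_wd (fun h0 => hv i (wf_eq_zero hκ h0)) hww
  set x := c i • sg κ (v i) - (c j * a) • sg κ (v j) with hx
  have e1 := h i x
  have e2 := h j x
  have e3 : (wd (sg κ (v i)) x * c i) • wf κ (v i) = (wd (sg κ (v j)) x * c j) • wf κ (v j) := by
    rw [ha, smul_smul]; congr 1
    simp only [hx, wd, Prod.fst_sub, Prod.snd_sub, Prod.smul_fst, Prod.smul_snd, smul_eq_mul]; ring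
  rw [← e3] at e2
  have hx0 := (sk _ _ ((hL i j hij).eq_zero e1 e2)).1
  have : wd x (sg κ (v j)) = c i * κ * wd (v i) (v j) := by
    simp only [hx, wd, sg, Prod.fst_sub, Prod.snd_sub, Prod.smul_fst, Prod.smul_snd, smul_eq_mul]; ring
  rw [hx0] at this
  have hκ0 : κ ≠ 0 := by rintro rfl; simp at hκ
  exact mul_ne_zero (mul_ne_zero (hc i) hκ0) hwd (by rw [← this]; simp [wd])

theorem IsSchlafliSix.exists_nf {L : Fin 6 → PLine} (hL : IsSchlafliSix L) :
    ∃ (π : Equiv.Perm (Fin 6)) (M : Mat4) (κ : ℝ) (v : Fin 5 → ℝ × ℝ), M.det ≠ 0 ∧ κ ^ 2 = 1 ∧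
      Valid κ v ∧ L ∘ π = _root_.act M (lines (nf κ v)) := by
  obtain ⟨T, hT, hns, hvan, i₀, u₀, hsk, hmeet, hu₀⟩ := hL.exists_transversal
  obtain ⟨α₀, hα₀⟩ := (hL.isLine i₀).exists_ln
  rw [hα₀] at hsk
  have hvα : ∀ x ∈ ln α₀, T x x x = 0 := hα₀ ▸ hvan i₀
  obtain ⟨κ, u, α, hκ, hu, hα, hp⟩ := exists_apolar_bases hT hns hsk hu₀ hvα
  rw [← hu] at hsk hmeet hu₀
  rw [← hα] at hsk hvα hα₀
  have sk := (skew_ln_iff_comb _ _).1 hsk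
  have hpair := hL.1
  obtain ⟨r, hr⟩ := exists_qk hκ (coeffs T α u)
  have data : ∀ k : Fin 5, ∃ (v : ℝ × ℝ) (c : ℝ), v ≠ 0 ∧ c ≠ 0 ∧
      (∀ x, comb u x + comb α ((wd (sg κ v) x * c) • wf κ v) ∈ L (i₀.succAbove k)) ∧
      ∀ x, tf (qk κ r) (wf κ v) (wf κ v) x = 2 / c * wd v x := by
    intro k
    obtain ⟨t, ht⟩ := exists_graph (L := L (i₀.succAbove k)) (α := u) (β := α)
      (hα₀ ▸ hpair _ _ (Fin.succAbove_ne i₀ k)) hsk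
    obtain ⟨X, hX, hXu, hX0⟩ := hmeet _ (Fin.succAbove_ne i₀ k)
    rw [ht] at hX
    obtain ⟨s, rfl⟩ := mem_ln_iff_comb.1 hX
    obtain ⟨s', hs'⟩ := mem_ln_iff_comb.1 hXu
    rw [comb_graphPair] at hs'
    have hdiff := sk (s - s') (mv t s) (by
      have : comb u s' + comb u (s - s') = comb u s := by rw [← comb_add]; congr 1; abel
      rw [← this] at hs'
      rw [add_assoc] at hs'
      exact (left_eq_add.1 hs'))
    have hs0 : s ≠ 0 := by
      rintro rfl; exact hX0 (by simp [comb])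
    have hgr : ∀ x, comb u x + comb α (mv t x) ∈ L (i₀.succAbove k) := fun x => by
      rw [ht, ← comb_graphPair]; exact comb_mem_ln _ _
    obtain ⟨v, c, hv0, hsg, hmv, hq⟩ := exists_wf_of_graph hκ (q := qk κ r) hs0 hdiff.2 fun x => by
      have := hvan _ _ (hgr x)
      rw [hT.add_self hu₀ hvα (comb_mem_ln _ _) (comb_mem_ln _ _), ← hT.tf_coeffs u α, ← hT.tf_coeffs α u,
        hp, hr] at this
      linarith
    have hc : c ≠ 0 := by
      rintro rfl
      have hin : ∀ x, comb u x ∈ L (i₀.succAbove k) := fun x => by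
        have := hgr x
        rw [hmv] at this
        simpa [comb] using this
      obtain ⟨k', hk'⟩ := exists_ne k
      obtain ⟨Y, hY, hYu, hY0⟩ := hmeet _ (Fin.succAbove_ne i₀ k')
      obtain ⟨y, rfl⟩ := mem_ln_iff_comb.1 hYu
      exact hY0 ((hpair _ _ fun e => hk' (Fin.succAbove_right_injective e)).eq_zero hY (hin y))
    refine ⟨v, c, hv0, hc, fun x => ?_, hq hc⟩
    rw [← hmv]; exact hgr x
  choose v c hv0 hc hmem hq using data
  have hV : Valid κ v := valid_of_graphs hsk hv0 hκ hc (L := fun k => L (i₀.succAbove k))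
    (fun i j hij => hpair _ _ fun e => hij (Fin.succAbove_right_injective e)) hmem
  obtain ⟨c₀, hc₀⟩ := exists_smul_quinticOf (fun i j hij => (hV i j hij).1) (r := r) fun i => by
    rw [← tf_qk_wf hκ, hq, wd_self, mul_zero]
  have hτ : ∀ i, 2 / c i = c₀ * mu κ v i := by
    intro i
    obtain ⟨x, hx⟩ : ∃ x, wd (v i) x ≠ 0 := by
      by_contra! hh; exact hv0 i (eq_zero_of_wd hh)
    have e := hq i x
    have e' : tf (qk κ (c₀ • quinticOf v)) (wf κ (v i)) (wf κ (v i)) x =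
        c₀ * tf (qk κ (quinticOf v)) (wf κ (v i)) (wf κ (v i)) x := by
      simp [tf, qk]; ring
    rw [hc₀, e', show quinticOf v = _ from mulForm_quartOf v i, tf_qk_mulForm hκ, ← mu_eq] at e
    exact mul_right_cancel₀ hx (by linear_combination -e)
  have hc₀0 : c₀ ≠ 0 := by
    rintro rfl
    have := hτ 0
    rw [zero_mul] at this
    exact div_ne_zero two_ne_zero (hc 0) this
  have hα' : ln (c₀⁻¹ • α.1, c₀⁻¹ • α.2) = ln α :=
    ln_eq_of_comb (a := c₀⁻¹) (b := 0) (c := 0) (d := c₀⁻¹)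
      (by simpa using hc₀0) (by simp) (by simp)
  refine ⟨(finSuccEquiv' (Fin.last 5)).trans (finSuccEquiv' i₀).symm, colMat u (c₀⁻¹ • α.1, c₀⁻¹ • α.2), κ, v,
    det_colMat (by rw [hα']; exact hsk), hκ, hV, ?_⟩
  refine eq_act_nf hκ hV (by rw [hα']; exact hsk) (fun i => hL.isLine _) ?_ fun i x => ?_
  · simp [hα', hα₀]
  · have e : ((finSuccEquiv' (Fin.last 5)).trans (finSuccEquiv' i₀).symm) i.castSucc = i₀.succAbove i := by
      rw [← Fin.succAbove_last]; simp
    rw [Function.comp, e]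
    convert hmem i x using 2
    have h1 := hτ i
    have h2 := hV.mu_ne_zero i
    have h3 := hc i
    have h4 : c i = 2 / (c₀ * mu κ v i) := by rw [← h1]; field_simp
    rw [h4]
    simp only [comb, Prod.smul_fst, Prod.smul_snd, smul_smul, smul_eq_mul]
    congr 2 <;> field_simp

theorem mu_perm {K : Type*} [Field K] (κ : K) (v : Fin 5 → K × K) (ρ : Equiv.Perm (Fin 5)) (i : Fin 5) :
    mu κ (v ∘ ρ) i = mu κ v (ρ i) := by
  rw [mu, mu, ← Equiv.prod_comp ρ fun j => if j = ρ i then 1 else bf κ (v (ρ i)) (v j)]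
  simp

theorem nf_perm (κ : ℝ) (v : Fin 5 → ℝ × ℝ) (ρ : Equiv.Perm (Fin 5)) :
    nf κ (v ∘ ρ) = nf κ v ∘ (finSuccEquivLast.trans ((Equiv.optionCongr ρ).trans finSuccEquivLast.symm)) := by
  ext1 i
  induction i using Fin.lastCases with
  | last => simp only [Function.comp_apply, Equiv.trans_apply, finSuccEquivLast_last,
      Equiv.optionCongr_apply, Option.map_none, finSuccEquivLast_symm_none, nf_last]
  | cast i => simp [nf_castSucc, mu_perm]

theorem deform_perm {κ : ℝ} (hκ : κ ^ 2 = 1) {v : Fin 5 → ℝ × ℝ} (hv : Valid κ v) (ρ : Equiv.Perm (Fin 5)) :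
    SchlafliDeformation (lines (nf κ v)) (lines (nf κ (v ∘ ρ))) := by
  rw [nf_perm]
  exact SchlafliDeformation.comp_right (isSchlafliSix_nf hκ hv) _

theorem bf_smul_smul {K : Type*} [Field K] (κ a b : K) (x y : K × K) :
    bf κ (a • x) (b • y) = a * b * bf κ x y := by
  simp only [bf, Prod.smul_fst, Prod.smul_snd, smul_eq_mul]; ring

theorem Valid.smul {K : Type*} [Field K] {κ : K} {v : Fin 5 → K × K} (h : Valid κ v) {c : Fin 5 → K}
    (hc : ∀ i, c i ≠ 0) : Valid κ (fun i => c i • v i) := fun i j hij => by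
  rw [wd_smul_smul, bf_smul_smul]
  exact ⟨mul_ne_zero (mul_ne_zero (hc i) (hc j)) (h i j hij).1,
    mul_ne_zero (mul_ne_zero (hc i) (hc j)) (h i j hij).2⟩

theorem mu_smul {K : Type*} [Field K] (κ : K) (v : Fin 5 → K × K) (c : Fin 5 → K) (i : Fin 5) :
    mu κ (fun i => c i • v i) i = c i ^ 3 * (∏ j, c j) * mu κ v i := by
  fin_cases i <;> simp [mu, Fin.prod_univ_five, bf_smul_smul] <;> ring

theorem act_diagonal (d : Fin 4 → ℝ) (u : Fin 6 → V4 × V4) : act (Matrix.diagonal d) (lines u) =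
    lines (fun i => (fun k => d k * (u i).1 k, fun k => d k * (u i).2 k)) := by
  rw [act_lines]; congr 1; ext1 i
  refine Prod.ext ?_ ?_ <;> ext k <;> simp [Matrix.mulVec_diagonal]

theorem lines_nf_smul (κ : ℝ) (v : Fin 5 → ℝ × ℝ) {c : Fin 5 → ℝ} (hc : ∀ i, c i ≠ 0) :
    lines (nf κ (fun i => c i • v i)) =
      act (Matrix.diagonal ![∏ j, c j, ∏ j, c j, 1, 1]) (lines (nf κ v)) := by
  rw [act_diagonal]
  ext1 i
  have hP : (∏ j, c j) ≠ 0 := Finset.prod_ne_zero_iff.2 fun i _ => hc i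
  induction i using Fin.lastCases with
  | last =>
    simp only [lines, nf_last]
    refine ln_eq_of_comb (a := 1) (b := 0) (c := 0) (d := 1) (by norm_num) ?_ ?_ <;>
    ext k <;> fin_cases k <;> simp [vec]
  | cast i =>
    simp only [lines, nf_castSucc, linePair, mu_smul]
    refine ln_eq_of_comb (a := c i / ∏ j, c j) (b := 0) (c := 0) (d := c i ^ 4) ?_ ?_ ?_
    · simp [hP, hc i]
    all_goals ext k; fin_cases k <;> simp [vec, sg, wf] <;> field_simp

theorem deform_smul {κ : ℝ} (hκ : κ ^ 2 = 1) {v : Fin 5 → ℝ × ℝ} (hv : Valid κ v) {c : Fin 5 → ℝ}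
    (hc : ∀ i, c i ≠ 0) : SchlafliDeformation (lines (nf κ v)) (lines (nf κ (fun i => c i • v i))) := by
  rw [lines_nf_smul κ v hc]
  refine SchlafliDeformation.act_of_det_pos (isSchlafliSix_nf hκ hv) ?_
  have hP : (∏ j, c j) ≠ 0 := Finset.prod_ne_zero_iff.2 fun i _ => hc i
  simp only [Matrix.det_diagonal, Fin.prod_univ_four]
  simpa using hP

theorem continuous_nf (κ : ℝ) : Continuous (nf κ) := by
  refine continuous_pi fun i => ?_
  induction i using Fin.lastCases with
  | last => simp only [nf_last]; exact continuous_const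
  | cast i =>
    simp only [nf_castSucc]
    have hmu : Continuous fun v => mu κ v i := by
      unfold mu bf
      refine continuous_finsetProd _ fun j _ => ?_
      split_ifs
      · exact continuous_const
      · fun_prop
    refine Continuous.prodMk ?_ ?_ <;> refine continuous_pi fun k => ?_ <;> fin_cases k <;>
      simp [vec, sg, wf] <;> fun_prop

theorem deform_path {κ : ℝ} (hκ : κ ^ 2 = 1) {f : ℝ → Fin 5 → ℝ × ℝ} (hf : Continuous f)
    (hv : ∀ t ∈ Set.Icc (0:ℝ) 1, Valid κ (f t)) :
    SchlafliDeformation (lines (nf κ (f 0))) (lines (nf κ (f 1))) :=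
  SchlafliDeformation.of_joinedIn (joinedIn_of_path (fun t => nf κ (f t)) ((continuous_nf κ).comp hf)
    fun t ht => isSchlafliSix_nf hκ (hv t ht))

theorem Valid.conj {κ : ℝ} {v : Fin 5 → ℝ × ℝ} (hv : Valid κ v) :
    Valid κ (fun i => ((v i).1, -(v i).2)) := fun i j hij => by
  obtain ⟨h1, h2⟩ := hv i j hij
  simp only [wd, bf] at *
  exact ⟨fun h => h1 (by linear_combination -h), fun h => h2 (by linear_combination h)⟩

theorem deform_conj {κ : ℝ} (hκ : κ ^ 2 = 1) {v : Fin 5 → ℝ × ℝ} (hv : Valid κ v) :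
    SchlafliDeformation (lines (nf κ v)) (lines (nf κ (fun i => ((v i).1, -(v i).2)))) := by
  have : lines (nf κ (fun i => ((v i).1, -(v i).2))) =
      act (Matrix.diagonal ![-1, 1, 1, -1]) (lines (nf κ v)) := by
    rw [act_diagonal]
    ext1 i
    induction i using Fin.lastCases with
    | last =>
      simp only [lines, nf_last]
      refine ln_eq_of_comb (a := 1) (b := 0) (c := 0) (d := -1) (by norm_num) ?_ ?_ <;>
      ext k <;> fin_cases k <;> simp [vec]
    | cast i =>
      have hmu : mu κ (fun i => ((v i).1, -(v i).2)) i = mu κ v i := by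
        simp [mu, bf]
      simp only [lines, nf_castSucc, linePair, hmu]
      refine ln_eq_of_comb (a := 1) (b := 0) (c := 0) (d := -1) (by norm_num) ?_ ?_ <;>
      ext k <;> fin_cases k <;> simp [vec, sg, wf]
  rw [this]
  exact SchlafliDeformation.act_of_det_pos (isSchlafliSix_nf hκ hv) (by
    simp [Matrix.det_diagonal, Fin.prod_univ_four])

/-- Exchanging the coordinates gives the mirror image in the hyperbolic case. -/
theorem deform_swap {v : Fin 5 → ℝ × ℝ} (hv : Valid (-1) v) :
    SchlafliDeformation (act Refl (lines (nf (-1) v))) (lines (nf (-1) (fun i => ((v i).2, (v i).1)))) := by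
  set A : Mat4 := !![0, 1, 0, 0; 1, 0, 0, 0; 0, 0, -1, 0; 0, 0, 0, -1] with hA
  have : lines (nf (-1) (fun i => ((v i).2, (v i).1))) = act A (lines (nf (-1) v)) := by
    rw [act_lines]
    ext1 i
    induction i using Fin.lastCases with
    | last =>
      simp only [lines, nf_last]
      refine ln_eq_of_comb (a := -1) (b := 0) (c := 0) (d := -1) (by norm_num) ?_ ?_ <;>
      ext k <;> fin_cases k <;> simp [vec, hA]
    | cast i =>
      have hmu : mu (-1) (fun i => ((v i).2, (v i).1)) i = mu (-1) v i := by
        fin_cases i <;> simp [mu, bf, Fin.prod_univ_five] <;> ring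
      simp only [lines, nf_castSucc, linePair, hmu]
      refine ln_eq_of_comb (a := 1) (b := 0) (c := 0) (d := -1) (by norm_num) ?_ ?_ <;>
      ext k <;> fin_cases k <;> simp [vec, sg, wf, hA] <;>
      ring
  rw [this]
  exact SchlafliDeformation.act_of_det_neg (isSchlafliSix_nf (by norm_num) hv) (by
    simp [hA, Matrix.det_succ_row_zero, Fin.sum_univ_succ, Fin.succAbove])

/-- Five vectors whose coordinates `(v₁ + v₂, v₁ - v₂)` are `(1, x i)` and `(y, 1)`. -/
noncomputable def hyperVec (x : Fin 4 → ℝ) (y : ℝ) : Fin 5 → ℝ × ℝ :=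
  ![((1 + x 0) / 2, (1 - x 0) / 2), ((1 + x 1) / 2, (1 - x 1) / 2), ((1 + x 2) / 2, (1 - x 2) / 2),
    ((1 + x 3) / 2, (1 - x 3) / 2), ((y + 1) / 2, (y - 1) / 2)]

noncomputable def hyperRep (a b c : ℝ) : Fin 5 → ℝ × ℝ := hyperVec ![0, a, 2 * b, 3 * c] 0

def HyperOrdered (v : Fin 5 → ℝ × ℝ) : Prop := ∀ i j, i < j →
  ((v i).1 - (v i).2) ^ 2 * ((v j).1 + (v j).2) ^ 2 < ((v j).1 - (v j).2) ^ 2 * ((v i).1 + (v i).2) ^ 2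

theorem HyperOrdered.valid {v : Fin 5 → ℝ × ℝ} (h : HyperOrdered v) : Valid (-1) v := by
  intro i j hij
  have key : wd (v i) (v j) * bf (-1) (v i) (v j) ≠ 0 := by
    simp only [wd, bf]
    rcases lt_or_gt_of_ne hij with h1 | h1
    · have := h i j h1
      intro h0
      linarith
    · have := h j i h1
      intro h0
      linarith
  exact ⟨left_ne_zero_of_mul key, right_ne_zero_of_mul key⟩

theorem hyperOrdered_hyperVec {x : Fin 4 → ℝ} {y : ℝ} (hx : ∀ i j, i < j → x i ^ 2 < x j ^ 2)
    (hy : x 3 ^ 2 * y ^ 2 < 1) : HyperOrdered (hyperVec x y) := by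
  have h01 := hx 0 1 (by decide)
  have h12 := hx 1 2 (by decide)
  have h23 := hx 2 3 (by decide)
  have hyy := sq_nonneg y
  have e0 : x 0 ^ 2 * y ^ 2 < 1 := lt_of_le_of_lt (by gcongr ?_ * _; linarith) hy
  have e1 : x 1 ^ 2 * y ^ 2 < 1 := lt_of_le_of_lt (by gcongr ?_ * _; linarith) hy
  have e2 : x 2 ^ 2 * y ^ 2 < 1 := lt_of_le_of_lt (by gcongr) hy
  intro i j hij
  fin_cases i <;> fin_cases j <;> first
    | exact absurd hij (by decide)
    | simp [hyperVec]; ring_nf; linarith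

theorem continuous_hyperVec {x : ℝ → Fin 4 → ℝ} {y : ℝ → ℝ} (hx : Continuous x) (hy : Continuous y) :
    Continuous fun t => hyperVec (x t) (y t) := by
  unfold hyperVec
  refine continuous_pi fun i => ?_
  fin_cases i <;> simp <;> constructor <;> fun_prop

theorem sq_lt_sq_of_convex {x z x' z' t : ℝ} (h : 0 ≤ x * z) (h' : 0 ≤ x' * z') (hx : x ^ 2 < x' ^ 2)
    (hz : z ^ 2 < z' ^ 2) (ht : t ∈ Set.Icc (0:ℝ) 1) :
    ((1 - t) * x + t * z) ^ 2 < ((1 - t) * x' + t * z') ^ 2 := by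
  have h1 : x * z ≤ x' * z' := by
    rw [← abs_of_nonneg h, ← abs_of_nonneg h', abs_mul, abs_mul]
    exact mul_le_mul (sq_lt_sq.1 hx).le (sq_lt_sq.1 hz).le (abs_nonneg _) (abs_nonneg _)
  obtain ⟨h0, h2⟩ := ht
  have h3 : 0 ≤ t * (1 - t) := mul_nonneg h0 (by linarith)
  have h4 : 0 ≤ (t * (1 - t)) * (x' * z' - x * z) := mul_nonneg h3 (by linarith)
  rcases h0.eq_or_lt with rfl | h0
  · simpa using hx
  · have h5 : 0 < t ^ 2 * (z' ^ 2 - z ^ 2) := mul_pos (by positivity) (by linarith)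
    have h6 : 0 ≤ (1 - t) ^ 2 * (x' ^ 2 - x ^ 2) := mul_nonneg (sq_nonneg _) (by linarith)
    nlinarith

theorem HyperOrdered.exists_hyperVec {v : Fin 5 → ℝ × ℝ} (h : HyperOrdered v) :
    ∃ x y, (∀ i j, i < j → x i ^ 2 < x j ^ 2) ∧ x 3 ^ 2 * y ^ 2 < 1 ∧
      (∀ i : Fin 4, x i * ((v i.castSucc).1 + (v i.castSucc).2) ^ 2 =
        ((v i.castSucc).1 - (v i.castSucc).2) * ((v i.castSucc).1 + (v i.castSucc).2) ∧
        (v i.castSucc).1 + (v i.castSucc).2 ≠ 0) ∧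
      SchlafliDeformation (lines (nf (-1) v)) (lines (nf (-1) (hyperVec x y))) := by
  have hp : ∀ i : Fin 4, (v i.castSucc).1 + (v i.castSucc).2 ≠ 0 := fun i h0 => by
    have := h i.castSucc (Fin.last 4) (Fin.castSucc_lt_last i)
    rw [h0] at this
    nlinarith [mul_nonneg (sq_nonneg ((v i.castSucc).1 - (v i.castSucc).2))
      (sq_nonneg ((v (Fin.last 4)).1 + (v (Fin.last 4)).2))]
  have hm : (v 4).1 - (v 4).2 ≠ 0 := fun h0 => by
    have := h 0 4 (by decide)
    rw [h0] at this
    nlinarith [mul_nonneg (sq_nonneg ((v 0).1 - (v 0).2)) (sq_nonneg ((v 4).1 + (v 4).2))]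
  have hp0 := hp 0
  have hp1 := hp 1
  have hp2 := hp 2
  have hp3 := hp 3
  simp only [Fin.castSucc_zero, Fin.castSucc_one, show (2 : Fin 4).castSucc = 2 from rfl,
    show (3 : Fin 4).castSucc = 3 from rfl] at hp0 hp1 hp2 hp3
  refine ⟨fun i => ((v i.castSucc).1 - (v i.castSucc).2) / ((v i.castSucc).1 + (v i.castSucc).2),
    ((v 4).1 + (v 4).2) / ((v 4).1 - (v 4).2), fun i j hij => ?_, ?_, fun i => ⟨?_, hp i⟩, ?_⟩
  · have := h i.castSucc j.castSucc hij
    have h1 := hp i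
    have h2 := hp j
    rw [div_pow, div_pow, div_lt_div_iff₀ (by positivity) (by positivity)]
    linarith
  · have := h 3 4 (by decide)
    simp only [show (3 : Fin 4).castSucc = 3 from rfl]
    rw [div_pow, div_pow, div_mul_div_comm, div_lt_one (by positivity)]
    linarith
  · have := hp i
    field_simp
  · convert deform_smul (by norm_num) h.valid (c := ![1 / ((v 0).1 + (v 0).2), 1 / ((v 1).1 + (v 1).2),
      1 / ((v 2).1 + (v 2).2), 1 / ((v 3).1 + (v 3).2), 1 / ((v 4).1 - (v 4).2)]) ?_ using 3
    · ext1 i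
      fin_cases i <;> simp [hyperVec] <;> refine Prod.ext ?_ ?_ <;> simp <;> field_simp <;> ring
    · intro i
      fin_cases i <;> simp [hp0, hp1, hp2, hp3, hm]

theorem deform_hyperRep {v : Fin 5 → ℝ × ℝ} (h : HyperOrdered v) {a b c : ℝ} (ha : a ^ 2 = 1)
    (hb : b ^ 2 = 1) (hc : c ^ 2 = 1) (h1 : 0 < a * (((v 1).1 - (v 1).2) * ((v 1).1 + (v 1).2)))
    (h2 : 0 < b * (((v 2).1 - (v 2).2) * ((v 2).1 + (v 2).2)))
    (h3 : 0 < c * (((v 3).1 - (v 3).2) * ((v 3).1 + (v 3).2))) :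
    SchlafliDeformation (lines (nf (-1) v)) (lines (nf (-1) (hyperRep a b c))) := by
  obtain ⟨x, y, hx, hy, hxv, hd⟩ := h.exists_hyperVec
  have key : ∀ (i : Fin 4) {e : ℝ}, 0 < e * (((v i.castSucc).1 - (v i.castSucc).2) *
      ((v i.castSucc).1 + (v i.castSucc).2)) → 0 < x i * e := fun i e he => by
    rw [← (hxv i).1] at he
    have := (hxv i).2
    refine pos_of_mul_pos_left (b := ((v i.castSucc).1 + (v i.castSucc).2) ^ 2) ?_ (by positivity)
    linarith
  have k1 := key 1 h1
  have k2 := key 2 h2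
  have k3 := key 3 h3
  have s1 : ∀ t ∈ Set.Icc (0:ℝ) 1, Valid (-1) (hyperVec x ((1 - t) * y)) := fun t ht => by
    refine (hyperOrdered_hyperVec hx (lt_of_le_of_lt ?_ hy)).valid
    gcongr ?_ * ?_
    rw [mul_pow]
    have : (1 - t) ^ 2 ≤ 1 := by nlinarith [ht.1, ht.2]
    nlinarith [sq_nonneg y]
  set z : Fin 4 → ℝ := ![0, a, 2 * b, 3 * c] with hz
  have s2 : ∀ t ∈ Set.Icc (0:ℝ) 1, Valid (-1) (hyperVec (fun i => (1 - t) * x i + t * z i) 0) :=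
    fun t ht => by
      refine (hyperOrdered_hyperVec (fun i j hij => ?_) (by norm_num)).valid
      have hxz : ∀ i, 0 ≤ x i * z i := fun i => by
        fin_cases i <;> simp [hz] <;> nlinarith
      refine sq_lt_sq_of_convex (hxz i) (hxz j) (hx i j hij) ?_ ht
      fin_cases i <;> fin_cases j <;> first
        | exact absurd hij (by decide)
        | simp [hz]; nlinarith
  have d1 := deform_path (by norm_num) (f := fun t => hyperVec x ((1 - t) * y))
    (continuous_hyperVec (by fun_prop) (by fun_prop)) s1
  have d2 := deform_path (by norm_num) (f := fun t => hyperVec (fun i => (1 - t) * x i + t * z i) 0)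
    (continuous_hyperVec (by fun_prop) (by fun_prop)) s2
  simp only [sub_zero, one_mul, sub_self, zero_mul, zero_add, add_zero] at d1 d2
  exact hd.trans (d1.trans d2)

theorem Valid.exists_hyperOrdered {v : Fin 5 → ℝ × ℝ} (hv : Valid (-1) v) :
    ∃ σ : Equiv.Perm (Fin 5), HyperOrdered (v ∘ σ) := by
  have hpos : ∀ i, 0 < ((v i).1 - (v i).2) ^ 2 + ((v i).1 + (v i).2) ^ 2 := fun i => by
    by_contra h0
    refine hv.ne_zero i (Prod.ext ?_ ?_) <;> simp <;> nlinarith [sq_nonneg ((v i).1), sq_nonneg ((v i).2)]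
  set θ : Fin 5 → ℝ := fun i => ((v i).1 - (v i).2) ^ 2 /
    (((v i).1 - (v i).2) ^ 2 + ((v i).1 + (v i).2) ^ 2) with hθ
  have hlt : ∀ i j, θ i < θ j ↔ ((v i).1 - (v i).2) ^ 2 * ((v j).1 + (v j).2) ^ 2 <
      ((v j).1 - (v j).2) ^ 2 * ((v i).1 + (v i).2) ^ 2 := fun i j => by
    rw [hθ, div_lt_div_iff₀ (hpos i) (hpos j)]
    constructor <;> intro h <;> linarith
  have hinj : Function.Injective θ := fun i j hij => by
    by_contra hne
    obtain ⟨h1, h2⟩ := hv i j hne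
    rw [hθ, div_eq_div_iff (hpos i).ne' (hpos j).ne'] at hij
    refine mul_ne_zero h1 h2 ?_
    simp only [wd, bf]
    linear_combination (1 / 4) * hij
  refine ⟨Tuple.sort θ, fun i j hij => ?_⟩
  have hs : StrictMono (θ ∘ Tuple.sort θ) :=
    (Tuple.monotone_sort θ).strictMono_of_injective (hinj.comp (Tuple.sort θ).injective)
  exact (hlt _ _).1 (hs hij)

theorem exists_sign_mul_pos {x : ℝ} (hx : x ≠ 0) : ∃ a : ℝ, a ^ 2 = 1 ∧ 0 < a * x := by
  rcases lt_or_gt_of_ne hx with h | h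
  · exact ⟨-1, by norm_num, by linarith⟩
  · exact ⟨1, by norm_num, by linarith⟩

theorem Valid.exists_hyperRep {v : Fin 5 → ℝ × ℝ} (hv : Valid (-1) v) :
    ∃ a b c : ℝ, a ^ 2 = 1 ∧ b ^ 2 = 1 ∧ c ^ 2 = 1 ∧
      SchlafliDeformation (lines (nf (-1) v)) (lines (nf (-1) (hyperRep a b c))) := by
  obtain ⟨σ, h⟩ := hv.exists_hyperOrdered
  have hne : ∀ i : Fin 5, 0 < i → i < 4 → (((v ∘ σ) i).1 - ((v ∘ σ) i).2) *
      (((v ∘ σ) i).1 + ((v ∘ σ) i).2) ≠ 0 := fun i h0 h4 => by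
    refine mul_ne_zero (fun he => ?_) fun he => ?_
    · have := h 0 i h0
      rw [he] at this
      nlinarith [mul_nonneg (sq_nonneg (((v ∘ σ) 0).1 - ((v ∘ σ) 0).2))
        (sq_nonneg (((v ∘ σ) i).1 + ((v ∘ σ) i).2))]
    · have := h i 4 h4
      rw [he] at this
      nlinarith [mul_nonneg (sq_nonneg (((v ∘ σ) i).1 - ((v ∘ σ) i).2))
        (sq_nonneg (((v ∘ σ) 4).1 + ((v ∘ σ) 4).2))]
  obtain ⟨a, ha, ha'⟩ := exists_sign_mul_pos (hne 1 (by decide) (by decide))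
  obtain ⟨b, hb, hb'⟩ := exists_sign_mul_pos (hne 2 (by decide) (by decide))
  obtain ⟨c, hc, hc'⟩ := exists_sign_mul_pos (hne 3 (by decide) (by decide))
  exact ⟨a, b, c, ha, hb, hc, (deform_perm (by norm_num) hv σ).trans
    (deform_hyperRep h ha hb hc ha' hb' hc')⟩

theorem hyperOrdered_hyperRep {a b c : ℝ} (ha : a ^ 2 = 1) (hb : b ^ 2 = 1) (hc : c ^ 2 = 1) :
    HyperOrdered (hyperRep a b c) := by
  refine hyperOrdered_hyperVec (fun i j hij => ?_) (by norm_num)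
  fin_cases i <;> fin_cases j <;> first
    | exact absurd hij (by decide)
    | simp [mul_pow, ha, hb, hc]; try norm_num

theorem hyperRep_reverse {a b c : ℝ} (ha : a ^ 2 = 1) (hb : b ^ 2 = 1) (hc : c ^ 2 = 1) :
    SchlafliDeformation (lines (nf (-1) (hyperRep a b c))) (lines (nf (-1) (hyperRep c b a))) := by
  have hv := (hyperOrdered_hyperRep ha hb hc).valid
  refine (deform_conj (by norm_num) hv).trans ((deform_perm (by norm_num) hv.conj Fin.revPerm).trans
    (deform_hyperRep ?_ hc hb ha ?_ ?_ ?_))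
  · intro i j hij
    have := hyperOrdered_hyperRep ha hb hc j.rev i.rev (by simpa using hij)
    simp only [Function.comp_apply, Fin.revPerm_apply]
    linarith
  all_goals simp [hyperRep, hyperVec]; ring_nf; simp [ha, hb, hc]

theorem hyperRep_mirror {a b c : ℝ} (ha : a ^ 2 = 1) (hb : b ^ 2 = 1) (hc : c ^ 2 = 1) :
    SchlafliDeformation (act Refl (lines (nf (-1) (hyperRep a b c))))
      (lines (nf (-1) (hyperRep (-a) (-b) (-c)))) := by
  have hv := (hyperOrdered_hyperRep ha hb hc).valid
  refine (deform_swap hv).trans (deform_hyperRep ?_ (by rwa [neg_sq]) (by rwa [neg_sq]) (by rwa [neg_sq]) ?_ ?_ ?_)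
  · intro i j hij
    have := hyperOrdered_hyperRep ha hb hc i j hij
    dsimp only
    linarith
  all_goals simp [hyperRep, hyperVec]; ring_nf; simp [ha, hb, hc]

/-- Two Schläfli sixes related by a projective transformation and a relabelling. -/
theorem lines_eq_act_comp (A : Mat4) (u u' : Fin 6 → V4 × V4) (o : Fin 6 → Fin 6)
    (w : Fin 6 → ℝ × ℝ × ℝ × ℝ) (hw : ∀ i, (w i).1 * (w i).2.2.2 - (w i).2.1 * (w i).2.2.1 ≠ 0)
    (h : ∀ i k, (u' i).1 k = (w i).1 * (A.mulVec (u (o i)).1) k + (w i).2.1 * (A.mulVec (u (o i)).2) k ∧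
      (u' i).2 k = (w i).2.2.1 * (A.mulVec (u (o i)).1) k + (w i).2.2.2 * (A.mulVec (u (o i)).2) k) :
    lines u' = act A (lines u) ∘ o := by
  rw [act_lines]
  ext1 i
  refine ln_eq_of_comb (hw i) ?_ ?_ <;> ext k
  · simpa using (h i k).1
  · simpa using (h i k).2

/-- The configurations deformable to one of hyperbolic type. -/
def IsHyper (L : Fin 6 → PLine) : Prop :=
  ∃ a b c : ℝ, a ^ 2 = 1 ∧ b ^ 2 = 1 ∧ c ^ 2 = 1 ∧
    SchlafliDeformation L (lines (nf (-1) (hyperRep a b c)))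

theorem IsHyper.act {L : Fin 6 → PLine} (h : IsHyper L) {M : Mat4} (hM : M.det ≠ 0) :
    IsHyper (act M L) := by
  obtain ⟨a, b, c, ha, hb, hc, hd⟩ := h
  have h1 := hd.act hM
  have hs := isSchlafliSix_nf (by norm_num) (hyperOrdered_hyperRep ha hb hc).valid
  rcases lt_or_gt_of_ne hM with h0 | h0
  · exact ⟨-a, -b, -c, by rwa [neg_sq], by rwa [neg_sq], by rwa [neg_sq],
      h1.trans ((SchlafliDeformation.act_of_det_neg hs h0).symm.trans (hyperRep_mirror ha hb hc))⟩
  · exact ⟨a, b, c, ha, hb, hc, h1.trans (SchlafliDeformation.act_of_det_pos hs h0).symm⟩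

theorem IsHyper.of_deformation {L L' : Fin 6 → PLine} (h : IsHyper L) (hd : SchlafliDeformation L' L) :
    IsHyper L' := by
  obtain ⟨a, b, c, ha, hb, hc, h⟩ := h
  exact ⟨a, b, c, ha, hb, hc, hd.trans h⟩

theorem Valid.isHyper {v : Fin 5 → ℝ × ℝ} (hv : Valid (-1) v) : IsHyper (lines (nf (-1) v)) :=
  hv.exists_hyperRep

theorem nf_eq (κ : ℝ) (v : Fin 5 → ℝ × ℝ) : nf κ v =
    let L := fun i => linePair (sg κ (v i)) (-(mu κ v i) • ((v i).1, κ * (v i).2))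
      ((2 * ((v i).1 ^ 2 + (v i).2 ^ 2)) • wf κ (v i))
    ![L 0, L 1, L 2, L 3, L 4, (![0, 0, 1, 0], ![0, 0, 0, 1])] := by
  funext i
  induction i using Fin.lastCases with
  | last => simp only [nf_last]; rfl
  | cast i => rw [nf_castSucc]; fin_cases i <;> rfl

theorem lines_nf_matching {κ : ℝ} {v v' : Fin 5 → ℝ × ℝ} {A : Mat4} (m m' : Fin 5 → ℝ)
    (hm : ∀ i, mu κ v i = m i) (hm' : ∀ i, mu (-1) v' i = m' i) (o : Fin 6 → Fin 6)
    (w : Fin 6 → ℝ × ℝ × ℝ × ℝ) (hw : ∀ i, (w i).1 * (w i).2.2.2 - (w i).2.1 * (w i).2.2.1 ≠ 0)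
    (h : ∀ i k, let L := fun i => (![-(κ * (v i).2), (v i).1, 0, 0],
        ![-m i * (v i).1, -m i * (κ * (v i).2), 2 * ((v i).1 ^ 2 + (v i).2 ^ 2) * (-2 * ((v i).1 * (v i).2)),
          2 * ((v i).1 ^ 2 + (v i).2 ^ 2) * ((v i).1 ^ 2 - κ * (v i).2 ^ 2)])
      let L' := fun i => (![(v' i).2, (v' i).1, 0, 0],
        ![-m' i * (v' i).1, m' i * (v' i).2,
          2 * ((v' i).1 ^ 2 + (v' i).2 ^ 2) * (-2 * ((v' i).1 * (v' i).2)),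
          2 * ((v' i).1 ^ 2 + (v' i).2 ^ 2) * ((v' i).1 ^ 2 + (v' i).2 ^ 2)])
      let u : Fin 6 → V4 × V4 := ![L 0, L 1, L 2, L 3, L 4, (![0, 0, 1, 0], ![0, 0, 0, 1])]
      let u' : Fin 6 → V4 × V4 := ![L' 0, L' 1, L' 2, L' 3, L' 4, (![0, 0, 1, 0], ![0, 0, 0, 1])]
      let B : V4 → V4 := fun x => ![A 0 0 * x 0 + A 0 1 * x 1 + A 0 2 * x 2 + A 0 3 * x 3,
        A 1 0 * x 0 + A 1 1 * x 1 + A 1 2 * x 2 + A 1 3 * x 3,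
        A 2 0 * x 0 + A 2 1 * x 1 + A 2 2 * x 2 + A 2 3 * x 3,
        A 3 0 * x 0 + A 3 1 * x 1 + A 3 2 * x 2 + A 3 3 * x 3]
      (u' i).1 k = (w i).1 * B (u (o i)).1 k + (w i).2.1 * B (u (o i)).2 k ∧
        (u' i).2 k = (w i).2.2.1 * B (u (o i)).1 k + (w i).2.2.2 * B (u (o i)).2 k) :
    lines (nf (-1) v') = act A (lines (nf κ v)) ∘ o := by
  have hB : ∀ x : V4, A.mulVec x = ![A 0 0 * x 0 + A 0 1 * x 1 + A 0 2 * x 2 + A 0 3 * x 3,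
        A 1 0 * x 0 + A 1 1 * x 1 + A 1 2 * x 2 + A 1 3 * x 3,
        A 2 0 * x 0 + A 2 1 * x 1 + A 2 2 * x 2 + A 2 3 * x 3,
        A 3 0 * x 0 + A 3 1 * x 1 + A 3 2 * x 2 + A 3 3 * x 3] := fun x => by
    ext k; fin_cases k <;> simp [Matrix.mulVec, dotProduct, Fin.sum_univ_four]
  refine lines_eq_act_comp A _ _ o w hw ?_
  have e : nf κ v = ![_, _, _, _, _, _] := nf_eq κ v
  have e' : nf (-1) v' = ![_, _, _, _, _, _] := nf_eq (-1) v'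
  simp only [hm, hm', linePair, sg, wf, vec, Prod.smul_fst, Prod.smul_snd, smul_eq_mul, Prod.fst_zero,
    Prod.snd_zero, neg_mul, one_mul, neg_neg, sub_neg_eq_add, mul_neg] at e e'
  simp only [e, e', hB]
  simpa only [neg_mul, mul_neg] using h

theorem lines_matching {κ : ℝ} {v v' : Fin 5 → ℝ × ℝ} {A : Mat4} {o : Fin 6 → Fin 6}
    (ho : Function.Injective o) (h : lines (nf (-1) v') = act A (lines (nf κ v)) ∘ o)
    (hκ : κ ^ 2 = 1) (hv : Valid κ v) (hA : A.det ≠ 0) :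
    SchlafliDeformation (act A (lines (nf κ v))) (lines (nf (-1) v')) := by
  have : o = Equiv.ofBijective o (Finite.injective_iff_bijective.1 ho) := rfl
  rw [h, this]
  exact SchlafliDeformation.comp_right ((isSchlafliSix_nf hκ hv).act hA) _

theorem isHyper_of_matching {κ : ℝ} {v v' : Fin 5 → ℝ × ℝ} {A : Mat4} {o : Fin 6 → Fin 6}
    (ho : Function.Injective o) (h : lines (nf (-1) v') = act A (lines (nf κ v)) ∘ o)
    (hκ : κ ^ 2 = 1) (hv : Valid κ v) (hv' : Valid (-1) v') (hA : A.det ≠ 0) :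
    IsHyper (lines (nf κ v)) := by
  have h1 := (hv'.isHyper.of_deformation (lines_matching ho h hκ hv hA)).act (M := A⁻¹) (by
    rw [Matrix.det_nonsing_inv]; simpa using hA)
  rwa [act_act, Matrix.nonsing_inv_mul _ (by simpa using hA), act_one] at h1

theorem hyperRep_extra : SchlafliDeformation (lines (nf (-1) (hyperRep 1 1 (-1))))
    (lines (nf (-1) (hyperRep (-1) (-1) 1))) := by
  have ho : HyperOrdered ![(1, 1), (5, 1), (1, 0), (-1, 3), (1, -1)] := fun i j hij => by
    fin_cases i <;> fin_cases j <;> first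
      | exact absurd hij (by decide)
      | simp; try norm_num
  have ho' : HyperOrdered ![(1, 1), (5, 6), (-4, -3), (-3, -2), (-1, 0)] := fun i j hij => by
    fin_cases i <;> fin_cases j <;> first
      | exact absurd hij (by decide)
      | simp; try norm_num
  have hdet : Matrix.det (!![1/65536, 0, 35/131072, -5/131072; 0, 0, 3/16384, 0; 0, 1/16384, 0, 0;
      1/786432, -49/786432, 7/786432, -1/786432] : Mat4) < 0 := by
    simp [Matrix.det_succ_row_zero, Fin.sum_univ_succ, Fin.succAbove]; norm_num
  have d1 := lines_matching (by decide) (lines_nf_matching (κ := -1)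
    (v := ![(1, 1), (5, 1), (1, 0), (-1, 3), (1, -1)])
    (v' := ![(1, 1), (5, 6), (-4, -3), (-3, -2), (-1, 0)])
    (A := !![1/65536, 0, 35/131072, -5/131072; 0, 0, 3/16384, 0; 0, 1/16384, 0, 0;
      1/786432, -49/786432, 7/786432, -1/786432])
    ![-32, -960, -5, -64, 24] ![1, 30, 48, 54, 60]
    (fun i => by fin_cases i <;> simp [mu, bf, Fin.prod_univ_five] <;> norm_num)
    (fun i => by fin_cases i <;> simp [mu, bf, Fin.prod_univ_five] <;> norm_num)
    ![0, 1, 4, 3, 5, 2]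
    ![(-65536/3, -2048/3, -458752/3, -2048/3),
      (-131072/13, -2048/39, -316538880/13, -24576/13), (-65536, -8192/3, -22020096, -98304),
      (131072/5, -2048/15, 30277632/5, -24576/5), (-16384/3, -114688/3, 0, -1572864),
      (16384, 802816/3, 0, 262144)]
    (fun i => by fin_cases i <;> simp <;> norm_num)
    (fun i k => by fin_cases i <;> fin_cases k <;> simp <;> norm_num))
    (by norm_num) ho.valid hdet.ne
  have d2 := deform_hyperRep ho (a := 1) (b := 1) (c := -1) (by norm_num) (by norm_num) (by norm_num)
    (by simp; norm_num) (by simp) (by simp; norm_num)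
  have d3 := deform_hyperRep ho' (a := -1) (b := 1) (c := 1) (by norm_num) (by norm_num) (by norm_num)
    (by simp; norm_num) (by simp; norm_num) (by simp; norm_num)
  have d4 := SchlafliDeformation.act_of_det_neg (isSchlafliSix_nf (by norm_num) ho.valid) hdet
  have d5 := hyperRep_mirror (a := 1) (b := 1) (c := -1) (by norm_num) (by norm_num) (by norm_num)
  have d6 := hyperRep_reverse (a := -1) (b := 1) (c := 1) (by norm_num) (by norm_num) (by norm_num)
  rw [neg_neg] at d5
  exact d6.symm.trans (d3.symm.trans (d1.symm.trans (d4.symm.trans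
    ((d2.act (M := Refl) (by rw [det_Refl]; norm_num)).trans d5))))

/-- The representatives of hyperbolic type. -/
theorem IsHyper.exists_rep {L : Fin 6 → PLine} (h : IsHyper L) :
    SchlafliDeformation L (lines (nf (-1) (hyperRep 1 1 1))) ∨
    SchlafliDeformation L (lines (nf (-1) (hyperRep (-1) (-1) (-1)))) ∨
    SchlafliDeformation L (lines (nf (-1) (hyperRep 1 (-1) 1))) ∨
    SchlafliDeformation L (lines (nf (-1) (hyperRep (-1) 1 (-1)))) ∨
    SchlafliDeformation L (lines (nf (-1) (hyperRep 1 1 (-1)))) := by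
  obtain ⟨a, b, c, ha, hb, hc, h⟩ := h
  have r1 := hyperRep_reverse (a := -1) (b := 1) (c := 1) (by norm_num) (by norm_num) (by norm_num)
  have r2 := hyperRep_reverse (a := 1) (b := -1) (c := -1) (by norm_num) (by norm_num) (by norm_num)
  have he := hyperRep_extra.symm
  rcases sq_eq_one_iff.1 ha with rfl | rfl <;> rcases sq_eq_one_iff.1 hb with rfl | rfl <;>
    rcases sq_eq_one_iff.1 hc with rfl | rfl
  · exact .inl h
  · exact .inr (.inr (.inr (.inr h)))
  · exact .inr (.inr (.inl h))
  · exact .inr (.inr (.inr (.inr (h.trans (r2.trans he)))))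
  · exact .inr (.inr (.inr (.inr (h.trans r1))))
  · exact .inr (.inr (.inr (.inl h)))
  · exact .inr (.inr (.inr (.inr (h.trans he))))
  · exact .inr (.inl h)

/-- Five vectors with `v i` equal to `(1, x i)`, or to that vector turned by a right angle. -/
def ellVec (ε : Fin 5 → Bool) (x : Fin 5 → ℝ) (i : Fin 5) : ℝ × ℝ :=
  if ε i then (-x i, 1) else (1, x i)

def ellRep (ε : Fin 5 → Bool) : Fin 5 → ℝ × ℝ := ellVec ε ![0, 1, 2, 3, 4]

theorem valid_ellVec (ε : Fin 5 → Bool) {x : Fin 5 → ℝ} (hx : StrictMono x) (h0 : ∀ i, 0 ≤ x i) :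
    Valid 1 (ellVec ε x) := by
  intro i j hij
  have h1 : x i - x j ≠ 0 := sub_ne_zero.2 (hx.injective.ne hij)
  have h2 : 1 + x i * x j ≠ 0 := by
    have := mul_nonneg (h0 i) (h0 j)
    positivity
  unfold ellVec
  split_ifs <;> simp only [wd, bf] <;> constructor <;> intro h <;> first
    | exact h1 (by linear_combination h)
    | exact h1 (by linear_combination -h)
    | exact h2 (by linear_combination h)
    | exact h2 (by linear_combination -h)

theorem strictMono_std : StrictMono (![0, 1, 2, 3, 4] : Fin 5 → ℝ) := by
  rw [Fin.strictMono_iff_lt_succ]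
  intro i
  fin_cases i <;> simp <;> norm_num

theorem std_nonneg (i : Fin 5) : 0 ≤ (![0, 1, 2, 3, 4] : Fin 5 → ℝ) i := by
  fin_cases i <;> simp

theorem valid_ellRep (ε : Fin 5 → Bool) : Valid 1 (ellRep ε) :=
  valid_ellVec ε strictMono_std std_nonneg

theorem deform_ellVec (ε : Fin 5 → Bool) {x : Fin 5 → ℝ} (hx : StrictMono x) (h0 : ∀ i, 0 ≤ x i) :
    SchlafliDeformation (lines (nf 1 (ellVec ε x))) (lines (nf 1 (ellRep ε))) := by
  have := deform_path (κ := 1) (by norm_num)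
    (f := fun t => ellVec ε ((1 - t) • x + t • ![0, 1, 2, 3, 4])) ?_ fun t ht => ?_
  · simpa only [ellRep, sub_zero, one_smul, zero_smul, add_zero, sub_self, zero_add] using this
  · refine continuous_pi fun i => ?_
    simp only [ellVec, Pi.add_apply, Pi.smul_apply, smul_eq_mul]
    split_ifs <;> fun_prop
  · have h1 : 0 ≤ 1 - t := by linarith [ht.2]
    refine valid_ellVec ε (fun i j hij => ?_) fun i => ?_
    · have e1 := hx hij
      have e2 := strictMono_std hij
      simp only [Pi.add_apply, Pi.smul_apply, smul_eq_mul]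
      rcases ht.1.eq_or_lt with rfl | h2
      · simpa using e1
      · have := mul_lt_mul_of_pos_left e2 h2
        have := mul_le_mul_of_nonneg_left e1.le h1
        linarith
    · have := mul_nonneg h1 (h0 i)
      have := mul_nonneg ht.1 (std_nonneg i)
      simp only [Pi.add_apply, Pi.smul_apply, smul_eq_mul]
      linarith

theorem deform_ellRep {v : Fin 5 → ℝ × ℝ} (σ : Equiv.Perm (Fin 5)) {ε : Fin 5 → Bool}
    {x c : Fin 5 → ℝ} (hc : ∀ i, c i ≠ 0) (hx : StrictMono x) (h0 : ∀ i, 0 ≤ x i)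
    (h : ∀ i, v (σ i) = c i • ellVec ε x i) :
    SchlafliDeformation (lines (nf 1 v)) (lines (nf 1 (ellRep ε))) := by
  have hv := valid_ellVec ε hx h0
  have e1 : v ∘ σ = fun i => c i • ellVec ε x i := funext h
  have e2 : v = (v ∘ σ) ∘ σ.symm := by ext1 i; simp
  refine SchlafliDeformation.trans ?_ (deform_ellVec ε hx h0)
  refine ((deform_smul (by norm_num) hv hc).trans ?_).symm
  have := deform_perm (κ := 1) (by norm_num) (hv.smul hc) σ.symm
  rw [← e1, ← e2] at this
  rwa [← e1]

theorem exists_ellVec {z : ℝ × ℝ} (hz : z ≠ 0) : ∃ (ε : Bool) (x c : ℝ), c ≠ 0 ∧ 0 ≤ x ∧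
    z = c • if ε then (-x, 1) else (1, x) := by
  obtain ⟨a, b⟩ := z
  by_cases ha : a = 0
  · subst ha
    have hb : b ≠ 0 := fun h => hz (by rw [h]; rfl)
    exact ⟨true, 0, b, hb, le_rfl, by simp⟩
  by_cases hab : 0 ≤ a * b
  · refine ⟨false, b / a, a, ha, ?_, by simp; field_simp⟩
    rw [show b / a = a * b / a ^ 2 by field_simp]
    positivity
  · have hb : b ≠ 0 := fun h => hab (by simp [h])
    refine ⟨true, -a / b, b, hb, ?_, by simp; field_simp⟩
    rw [show -a / b = -(a * b) / b ^ 2 by field_simp]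
    exact div_nonneg (by linarith) (by positivity)

theorem Valid.exists_ellRep {v : Fin 5 → ℝ × ℝ} (hv : Valid 1 v) :
    ∃ ε, SchlafliDeformation (lines (nf 1 v)) (lines (nf 1 (ellRep ε))) := by
  choose ε x c hc h0 h using fun i => exists_ellVec (hv.ne_zero i)
  have hinj : Function.Injective x := fun i j hij => by
    by_contra hne
    obtain ⟨h1, h2⟩ := hv i j hne
    rw [h i, h j, wd_smul_smul] at h1
    rw [h i, h j, bf_smul_smul] at h2
    cases hi : ε i <;> cases hj : ε j <;> simp [hi, hj, hij, wd, bf] at h1 h2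
  exact ⟨ε ∘ Tuple.sort x, deform_ellRep (x := x ∘ Tuple.sort x) (c := c ∘ Tuple.sort x) (Tuple.sort x)
    (fun i => hc _) ((Tuple.monotone_sort x).strictMono_of_injective (hinj.comp (Tuple.sort x).injective))
    (fun i => h0 _) fun i => h _⟩

theorem ellRep_rotate (ε : Fin 5 → Bool) : SchlafliDeformation (lines (nf 1 (ellRep ε)))
    (lines (nf 1 (ellRep ![ε 1, ε 2, ε 3, ε 4, !ε 0]))) := by
  have h1 := deform_path (κ := 1) (by norm_num)
    (f := fun t i => ((ellRep ε i).1 + t * (ellRep ε i).2, (ellRep ε i).2 - t * (ellRep ε i).1))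
    (by fun_prop) fun t ht i j hij => by
      obtain ⟨h1, h2⟩ := valid_ellRep ε i j hij
      have ht' : 1 + t ^ 2 ≠ 0 := by positivity
      refine ⟨fun h => mul_ne_zero ht' h1 ?_, fun h => mul_ne_zero ht' h2 ?_⟩ <;>
        simp only [wd, bf] at h ⊢ <;> linear_combination h
  simp only [zero_mul, add_zero, sub_zero, one_mul] at h1
  refine h1.trans (deform_ellRep (finRotate 5) (x := ![0, 1 / 3, 1 / 2, 3 / 5, 1])
    (c := ![2, 3, 4, 5, if ε 0 then 1 else -1]) (fun i => ?_) ?_ (fun i => ?_) fun i => ?_)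
  · fin_cases i <;> simp
    split_ifs <;> norm_num
  · rw [Fin.strictMono_iff_lt_succ]
    intro i
    fin_cases i <;> simp <;> norm_num
  · fin_cases i <;> simp
    norm_num
  · fin_cases i <;> simp [ellVec, ellRep] <;> split_ifs <;> (refine Prod.ext ?_ ?_ <;> simp_all) <;> norm_num

theorem isHyper_ellRep {ε : Fin 5 → Bool} {v v' : Fin 5 → ℝ × ℝ} {A : Mat4} {o : Fin 6 → Fin 6}
    {x c : Fin 5 → ℝ} (ho : Function.Injective o) (h : lines (nf (-1) v') = act A (lines (nf 1 v)) ∘ o)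
    (hv' : ∀ i j, i ≠ j → wd (v' i) (v' j) ≠ 0 ∧ bf (-1) (v' i) (v' j) ≠ 0) (hA : A.det ≠ 0)
    (hc : ∀ i, c i ≠ 0) (hx : ∀ i : Fin 4, x i.castSucc < x i.succ) (h0 : ∀ i, 0 ≤ x i)
    (hvx : ∀ i, v i = c i • ellVec ε x i) : IsHyper (lines (nf 1 (ellRep ε))) := by
  have hx' := Fin.strictMono_iff_lt_succ.2 hx
  have hv : v = fun i => c i • ellVec ε x i := funext hvx
  have hval : Valid 1 v := hv ▸ (valid_ellVec ε hx' h0).smul hc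
  exact (isHyper_of_matching ho h (by norm_num) hval hv' hA).of_deformation
    (deform_ellRep (Equiv.refl _) hc hx' h0 hvx).symm

theorem isHyper_ellRep_zero : IsHyper (lines (nf 1 (ellRep ![false, false, false, false, false]))) := by
  have h := lines_nf_matching (κ := 1)
    (v := ![(1, 0), (3, 2), (1, 1), (2, 3), (1, 2)])
    (v' := ![(1, 1), (9, 5), (7, 3), (5, 1), (1, 0)])
    (A := !![1/140625, 2/140625, -7/30000, 7/62500;
      0, 0, -1/50000, 1/37500;
      -1/9000000, 1/18000000, 0, 0;
      7/135000000, -13/90000000, 1/675000, -1/1406250])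
    ![6, 1260, 75, 960, 168] ![64, 69120, 43008, 25600, 315]
    (fun i => by fin_cases i <;> simp [mu, bf, Fin.prod_univ_five] <;> norm_num)
    (fun i => by fin_cases i <;> simp [mu, bf, Fin.prod_univ_five] <;> norm_num)
    ![3, 2, 1, 0, 5, 4]
    ![(-562500/13, 9375/26, -270000000/13, 300000/13),
      (-1406250, 56250, -168480000000, 2160000000),
      (-6750000/13, 9375/13, -287280000000/13, 172800000/13),
      (-1125000, 93750, -15120000000, 480000000), (28125, 234375/4, 2109375, 6328125/4),
      (3600000, 1884375/4, 0, 2109375/4)]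
    (fun i => by fin_cases i <;> simp <;> norm_num)
    (fun i k => by fin_cases i <;> fin_cases k <;> simp <;> norm_num)
  refine isHyper_ellRep (by decide) h (fun i j hij => ?_) ?_ (x := ![0, 2 / 3, 1, 3 / 2, 2])
    (c := ![1, 3, 1, 2, 1]) (fun i => ?_) (fun i => ?_) (fun i => ?_) fun i => ?_
  · fin_cases i <;> fin_cases j <;> first
      | exact absurd rfl hij
      | simp [wd, bf]; try norm_num
  · simp [Matrix.det_succ_row_zero, Fin.sum_univ_succ, Fin.succAbove]; try norm_num
  · fin_cases i <;> simp
  · fin_cases i <;> simp <;> norm_num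
  · fin_cases i <;> simp <;> norm_num
  · fin_cases i <;> simp [ellVec] <;> try norm_num

theorem isHyper_ellRep_three : IsHyper (lines (nf 1 (ellRep ![false, false, false, true, false]))) := by
  have h := lines_nf_matching (κ := 1)
    (v := ![(1, 0), (2, 1), (1, 1), (-3, 1), (1, 4)])
    (v' := ![(1, 2), (1, 3), (-9, -2), (-1, 0), (2, -1)])
    (A := !![1/2109375, 0, 1/468750, -1/703125;
      0, 0, -1/1406250, 0;
      0, 2/52734375, 0, 0;
      -1/31640625, -1/12656250, -1/4218750, 1/6328125])
    ![-6, -180, -30, -30, 30] ![-100, -75, -2700, -18, 800]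
    (fun i => by fin_cases i <;> simp [mu, bf, Fin.prod_univ_five] <;> norm_num)
    (fun i => by fin_cases i <;> simp [mu, bf, Fin.prod_univ_five] <;> norm_num)
    ![2, 1, 3, 5, 4, 0]
    ![(-10546875/2, 703125/4, 0, -35156250), (-6328125/2, 140625/4, -1740234375/2, -31640625/4),
      (2109375/2, 421875/4, 53156250000, -63281250), (1406250, 2109375, 0, 12656250),
      (21093750/17, 703125/68, 9492187500/17, -70312500/17),
      (52734375/2, 263671875/16, 0, 31640625/4)]
    (fun i => by fin_cases i <;> simp <;> norm_num)
    (fun i k => by fin_cases i <;> fin_cases k <;> simp <;> norm_num)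
  refine isHyper_ellRep (by decide) h (fun i j hij => ?_) ?_ (x := ![0, 1 / 2, 1, 3, 4])
    (c := ![1, 2, 1, 1, 1]) (fun i => ?_) (fun i => ?_) (fun i => ?_) fun i => ?_
  · fin_cases i <;> fin_cases j <;> first
      | exact absurd rfl hij
      | simp [wd, bf]; try norm_num
  · simp [Matrix.det_succ_row_zero, Fin.sum_univ_succ, Fin.succAbove]; try norm_num
  · fin_cases i <;> simp
  · fin_cases i <;> simp <;> norm_num
  · fin_cases i <;> simp
  · fin_cases i <;> simp [ellVec]

theorem isHyper_ellRep_two : IsHyper (lines (nf 1 (ellRep ![false, false, true, false, false]))) := by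
  have h := lines_nf_matching (κ := 1)
    (v := ![(1, 0), (4, 1), (-1, 2), (1, 1), (1, 2)])
    (v' := ![(1, 0), (-2, 1), (-2, 3), (5, -4), (1, -1)])
    (A := !![-1/2125764, -1/2125764, 5/2834352, 5/1062882;
      0, 0, 0, -1/354294;
      1/531441, -1/531441, 0, 0;
      1/472392, -1/531441, -1/5668704, -1/2125764])
    ![-4, -240, 6, 15, 54] ![20, -12, -4, -60, -1]
    (fun i => by fin_cases i <;> simp [mu, bf, Fin.prod_univ_five] <;> norm_num)
    (fun i => by fin_cases i <;> simp [mu, bf, Fin.prod_univ_five] <;> norm_num)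
    ![5, 2, 4, 1, 0, 3]
    ![(944784, -354294, -11337408, 0), (-2125764/5, -118098/5, -119042784/5, -708588/5),
      (-2125764/5, -118098/5, -289103904/5, -708588/5),
      (-8503056/17, -59049/17, -6334776720/17, -2834352/17), (-708588, -177147, -4960116, -177147),
      (-531441/2, 1003833/2, 0, -472392)]
    (fun i => by fin_cases i <;> simp <;> norm_num)
    (fun i k => by fin_cases i <;> fin_cases k <;> simp <;> norm_num)
  refine isHyper_ellRep (by decide) h (fun i j hij => ?_) ?_ (x := ![0, 1 / 4, 1 / 2, 1, 2])
    (c := ![1, 4, 2, 1, 1]) (fun i => ?_) (fun i => ?_) (fun i => ?_) fun i => ?_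
  · fin_cases i <;> fin_cases j <;> first
      | exact absurd rfl hij
      | simp [wd, bf]; try norm_num
  · simp [Matrix.det_succ_row_zero, Fin.sum_univ_succ, Fin.succAbove]; try norm_num
  · fin_cases i <;> simp
  · fin_cases i <;> simp <;> norm_num
  · fin_cases i <;> simp
  · fin_cases i <;> simp [ellVec]

theorem ellRep_exists (ε : Fin 5 → Bool) : IsHyper (lines (nf 1 (ellRep ε))) ∨
    SchlafliDeformation (lines (nf 1 (ellRep ε))) (lines (nf 1 (ellRep ![false, true, false, true, false]))) := by
  set P : (Fin 5 → Bool) → Prop := fun ε => IsHyper (lines (nf 1 (ellRep ε))) ∨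
    SchlafliDeformation (lines (nf 1 (ellRep ε)))
      (lines (nf 1 (ellRep ![false, true, false, true, false]))) with hP
  have hrot : ∀ ε : Fin 5 → Bool, P ![ε 1, ε 2, ε 3, ε 4, !ε 0] → P ε := fun ε h =>
    h.imp (fun h => h.of_deformation (ellRep_rotate ε)) fun h => (ellRep_rotate ε).trans h
  have h0 : P ![false, false, false, false, false] := .inl isHyper_ellRep_zero
  have h1 : P ![false, false, false, true, false] := .inl isHyper_ellRep_three
  have h2 : P ![false, false, true, false, false] := .inl isHyper_ellRep_two
  have h3 : P ![false, true, false, true, false] :=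
    .inr (.refl (isSchlafliSix_nf (by norm_num) (valid_ellRep _)))
  have hit : ∀ (n : ℕ) (ε : Fin 5 → Bool),
      P ((fun ε : Fin 5 → Bool => ![ε 1, ε 2, ε 3, ε 4, !ε 0])^[n] ε) → P ε := fun n => by
    induction n with
    | zero => exact fun _ h => h
    | succ n ih => exact fun ε h => hrot ε (ih _ h)
  have key : ∀ ε : Fin 5 → Bool, ∃ n < 10, (fun ε : Fin 5 → Bool => ![ε 1, ε 2, ε 3, ε 4, !ε 0])^[n] ε ∈
      ({![false, false, false, false, false], ![false, false, false, true, false],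
        ![false, false, true, false, false], ![false, true, false, true, false]} :
          Finset (Fin 5 → Bool)) := by decide
  obtain ⟨n, -, hn⟩ := key ε
  refine hit n ε ?_
  simp only [Finset.mem_insert, Finset.mem_singleton] at hn
  rcases hn with h | h | h | h <;> rw [h] <;> assumption

theorem IsSchlafliSix.exists_rep {L : Fin 6 → PLine} (hL : IsSchlafliSix L) : IsHyper L ∨
    SchlafliDeformation L (lines (nf 1 (ellRep ![false, true, false, true, false]))) ∨
    SchlafliDeformation L
      (_root_.act Refl (lines (nf 1 (ellRep ![false, true, false, true, false])))) := by
  obtain ⟨π, M, κ, v, hM, hκ, hv, h⟩ := hL.exists_nf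
  have hLM : SchlafliDeformation L (_root_.act M (lines (nf κ v))) := h ▸ SchlafliDeformation.comp_right hL π
  have hN := isSchlafliSix_nf hκ hv
  have hyp : IsHyper (lines (nf κ v)) → IsHyper L := fun h => (h.act hM).of_deformation hLM
  rcases sq_eq_one_iff.1 hκ with rfl | rfl
  · obtain ⟨ε, hε⟩ := hv.exists_ellRep
    rcases ellRep_exists ε with he | he
    · exact .inl (hyp (he.of_deformation hε))
    · right
      rcases lt_or_gt_of_ne hM with h0 | h0
      · exact .inr (hLM.trans ((SchlafliDeformation.act_of_det_neg hN h0).symm.trans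
          ((hε.trans he).act (by rw [det_Refl]; norm_num))))
      · exact .inl (hLM.trans ((SchlafliDeformation.act_of_det_pos hN h0).symm.trans (hε.trans he)))
  · exact .inl (hyp hv.isHyper)

/-- Lagrange interpolation of a binary cubic at five points. -/
theorem lagrange_cubic (κ w c0 c1 c2 c3 a a' b b' c c' d d' e e' : ℝ)
    (h0 : w * ((a * b + κ * (a' * b')) * (a * c + κ * (a' * c')) * (a * d + κ * (a' * d')) * (a * e + κ * (a' * e'))) +
      (c0 * a ^ 3 + c1 * (a ^ 2 * a') + c2 * (a * a' ^ 2) + c3 * a' ^ 3) = 0)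
    (h1 : w * ((b * a + κ * (b' * a')) * (b * c + κ * (b' * c')) * (b * d + κ * (b' * d')) * (b * e + κ * (b' * e'))) +
      (c0 * b ^ 3 + c1 * (b ^ 2 * b') + c2 * (b * b' ^ 2) + c3 * b' ^ 3) = 0)
    (h2 : w * ((c * a + κ * (c' * a')) * (c * b + κ * (c' * b')) * (c * d + κ * (c' * d')) * (c * e + κ * (c' * e'))) +
      (c0 * c ^ 3 + c1 * (c ^ 2 * c') + c2 * (c * c' ^ 2) + c3 * c' ^ 3) = 0)
    (h3 : w * ((d * a + κ * (d' * a')) * (d * b + κ * (d' * b')) * (d * c + κ * (d' * c')) * (d * e + κ * (d' * e'))) +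
      (c0 * d ^ 3 + c1 * (d ^ 2 * d') + c2 * (d * d' ^ 2) + c3 * d' ^ 3) = 0)
    (h4 : w * ((e * a + κ * (e' * a')) * (e * b + κ * (e' * b')) * (e * c + κ * (e' * c')) * (e * d + κ * (e' * d'))) +
      (c0 * e ^ 3 + c1 * (e ^ 2 * e') + c2 * (e * e' ^ 2) + c3 * e' ^ 3) = 0) :
    w * (κ ^ 2 * ((a * b' - a' * b) * (a * c' - a' * c) * (a * d' - a' * d) * (a * e' - a' * e) * (b * c' - b' * c) * (b * d' - b' * d) * (b * e' - b' * e) * (c * d' - c' * d) * (c * e' - c' * e) * (d * e' - d' * e))) = 0 := by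
  linear_combination (b * c' - b' * c) * (b * d' - b' * d) * (b * e' - b' * e) * (c * d' - c' * d) * (c * e' - c' * e) * (d * e' - d' * e) * h0
      - (a * c' - a' * c) * (a * d' - a' * d) * (a * e' - a' * e) * (c * d' - c' * d) * (c * e' - c' * e) * (d * e' - d' * e) * h1
      + (a * b' - a' * b) * (a * d' - a' * d) * (a * e' - a' * e) * (b * d' - b' * d) * (b * e' - b' * e) * (d * e' - d' * e) * h2
      - (a * b' - a' * b) * (a * c' - a' * c) * (a * e' - a' * e) * (b * c' - b' * c) * (b * e' - b' * e) * (c * e' - c' * e) * h3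
      + (a * b' - a' * b) * (a * c' - a' * c) * (a * d' - a' * d) * (b * c' - b' * c) * (b * d' - b' * d) * (c * d' - c' * d) * h4

theorem apply_eq_sum (f : V4 →ₗ[ℝ] V4 →ₗ[ℝ] ℝ) (x y : V4) :
    f x y = ∑ k, ∑ l, x k * (y l * f (fun j => if k = j then 1 else 0) (fun j => if l = j then 1 else 0)) := by
  rw [LinearMap.pi_apply_eq_sum_univ f x, LinearMap.sum_apply]
  refine Finset.sum_congr rfl fun k _ => ?_
  rw [LinearMap.smul_apply, LinearMap.pi_apply_eq_sum_univ (f _) y, Finset.smul_sum]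
  simp

theorem cubic_coeff_eq_zero {c0 c1 c2 c3 : ℝ} (v : Fin 4 → ℝ × ℝ)
    (hv : ∀ i j, i ≠ j → wd (v i) (v j) ≠ 0) (h : ∀ i, c0 * (v i).1 ^ 3 + c1 * ((v i).1 ^ 2 * (v i).2) +
      c2 * ((v i).1 * (v i).2 ^ 2) + c3 * (v i).2 ^ 3 = 0) : c0 = 0 ∧ c1 = 0 ∧ c2 = 0 ∧ c3 = 0 := by
  have hdet : (Matrix.projVandermonde (fun i => (v i).2) (fun i => (v i).1)).det ≠ 0 := by
    rw [Matrix.det_projVandermonde, Finset.prod_ne_zero_iff]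
    refine fun i _ => Finset.prod_ne_zero_iff.2 fun j hj => ?_
    have := hv i j (Finset.mem_Ioi.1 hj).ne
    rw [wd] at this
    intro h0
    exact this (by linear_combination h0)
  have := Matrix.eq_zero_of_mulVec_eq_zero hdet (v := ![c0, c1, c2, c3]) (by
    ext i
    have := h i
    simp [Matrix.mulVec, dotProduct, Fin.sum_univ_four, Matrix.projVandermonde_apply, Fin.rev]
    linear_combination this)
  exact ⟨congrFun this 0, congrFun this 1, congrFun this 2, congrFun this 3⟩

/-- No nonzero alternating form vanishes on the lines of a normal form. -/
theorem alternating_eq_zero_of_nf {κ : ℝ} (hκ : κ ^ 2 = 1) {v : Fin 5 → ℝ × ℝ} (hv : Valid κ v)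
    {f : V4 →ₗ[ℝ] V4 →ₗ[ℝ] ℝ} (hf : ∀ x, f x x = 0) (h : ∀ i, f (nf κ v i).1 (nf κ v i).2 = 0) :
    f = 0 := by
  set F : Fin 4 → Fin 4 → ℝ := fun k l =>
    f (fun j => if k = j then 1 else 0) (fun j => if l = j then 1 else 0) with hF
  have hexp : ∀ x y, f x y = ∑ k, ∑ l, x k * (y l * F k l) := apply_eq_sum f
  have hd : ∀ k, F k k = 0 := fun k => hf _
  have ha : ∀ k l, F l k = - F k l := fun k l => by
    have := hf ((fun j => if k = j then 1 else 0) + (fun j => if l = j then 1 else 0))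
    simp only [map_add, LinearMap.add_apply, hf] at this
    simp only [hF]
    linarith
  have e : ∀ x y, f x y = (x 0 * y 1 - x 1 * y 0) * F 0 1 + (x 0 * y 2 - x 2 * y 0) * F 0 2 +
      (x 0 * y 3 - x 3 * y 0) * F 0 3 + (x 1 * y 2 - x 2 * y 1) * F 1 2 +
      (x 1 * y 3 - x 3 * y 1) * F 1 3 + (x 2 * y 3 - x 3 * y 2) * F 2 3 := fun x y => by
    rw [hexp]
    simp only [Fin.sum_univ_four, hd, ha 0 1, ha 0 2, ha 0 3, ha 1 2, ha 1 3, ha 2 3]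
    ring
  have h23 : F 2 3 = 0 := by
    have := h (Fin.last 5)
    rw [nf_last, e] at this
    simpa [vec] using this
  have key : ∀ i, F 0 1 * mu κ v i + 2 * (F 1 3 * (v i).1 ^ 3 + (-κ * F 0 3 - 2 * F 1 2) *
      ((v i).1 ^ 2 * (v i).2) + (2 * κ * F 0 2 - κ * F 1 3) * ((v i).1 * (v i).2 ^ 2) +
      F 0 3 * (v i).2 ^ 3) = 0 := fun i => by
    have h1 := h i.castSucc
    rw [nf_castSucc, e, h23] at h1
    simp [linePair, vec, sg, wf] at h1
    refine (mul_eq_zero.1 (?_ : ((v i).1 ^ 2 + (v i).2 ^ 2) * _ = 0)).resolve_left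
      (normSq_pos (hv.ne_zero i)).ne'
    rcases sq_eq_one_iff.1 hκ with rfl | rfl <;> linear_combination h1
  have h01 : F 0 1 = 0 := by
    have h2 := fun i => key i
    simp only [mul_add, mu, bf, Fin.prod_univ_five] at h2
    have h3 := lagrange_cubic κ (F 0 1) (2 * F 1 3) (2 * (-κ * F 0 3 - 2 * F 1 2))
      (2 * (2 * κ * F 0 2 - κ * F 1 3)) (2 * F 0 3) (v 0).1 (v 0).2 (v 1).1 (v 1).2 (v 2).1 (v 2).2
      (v 3).1 (v 3).2 (v 4).1 (v 4).2
      (by have := h2 0; simp at this; linear_combination this)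
      (by have := h2 1; simp at this; linear_combination this)
      (by have := h2 2; simp at this; linear_combination this)
      (by have := h2 3; simp at this; linear_combination this)
      (by have := h2 4; simp at this; linear_combination this)
    refine (mul_eq_zero.1 h3).resolve_right ?_
    rw [hκ, one_mul]
    simp only [mul_eq_zero, not_or, and_assoc]
    refine ⟨(hv _ _ ?_).1, (hv _ _ ?_).1, (hv _ _ ?_).1, (hv _ _ ?_).1, (hv _ _ ?_).1, (hv _ _ ?_).1,
      (hv _ _ ?_).1, (hv _ _ ?_).1, (hv _ _ ?_).1, (hv _ _ ?_).1⟩ <;> decide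
  have hcub : ∀ i, F 1 3 * (v i).1 ^ 3 + (-κ * F 0 3 - 2 * F 1 2) * ((v i).1 ^ 2 * (v i).2) +
      (2 * κ * F 0 2 - κ * F 1 3) * ((v i).1 * (v i).2 ^ 2) + F 0 3 * (v i).2 ^ 3 = 0 := fun i => by
    have := key i
    rw [h01] at this
    linarith
  have hco : F 1 3 = 0 ∧ (-κ * F 0 3 - 2 * F 1 2) = 0 ∧ (2 * κ * F 0 2 - κ * F 1 3) = 0 ∧ F 0 3 = 0 :=
    cubic_coeff_eq_zero (fun i : Fin 4 => v i.castSucc)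
      (fun i j hij => (hv _ _ ((Fin.castSucc_injective _).ne hij)).1) fun i => hcub _
  have hκ0 : κ ≠ 0 := by rintro rfl; norm_num at hκ
  obtain ⟨h13, h12, h02, h03⟩ := hco
  have h12' : F 1 2 = 0 := by rw [h03] at h12; linarith
  have h02' : F 0 2 = 0 := by
    rw [h13] at h02
    have : κ * F 0 2 = 0 := by linarith
    exact (mul_eq_zero.1 this).resolve_left hκ0
  refine LinearMap.ext fun x => LinearMap.ext fun y => ?_
  rw [e, h23, h01, h13, h12', h02', h03]
  simp

/-- Plücker coordinates. -/
def pluecker (u : V4 × V4) : Fin 6 → ℝ :=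
  ![u.1 0 * u.2 1 - u.1 1 * u.2 0, u.1 0 * u.2 2 - u.1 2 * u.2 0, u.1 0 * u.2 3 - u.1 3 * u.2 0,
    u.1 1 * u.2 2 - u.1 2 * u.2 1, u.1 1 * u.2 3 - u.1 3 * u.2 1, u.1 2 * u.2 3 - u.1 3 * u.2 2]

noncomputable def plueckerForm (ω : Fin 6 → ℝ) : V4 →ₗ[ℝ] V4 →ₗ[ℝ] ℝ :=
  LinearMap.mk₂ ℝ (fun x y => ∑ k, pluecker (x, y) k * ω k)
    (fun x x' y => by simp [pluecker, Fin.sum_univ_six]; ring)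
    (fun c x y => by simp [pluecker, Fin.sum_univ_six]; ring)
    (fun x y y' => by simp [pluecker, Fin.sum_univ_six]; ring)
    (fun c x y => by simp [pluecker, Fin.sum_univ_six]; ring)

theorem plueckerForm_apply (ω : Fin 6 → ℝ) (x y : V4) :
    plueckerForm ω x y = ∑ k, pluecker (x, y) k * ω k := rfl

theorem plueckerForm_self (ω : Fin 6 → ℝ) (x : V4) : plueckerForm ω x x = 0 := by
  simp [plueckerForm_apply, pluecker, Fin.sum_univ_six, mul_comm]

theorem eq_zero_of_plueckerForm {ω : Fin 6 → ℝ} (h : plueckerForm ω = 0) : ω = 0 := by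
  have key : ∀ x y, ∑ k, pluecker (x, y) k * ω k = 0 := fun x y => by
    rw [← plueckerForm_apply, h]; rfl
  funext k
  fin_cases k
  · simpa [pluecker, Fin.sum_univ_six] using key ![1, 0, 0, 0] ![0, 1, 0, 0]
  · simpa [pluecker, Fin.sum_univ_six] using key ![1, 0, 0, 0] ![0, 0, 1, 0]
  · simpa [pluecker, Fin.sum_univ_six] using key ![1, 0, 0, 0] ![0, 0, 0, 1]
  · simpa [pluecker, Fin.sum_univ_six] using key ![0, 1, 0, 0] ![0, 0, 1, 0]
  · simpa [pluecker, Fin.sum_univ_six] using key ![0, 1, 0, 0] ![0, 0, 0, 1]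
  · simpa [pluecker, Fin.sum_univ_six] using key ![0, 0, 1, 0] ![0, 0, 0, 1]

theorem alternating_vanish {f : V4 →ₗ[ℝ] V4 →ₗ[ℝ] ℝ} (hf : ∀ x, f x x = 0) {u : V4 × V4}
    (h : f u.1 u.2 = 0) {x y : V4} (hx : x ∈ ln u) (hy : y ∈ ln u) : f x y = 0 := by
  obtain ⟨a, b, rfl⟩ := mem_ln.1 hx
  obtain ⟨c, d, rfl⟩ := mem_ln.1 hy
  have h' : f u.2 u.1 = 0 := by
    have := hf (u.1 + u.2)
    simp only [map_add, LinearMap.add_apply, hf, h] at this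
    simpa using this
  simp [hf, h, h']

noncomputable def plueckerDet (u : Fin 6 → V4 × V4) : ℝ :=
  Matrix.det (Matrix.of fun i => pluecker (u i))

/-- The lines of a Schläfli six do not belong to a linear complex. -/
theorem plueckerDet_ne_zero {u : Fin 6 → V4 × V4} (hu : u ∈ SixBases) : plueckerDet u ≠ 0 := by
  intro h0
  obtain ⟨ω, hω, h⟩ := Matrix.exists_mulVec_eq_zero_iff.2 h0
  have hL : IsSchlafliSix (lines u) := hu
  obtain ⟨π, M, κ, v, hM, hκ, hv, hN⟩ := hL.exists_nf
  refine hω (eq_zero_of_plueckerForm ?_)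
  set g := (plueckerForm ω).compl₁₂ (Matrix.mulVecLin M) (Matrix.mulVecLin M) with hg
  have hg0 : g = 0 := by
    refine alternating_eq_zero_of_nf hκ hv (fun x => plueckerForm_self ω _) fun i => ?_
    have hi : (lines u ∘ π) i = ln (M.mulVec (nf κ v i).1, M.mulVec (nf κ v i).2) := by
      rw [hN, act_lines]; rfl
    refine alternating_vanish (plueckerForm_self ω) (u := u (π i)) (congrFun h (π i)) ?_ ?_
    · change _ ∈ (lines u ∘ π) i
      rw [hi]
      exact mem_ln.2 ⟨1, 0, by simp⟩
    · change _ ∈ (lines u ∘ π) i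
      rw [hi]
      exact mem_ln.2 ⟨0, 1, by simp⟩
  have hMu : IsUnit M.det := isUnit_iff_ne_zero.2 hM
  refine LinearMap.ext fun x => LinearMap.ext fun y => ?_
  have := LinearMap.congr_fun (LinearMap.congr_fun hg0 (M⁻¹.mulVec x)) (M⁻¹.mulVec y)
  simpa [hg, Matrix.mulVec_mulVec, Matrix.mul_nonsing_inv _ hMu] using this

noncomputable def pairing (u : Fin 6 → V4 × V4) (i j : Fin 6) : ℝ :=
  det2 (u i).1 (u i).2 (u j).1 (u j).2

theorem pairing_ne_zero {u : Fin 6 → V4 × V4} (hu : u ∈ SixBases) {i j : Fin 6} (hij : i ≠ j) :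
    pairing u i j ≠ 0 := (skew_ln_iff_det _ _).1 (hu.1 i j hij)

theorem continuous_pairing (i j : Fin 6) : Continuous fun u => pairing u i j := by
  unfold pairing det2
  refine Continuous.matrix_det (continuous_matrix fun k l => ?_)
  fin_cases k <;> simp <;> fun_prop

theorem continuous_plueckerDet : Continuous plueckerDet := by
  unfold plueckerDet
  refine Continuous.matrix_det (continuous_matrix fun k l => ?_)
  fin_cases l <;> simp [pluecker] <;> fun_prop

theorem mul_pos_of_sign_eq {a b : ℝ} (h : SignType.sign a = SignType.sign b) (ha : a ≠ 0) : 0 < a * b := by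
  rcases lt_or_gt_of_ne ha with h1 | h1
  · rw [sign_neg h1] at h
    exact mul_pos_of_neg_of_neg h1 (sign_eq_neg_one_iff.1 h.symm)
  · rw [sign_pos h1] at h
    exact mul_pos h1 (sign_eq_one_iff.1 h.symm)

theorem exists_scale {u w : Fin 6 → V4 × V4} (hu : u ∈ SixBases) {π : Equiv.Perm (Fin 6)}
    (h : lines u = lines w ∘ π) : ∃ δ : Fin 6 → ℝ, (∀ i, δ i ≠ 0) ∧
      (∀ i j, pairing u i j = δ i * δ j * pairing w (π i) (π j)) ∧
      plueckerDet u = (∏ i, δ i) * (Equiv.Perm.sign π : ℤ) * plueckerDet w := by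
  have hc : ∀ i, ∃ a b c d : ℝ, a * d - b * c ≠ 0 ∧ (u i).1 = a • (w (π i)).1 + b • (w (π i)).2 ∧
      (u i).2 = c • (w (π i)).1 + d • (w (π i)).2 := fun i =>
    exists_comb_of_ln_eq (IsSchlafliSix.isLine hu i) (congrFun h i)
  choose a b c d hne h1 h2 using hc
  refine ⟨fun i => a i * d i - b i * c i, hne, fun i j => ?_, ?_⟩
  · simp only [pairing, h1, h2]
    simp [det2, Matrix.det_succ_row_zero, Fin.sum_univ_succ, Fin.succAbove]
    ring
  · have e1 : (Matrix.of fun i => pluecker (u i)) = Matrix.of fun i j =>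
        (a i * d i - b i * c i) * (((Matrix.of fun i => pluecker (w i)).submatrix π id) i j) := by
      ext i j
      simp only [Matrix.of_apply, Matrix.submatrix_apply, id, pluecker, h1, h2]
      fin_cases j <;> simp <;> ring
    rw [plueckerDet, e1, Matrix.det_mul_column, Matrix.det_permute, plueckerDet]
    ring

theorem exists_int_sign {x : ℝ} (hx : x ≠ 0) : ∃ e : ℤ, (e = 1 ∨ e = -1) ∧ 0 < (e : ℝ) * x := by
  rcases lt_or_gt_of_ne hx with h | h
  · exact ⟨-1, Or.inr rfl, by push_cast; linarith⟩
  · exact ⟨1, Or.inl rfl, by push_cast; linarith⟩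

theorem mul_pos_of_mul_pos_left {d x e : ℝ} (h1 : 0 < d * x) (h2 : 0 < e * d) : 0 < e * x := by
  have h := mul_pos h1 h2
  have hd : 0 < d ^ 2 := by
    have : d ≠ 0 := fun h0 => by simp [h0] at h1
    positivity
  refine pos_of_mul_pos_right (b := e * x) (a := d ^ 2) ?_ hd.le
  linarith

theorem SchlafliDeformation.exists_signs {w w' : Fin 6 → V4 × V4}
    (h : SchlafliDeformation (lines w) (lines w')) :
    ∃ (τ : Equiv.Perm (Fin 6)) (ε : Fin 6 → ℤ), (∀ i, ε i = 1 ∨ ε i = -1) ∧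
      (∀ i j, i ≠ j → 0 < (ε i * ε j : ℝ) * (pairing w (τ i) (τ j) * pairing w' i j)) ∧
      0 < (((∏ i, ε i) * Equiv.Perm.sign τ : ℤ) : ℝ) * (plueckerDet w * plueckerDet w') := by
  obtain ⟨π, π', u, u', hJ, hu, hu'⟩ := schlafliDeformation_iff.1 h
  obtain ⟨δ, hδ, hp, hd⟩ := exists_scale hJ.source_mem hu
  obtain ⟨δ', hδ', hp', hd'⟩ := exists_scale hJ.target_mem hu'
  choose e he hepos using fun i => exists_int_sign (mul_ne_zero (hδ i) (hδ' i))
  refine ⟨π'.symm.trans π, fun i => e (π'.symm i), fun i => he _, fun i j hij => ?_, ?_⟩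
  · have hij' : π'.symm i ≠ π'.symm j := π'.symm.injective.ne hij
    have h1 := mul_pos_of_sign_eq (hJ.sign_eq (continuous_pairing (π'.symm i) (π'.symm j))
      fun x hx => pairing_ne_zero hx hij') (pairing_ne_zero hJ.source_mem hij')
    rw [hp, hp'] at h1
    simp only [Equiv.apply_symm_apply] at h1
    have h2 := mul_pos (hepos (π'.symm i)) (hepos (π'.symm j))
    refine mul_pos_of_mul_pos_left
      (d := δ (π'.symm i) * δ' (π'.symm i) * (δ (π'.symm j) * δ' (π'.symm j))) ?_ ?_
    · simp only [Equiv.trans_apply]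
      linarith
    · linarith
  · have h1 := mul_pos_of_sign_eq (hJ.sign_eq continuous_plueckerDet
      fun x hx => plueckerDet_ne_zero hx) (plueckerDet_ne_zero hJ.source_mem)
    rw [hd, hd'] at h1
    have h2 : 0 < ∏ i, (e i : ℝ) * (δ i * δ' i) := Finset.prod_pos fun i _ => hepos i
    rw [Finset.prod_mul_distrib, Finset.prod_mul_distrib] at h2
    rw [Equiv.prod_comp π'.symm e]
    have hs : (((Equiv.Perm.sign (π'.symm.trans π) : ℤˣ) : ℤ) : ℝ) =
        ((Equiv.Perm.sign π : ℤˣ) : ℤ) * ((Equiv.Perm.sign π' : ℤˣ) : ℤ) := by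
      simp [Equiv.Perm.sign_trans]
    have hsq : ∀ σ : Equiv.Perm (Fin 6), (((Equiv.Perm.sign σ : ℤˣ) : ℤ) : ℝ) ^ 2 = 1 := fun σ => by
      rcases Int.units_eq_one_or (Equiv.Perm.sign σ) with h | h <;> simp [h]
    push_cast
    rw [hs]
    refine mul_pos_of_mul_pos_left (d := (∏ i, δ i) * (∏ i, δ' i) * (((Equiv.Perm.sign π : ℤˣ) : ℤ) *
      ((Equiv.Perm.sign π' : ℤˣ) : ℤ))) (by linarith) ?_
    have e2 : (∏ i, (e i : ℝ)) * (((Equiv.Perm.sign π : ℤˣ) : ℤ) * ((Equiv.Perm.sign π' : ℤˣ) : ℤ)) *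
      ((∏ i, δ i) * (∏ i, δ' i) * (((Equiv.Perm.sign π : ℤˣ) : ℤ) *
      ((Equiv.Perm.sign π' : ℤˣ) : ℤ))) = (∏ i, (e i : ℝ)) * ((∏ i, δ i) * ∏ i, δ' i) := by
      linear_combination (∏ i, (e i : ℝ)) * ((∏ i, δ i) * ∏ i, δ' i) *
        ((((Equiv.Perm.sign π : ℤˣ) : ℤ) : ℝ) ^ 2 * hsq π' + hsq π)
    rw [e2]; exact h2

/-- The matrix `M` records the signs of the pairings of `w`. -/
def SignedBy (w : Fin 6 → V4 × V4) (M : Fin 6 → Fin 6 → ℤ) : Prop :=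
  ∀ i j, i ≠ j → (M i j = 1 ∨ M i j = -1) ∧ 0 < pairing w i j * M i j

theorem int_sign_eq {e f m n : ℤ} {x y : ℝ} (he : e = 1 ∨ e = -1) (hf : f = 1 ∨ f = -1)
    (hm : m = 1 ∨ m = -1) (hn : n = 1 ∨ n = -1) (h : 0 < (e * f : ℝ) * (x * y))
    (hx : 0 < x * m) (hy : 0 < y * n) : n = e * f * m := by
  have h1 : 0 < (e * f * m * n : ℝ) := by
    refine pos_of_mul_pos_right (a := (x * y) ^ 2) ?_ (sq_nonneg _)
    linarith [mul_pos h (mul_pos hx hy)]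
  rcases he with rfl | rfl <;> rcases hf with rfl | rfl <;> rcases hm with rfl | rfl <;>
    rcases hn with rfl | rfl <;> first | rfl | norm_num at h1

theorem SchlafliDeformation.exists_signedBy {w w' : Fin 6 → V4 × V4}
    {M M' : Fin 6 → Fin 6 → ℤ} (h : SchlafliDeformation (lines w) (lines w'))
    (hw : SignedBy w M) (hw' : SignedBy w' M') :
    ∃ (τ : Equiv.Perm (Fin 6)) (ε : Fin 6 → ℤ), (∀ i, ε i = 1 ∨ ε i = -1) ∧
      (∀ i j, i ≠ j → M' i j = ε i * ε j * M (τ i) (τ j)) ∧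
      0 < (((∏ i, ε i) * Equiv.Perm.sign τ : ℤ) : ℝ) * (plueckerDet w * plueckerDet w') := by
  obtain ⟨τ, ε, hε, hM, hd⟩ := h.exists_signs
  refine ⟨τ, ε, hε, fun i j hij => ?_, hd⟩
  have hτ : τ i ≠ τ j := τ.injective.ne hij
  exact int_sign_eq (hε i) (hε j) (hw _ _ hτ).1 (hw' _ _ hij).1 (hM i j hij) (hw _ _ hτ).2
    (hw' _ _ hij).2

theorem pairing_comm (u : Fin 6 → V4 × V4) (i j : Fin 6) : pairing u i j = pairing u j i := by
  simp [pairing, det2, Matrix.det_succ_row_zero, Fin.sum_univ_succ, Fin.succAbove]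
  ring

theorem signedBy_nf {κ : ℝ} (hκ : κ ^ 2 = 1) {v : Fin 5 → ℝ × ℝ} (hv : Valid κ v)
    {M : Fin 6 → Fin 6 → ℤ} (hM : ∀ i j, M i j = M j i)
    (h1 : ∀ i j, i ≠ j → M i j = 1 ∨ M i j = -1)
    (h : ∀ i j : Fin 5, i < j → 0 < -(κ * bf κ (v i) (v j)) * M i.castSucc j.castSucc)
    (hl : ∀ i : Fin 5, 0 < mu κ v i * M i.castSucc (Fin.last 5)) : SignedBy (nf κ v) M := by
  have key : ∀ i j : Fin 6, i < j → 0 < pairing (nf κ v) i j * M i j := by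
    intro i j hij
    obtain ⟨i, rfl⟩ := Fin.exists_castSucc_eq.2 (Fin.ne_last_of_lt hij)
    have hi := normSq_pos (hv.ne_zero i)
    induction j using Fin.lastCases with
    | last =>
      rw [pairing, det2_nf_last hκ]
      linarith [mul_pos (hl i) hi]
    | cast j =>
      have hij' : i < j := Fin.castSucc_lt_castSucc_iff.1 hij
      rw [pairing, det2_nf]
      have hj := normSq_pos (hv.ne_zero j)
      have hw : 0 < wd (v i) (v j) ^ 2 := by
        have := (hv i j hij'.ne).1
        positivity
      linarith [mul_pos (mul_pos (mul_pos (h i j hij') hi) hj) hw]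
  intro i j hij
  refine ⟨h1 i j hij, ?_⟩
  rcases lt_or_gt_of_ne hij with h | h
  · exact key i j h
  · rw [pairing_comm, hM]
    exact key j i h

/-- Representatives of the deformation classes of Schläfli sixes. -/
noncomputable def sixRep : Fin 7 → Fin 6 → V4 × V4 :=
  ![nf (-1) (hyperRep 1 1 1), nf (-1) (hyperRep (-1) (-1) (-1)), nf (-1) (hyperRep 1 (-1) 1),
    nf (-1) (hyperRep (-1) 1 (-1)), nf (-1) (hyperRep 1 1 (-1)),
    nf 1 (ellRep ![false, true, false, true, false]), fun i =>
      (Refl.mulVec (nf 1 (ellRep ![false, true, false, true, false]) i).1,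
        Refl.mulVec (nf 1 (ellRep ![false, true, false, true, false]) i).2)]

/-- The signs of the elliptic representative. -/
def ellSign : Fin 6 → Fin 6 → ℤ :=
  ![![0, 1, -1, 1, -1, 1], ![1, 0, -1, -1, -1, -1], ![-1, -1, 0, 1, -1, -1], ![1, -1, 1, 0, -1, 1], ![-1, -1, -1, -1, 0, 1], ![1, -1, -1, 1, 1, 0]]

def sixSign : Fin 7 → Fin 6 → Fin 6 → ℤ :=
  ![![![0, 1, 1, 1, 1, 1], ![1, 0, 1, 1, 1, 1], ![1, 1, 0, 1, 1, 1], ![1, 1, 1, 0, 1, 1], ![1, 1, 1, 1, 0, 1], ![1, 1, 1, 1, 1, 0]],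
    ![![0, -1, -1, -1, 1, -1], ![-1, 0, -1, -1, 1, -1], ![-1, -1, 0, -1, 1, -1], ![-1, -1, -1, 0, 1, -1], ![1, 1, 1, 1, 0, 1], ![-1, -1, -1, -1, 1, 0]],
    ![![0, 1, -1, 1, 1, -1], ![1, 0, -1, 1, 1, -1], ![-1, -1, 0, 1, 1, 1], ![1, 1, 1, 0, 1, 1], ![1, 1, 1, 1, 0, 1], ![-1, -1, 1, 1, 1, 0]],
    ![![0, -1, 1, -1, 1, 1], ![-1, 0, 1, -1, 1, 1], ![1, 1, 0, -1, 1, -1], ![-1, -1, -1, 0, 1, -1], ![1, 1, 1, 1, 0, 1], ![1, 1, -1, -1, 1, 0]],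
    ![![0, 1, 1, -1, 1, -1], ![1, 0, 1, -1, 1, -1], ![1, 1, 0, -1, 1, -1], ![-1, -1, -1, 0, 1, -1], ![1, 1, 1, 1, 0, 1], ![-1, -1, -1, -1, 1, 0]], ellSign, -ellSign]

theorem hyperRep_apply (a b c : ℝ) : hyperRep a b c =
    ![(1 / 2, 1 / 2), ((1 + a) / 2, (1 - a) / 2), ((1 + 2 * b) / 2, (1 - 2 * b) / 2),
      ((1 + 3 * c) / 2, (1 - 3 * c) / 2), (1 / 2, -1 / 2)] := by
  simp [hyperRep, hyperVec]

theorem forall_lt_fin_five {p : Fin 5 → Fin 5 → Prop} (h01 : p 0 1) (h02 : p 0 2) (h03 : p 0 3)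
    (h04 : p 0 4) (h12 : p 1 2) (h13 : p 1 3) (h14 : p 1 4) (h23 : p 2 3) (h24 : p 2 4) (h34 : p 3 4) :
    ∀ i j, i < j → p i j := by
  intro i j hij
  fin_cases i <;> fin_cases j <;> first | assumption | exact absurd hij (by decide)

theorem signedBy_hyperRep {a b c : ℝ} (ha : a ^ 2 = 1) (hb : b ^ 2 = 1) (hc : c ^ 2 = 1)
    {M : Fin 6 → Fin 6 → ℤ} (hM : ∀ i j, M i j = M j i)
    (h1 : ∀ i j, i ≠ j → M i j = 1 ∨ M i j = -1)
    (h : ∀ i j : Fin 5, i < j →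
      0 < bf (-1) (hyperRep a b c i) (hyperRep a b c j) * M i.castSucc j.castSucc)
    (hl : ∀ i : Fin 5, 0 < mu (-1) (hyperRep a b c) i * M i.castSucc (Fin.last 5)) :
    SignedBy (nf (-1) (hyperRep a b c)) M :=
  signedBy_nf (by norm_num) (hyperOrdered_hyperRep ha hb hc).valid hM h1
    (fun i j hij => by simpa using h i j hij) hl

theorem sixSign_symm (k : Fin 7) (i j : Fin 6) : sixSign k i j = sixSign k j i := by
  revert k i j; decide

theorem sixSign_sq (k : Fin 7) (i j : Fin 6) (h : i ≠ j) :
    sixSign k i j = 1 ∨ sixSign k i j = -1 := by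
  revert k i j; decide

theorem signedBy_sixRep_hyper : SignedBy (sixRep 0) (sixSign 0) ∧ SignedBy (sixRep 1) (sixSign 1) ∧
    SignedBy (sixRep 2) (sixSign 2) ∧ SignedBy (sixRep 3) (sixSign 3) ∧
    SignedBy (sixRep 4) (sixSign 4) := by
  refine ⟨?_, ?_, ?_, ?_, ?_⟩
  all_goals
    refine signedBy_hyperRep (by norm_num) (by norm_num) (by norm_num) (sixSign_symm _)
      (sixSign_sq _) (forall_lt_fin_five ?_ ?_ ?_ ?_ ?_ ?_ ?_ ?_ ?_ ?_) fun i => ?_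
  all_goals try fin_cases i
  all_goals simp [hyperRep_apply, mu, bf, sixSign, Fin.prod_univ_succ] <;> norm_num

theorem ellRep_apply : ellRep ![false, true, false, true, false] =
    ![(1, 0), (-1, 1), (1, 2), (-3, 1), (1, 4)] := by
  ext i <;> fin_cases i <;> simp [ellRep, ellVec]

theorem signedBy_sixRep_ell : SignedBy (sixRep 5) (sixSign 5) := by
  refine signedBy_nf (by norm_num) (valid_ellRep _) (sixSign_symm _)
      (sixSign_sq _) (forall_lt_fin_five ?_ ?_ ?_ ?_ ?_ ?_ ?_ ?_ ?_ ?_) fun i => ?_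
  all_goals try fin_cases i
  all_goals simp [ellRep_apply, mu, bf, sixSign, ellSign, Fin.prod_univ_succ] <;> norm_num

theorem Refl_mulVec (x : V4) : Refl.mulVec x = ![x 0, x 1, x 2, -x 3] := by
  ext i; fin_cases i <;> simp [Refl, Matrix.mulVec_diagonal]

theorem pairing_Refl (u : Fin 6 → V4 × V4) (i j : Fin 6) :
    pairing (fun i => (Refl.mulVec (u i).1, Refl.mulVec (u i).2)) i j = -pairing u i j := by
  simp only [pairing, Refl_mulVec]
  simp [det2, Matrix.det_succ_row_zero, Fin.sum_univ_succ, Fin.succAbove]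
  ring

theorem plueckerDet_Refl (u : Fin 6 → V4 × V4) :
    plueckerDet (fun i => (Refl.mulVec (u i).1, Refl.mulVec (u i).2)) = -plueckerDet u := by
  have e : (Matrix.of fun i => pluecker (Refl.mulVec (u i).1, Refl.mulVec (u i).2)) =
      Matrix.of fun i j => (![1, 1, -1, 1, -1, -1] : Fin 6 → ℝ) j *
        (Matrix.of fun i => pluecker (u i)) i j := by
    ext i j
    simp only [Refl_mulVec, pluecker, Matrix.of_apply]
    fin_cases j <;> simp <;> ring
  rw [plueckerDet, e, Matrix.det_mul_row, plueckerDet]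
  simp [Fin.prod_univ_succ]

theorem signedBy_sixRep (k : Fin 7) : SignedBy (sixRep k) (sixSign k) := by
  obtain ⟨h0, h1, h2, h3, h4⟩ := signedBy_sixRep_hyper
  fin_cases k
  · exact h0
  · exact h1
  · exact h2
  · exact h3
  · exact h4
  · exact signedBy_sixRep_ell
  · intro i j hij
    refine ⟨sixSign_sq 6 i j hij, ?_⟩
    have := (signedBy_sixRep_ell i j hij).2
    change 0 < pairing (fun i => (Refl.mulVec (sixRep 5 i).1, Refl.mulVec (sixRep 5 i).2)) i j *
      ((-sixSign 5 i j : ℤ) : ℝ)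
    rw [pairing_Refl]
    push_cast
    linarith

def tripleSum (M : Fin 6 → Fin 6 → ℤ) (i : Fin 6) : ℤ := ∑ j, ∑ k, M i j * M i k * M j k

theorem tripleSum_eq {M M' : Fin 6 → Fin 6 → ℤ} {τ : Equiv.Perm (Fin 6)} {ε : Fin 6 → ℤ}
    (hε : ∀ i, ε i = 1 ∨ ε i = -1) (h : ∀ i j, M' i j = ε i * ε j * M (τ i) (τ j)) (i : Fin 6) :
    tripleSum M' i = tripleSum M (τ i) := by
  have hsq : ∀ i, ε i ^ 2 = 1 := fun i => by rcases hε i with h | h <;> simp [h]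
  rw [tripleSum, tripleSum, ← Equiv.sum_comp τ fun j => ∑ k, M (τ i) j * M (τ i) k * M j k]
  refine Finset.sum_congr rfl fun j _ => ?_
  rw [← Equiv.sum_comp τ fun k => M (τ i) (τ j) * M (τ i) k * M (τ j) k]
  refine Finset.sum_congr rfl fun k _ => ?_
  rw [h, h, h]
  linear_combination M (τ i) (τ j) * M (τ i) (τ k) * M (τ j) (τ k) *
    (ε j ^ 2 * ε k ^ 2 * hsq i + ε k ^ 2 * hsq j + hsq k)

def signInvariant (k : Fin 7) : ℤ × ℤ :=
  (∑ i, tripleSum (sixSign k) i, ∑ i, tripleSum (sixSign k) i ^ 2)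

theorem signInvariant_eq {k l : Fin 7} (h : SchlafliDeformation (lines (sixRep k)) (lines (sixRep l))) :
    signInvariant k = signInvariant l := by
  obtain ⟨τ, ε, hε, hM, -⟩ := h.exists_signedBy (signedBy_sixRep k) (signedBy_sixRep l)
  have h0 : ∀ (k : Fin 7) (i : Fin 6), sixSign k i i = 0 := by decide
  have hT := tripleSum_eq hε (M := sixSign k) (M' := sixSign l) (τ := τ) fun i j => by
    rcases eq_or_ne i j with rfl | hij
    · simp [h0]
    · exact hM i j hij
  simp only [signInvariant, hT]
  rw [Equiv.sum_comp τ, Equiv.sum_comp τ fun i => tripleSum (sixSign k) i ^ 2]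

theorem signInvariant_injOn {k l : Fin 7} (h : signInvariant k = signInvariant l) (hkl : k ≠ l) :
    (k = 5 ∧ l = 6) ∨ (k = 6 ∧ l = 5) := by
  revert k l
  have e : signInvariant = ![(120, 2400), (-120, 2400), (24, 96), (-24, 96), (0, 384), (0, 0), (0, 0)] := by
    decide +kernel
  rw [e]; decide

def switching (τ : Equiv.Perm (Fin 6)) (j : Fin 6) : ℤ :=
  if j = 0 then 1 else -(ellSign 0 j * ellSign (τ 0) (τ j))

theorem prod_switching (τ : Equiv.Perm (Fin 6)) :
    (∀ i j : Fin 6, i < j → -ellSign i j = switching τ i * switching τ j * ellSign (τ i) (τ j)) →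
    (∏ i, switching τ i) * Equiv.Perm.sign τ = 1 := by
  revert τ
  decide +kernel

theorem ellSign_sq (i j : Fin 6) (h : i ≠ j) : ellSign i j ^ 2 = 1 := by
  revert i j; decide

theorem not_schlafliDeformation_Refl :
    ¬ SchlafliDeformation (lines (sixRep 5)) (lines (sixRep 6)) := by
  intro h
  obtain ⟨τ, ε, hε, hM, hd⟩ := h.exists_signedBy (signedBy_sixRep 5) (signedBy_sixRep 6)
  replace hM : ∀ i j, i ≠ j → -ellSign i j = ε i * ε j * ellSign (τ i) (τ j) := hM
  have hsq : ∀ i, ε i ^ 2 = 1 := fun i => by rcases hε i with h | h <;> simp [h]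
  have hs : ∀ i, switching τ i = ε 0 * ε i := by
    intro i
    rw [switching]
    split_ifs with hi
    · rw [hi]; linarith [hsq 0]
    · have h1 := hM 0 i (Ne.symm hi)
      have h2 := ellSign_sq (τ 0) (τ i) (τ.injective.ne (Ne.symm hi))
      linear_combination ellSign (τ 0) (τ i) * h1 + ε 0 * ε i * h2
  have h1 := prod_switching τ fun i j hij => by
    rw [hs, hs, hM i j hij.ne]
    linear_combination -(ε i * ε j * ellSign (τ i) (τ j)) * hsq 0
  have h2 : ∏ i, switching τ i = ∏ i, ε i := by
    simp only [hs, Finset.prod_mul_distrib, Finset.prod_const, Finset.card_univ, Fintype.card_fin]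
    rw [show ε 0 ^ 6 = (ε 0 ^ 2) ^ 3 by ring, hsq]
    ring
  rw [← h2, h1] at hd
  have h3 : plueckerDet (sixRep 6) = -plueckerDet (sixRep 5) := plueckerDet_Refl _
  rw [h3] at hd
  push_cast at hd
  nlinarith [sq_nonneg (plueckerDet (sixRep 5))]

theorem isSchlafliSix_sixRep (k : Fin 7) : IsSchlafliSix (lines (sixRep k)) := by
  have hh : ∀ {a b c : ℝ}, a ^ 2 = 1 → b ^ 2 = 1 → c ^ 2 = 1 →
      IsSchlafliSix (lines (nf (-1) (hyperRep a b c))) := fun ha hb hc =>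
    isSchlafliSix_nf (by norm_num) (hyperOrdered_hyperRep ha hb hc).valid
  have he : IsSchlafliSix (lines (sixRep 5)) := isSchlafliSix_nf (by norm_num) (valid_ellRep _)
  fin_cases k
  iterate 5 exact hh (by norm_num) (by norm_num) (by norm_num)
  · exact he
  · change IsSchlafliSix (lines fun i => (Refl.mulVec (sixRep 5 i).1, Refl.mulVec (sixRep 5 i).2))
    rw [← act_lines]
    exact he.act (by rw [det_Refl]; norm_num)

theorem not_schlafliDeformation_sixRep {k l : Fin 7} (hkl : k ≠ l) :
    ¬ SchlafliDeformation (lines (sixRep k)) (lines (sixRep l)) := by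
  intro h
  rcases signInvariant_injOn (signInvariant_eq h) hkl with ⟨rfl, rfl⟩ | ⟨rfl, rfl⟩
  · exact not_schlafliDeformation_Refl h
  · exact not_schlafliDeformation_Refl h.symm

theorem IsSchlafliSix.exists_sixRep {L : Fin 6 → PLine} (hL : IsSchlafliSix L) :
    ∃ k, SchlafliDeformation L (lines (sixRep k)) := by
  rcases hL.exists_rep with h | h | h
  · rcases h.exists_rep with h | h | h | h | h
    exacts [⟨0, h⟩, ⟨1, h⟩, ⟨2, h⟩, ⟨3, h⟩, ⟨4, h⟩]
  · exact ⟨5, h⟩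
  · rw [act_lines] at h
    exact ⟨6, h⟩

theorem segre_seven_deformation_classes :
    ∃ C : Fin 7 → (Fin 6 → PLine),
      (∀ k, IsSchlafliSix (C k)) ∧
      (∀ k l, k ≠ l → ¬ SchlafliDeformation (C k) (C l)) ∧
      (∀ L : Fin 6 → PLine, IsSchlafliSix L → ∃ k, SchlafliDeformation L (C k)) := by
  exact ⟨fun k => lines (sixRep k), isSchlafliSix_sixRep, fun _ _ => not_schlafliDeformation_sixRep,
    fun _ hL => hL.exists_sixRep⟩
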